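/- arXiv:2011.05724 — 2 statements merged into one kernel-verified Lean document; each statement's English description precedes it below -/
import Mathlib

section
/- Let V ⊆ V' be an immediate extension of valuation rings containing ℚ (i.e., both are ℚ-algebras). Then V' is ind-smooth over V. -/
universe u v

/-- A ring homomorphism `f : A →+* B` is *ind-smooth* if `B` is a filtered colimit of smooth
`A`-algebras; equivalently (and this is the definition used here), every `A`-algebra homomorphism
`E → B` from a finitely presented `A`-algebra `E` factors through a smooth (i.e. finitely
presented and formally smooth) `A`-algebra. -/
def RingHom.IsIndSmooth {A : Type u} {B : Type v} [CommRing A] [CommRing B]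
    (f : A →+* B) : Prop :=
  ∀ (E : Type u) [CommRing E] [Algebra A E], Algebra.FinitePresentation A E →
    ∀ w : E →+* B, w.comp (algebraMap A E) = f →
      ∃ (S : Type u) (_ : CommRing S) (_ : Algebra A S), Algebra.Smooth A S ∧
        ∃ (g : E →ₐ[A] S) (h : S →+* B),
          h.comp g.toRingHom = w ∧ h.comp (algebraMap A S) = f

/-- The value group extension of an extension `f : V → V'` of valuation rings is *trivial* if
every nonzero element `x/y` of the fraction field of `V'` is, up to a unit of `V'`, of the form
`a/b` with `a, b` nonzero in `V`. -/
def RingHom.HasTrivialValueGroupExt {V : Type u} {V' : Type v} [CommRing V] [CommRing V']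
    (f : V →+* V') : Prop :=
  ∀ x y : V', x ≠ 0 → y ≠ 0 → ∃ a b : V, a ≠ 0 ∧ b ≠ 0 ∧ Associated (x * f b) (y * f a)

open scoped TensorProduct

/-- Every finite subset of `B` lies in a smooth `A`-subalgebra contained in `B`. -/
def IsLocallySmoothIn (A : Type*) {Ω : Type*} [CommRing A] [CommRing Ω] [Algebra A Ω]
    (B : Set Ω) : Prop :=
  ∀ T : Finset Ω, (T : Set Ω) ⊆ B →
    ∃ C : Subalgebra A Ω, (T : Set Ω) ⊆ C ∧ (C : Set Ω) ⊆ B ∧ Algebra.Smooth A C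

theorem exists_smooth_subalgebra_of_tensorProduct {A A₀ A₁ B₀ B Ω : Type u} [CommRing A]
    [CommRing A₀] [CommRing A₁] [CommRing B₀] [CommRing B] [CommRing Ω] [Algebra A A₁]
    [Algebra A₀ A₁] [Algebra A₀ B₀] [Algebra A₀ B] [Algebra A Ω] [Algebra.Smooth A A₁]
    [Algebra.Smooth A₀ B₀] (ι : A₁ →ₐ[A₀] B) (hι : Function.Injective ι)
    (j : B ⊗[A₀] B₀ →+* Ω) (hj : Function.Injective j)
    (hc : ∀ a, j (ι (algebraMap A A₁ a) ⊗ₜ 1) = algebraMap A Ω a) :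
    ∃ C : Subalgebra A Ω, (C : Set Ω) ⊆ Set.range j ∧ Algebra.Smooth A C ∧
      ∀ s : Finset (B × B₀), (∀ i ∈ s, i.1 ∈ ι.range) → j (∑ i ∈ s, i.1 ⊗ₜ[A₀] i.2) ∈ C := by
  have : Module.Flat A₀ B₀ := Algebra.Smooth.flat A₀ B₀
  let φ : A₁ ⊗[A₀] B₀ →ₐ[A₀] B ⊗[A₀] B₀ := Algebra.TensorProduct.map ι (AlgHom.id _ _)
  have hφ : Function.Injective φ :=
    Module.Flat.rTensor_preserves_injective_linearMap ι.toLinearMap hι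
  let ψ : A₁ ⊗[A₀] B₀ →ₐ[A] Ω :=
    { j.comp φ.toRingHom with
      commutes' := fun a => by
        rw [← hc, Algebra.TensorProduct.algebraMap_apply]
        rfl }
  have hψ : Function.Injective ψ := hj.comp hφ
  have : Algebra.Smooth A (A₁ ⊗[A₀] B₀) := Algebra.Smooth.comp A A₁ (A₁ ⊗[A₀] B₀)
  refine ⟨ψ.range, ?_, .of_equiv (AlgEquiv.ofInjective ψ hψ), fun s hs => ?_⟩
  · rintro _ ⟨y, rfl⟩
    exact ⟨φ y, rfl⟩
  · rw [map_sum]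
    refine sum_mem fun i hi => ?_
    obtain ⟨a, ha⟩ := hs i hi
    refine ⟨a ⊗ₜ i.2, ?_⟩
    rw [← ha]
    rfl

theorem IsLocallySmoothIn.trans {Ω : Type u} [CommRing Ω] {A B : Subring Ω} {D : Set Ω}
    (h1 : IsLocallySmoothIn A (B : Set Ω)) (h2 : IsLocallySmoothIn B D) :
    IsLocallySmoothIn A D := by
  classical
  intro T hT
  obtain ⟨C, hTC, hCD, hC⟩ := h2 T hT
  obtain ⟨A₀, B₀, _, _, ⟨g, hg⟩, hB₀, ⟨e⟩⟩ := Algebra.Smooth.exists_subalgebra_fg ℤ B C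
  have hfin : ∀ t : T, ∃ S : Finset (B × B₀),
      e ⟨t, hTC t.2⟩ = ∑ i ∈ S, i.1 ⊗ₜ[A₀] i.2 :=
    fun t => TensorProduct.exists_finset _
  choose S hS using hfin
  let T1 : Finset B := g ∪ Finset.univ.biUnion fun t => (S t).image Prod.fst
  obtain ⟨A1, hT1, hA1B, hA1⟩ := h1 (T1.map ⟨Subtype.val, Subtype.val_injective⟩) (by
    intro x hx
    simp only [Finset.coe_map, Function.Embedding.coeFn_mk, Set.mem_image] at hx
    obtain ⟨y, -, rfl⟩ := hx
    exact y.2)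
  have hT1' : ∀ y ∈ T1, (y : Ω) ∈ A1 := fun y hy => hT1 (by simp [hy])
  have hA₀ : ∀ y ∈ A₀, (y : Ω) ∈ A1 := by
    intro y hy
    rw [← hg] at hy
    induction hy using Algebra.adjoin_induction with
    | mem x hx => exact hT1' x (Finset.mem_union_left _ hx)
    | algebraMap r => simp
    | add x y _ _ hx hy => simpa using add_mem hx hy
    | mul x y _ _ hx hy => simpa using mul_mem hx hy
  let _ : Algebra A₀ A1 := RingHom.toAlgebra
    { toFun := fun y => ⟨y, hA₀ y y.2⟩
      map_one' := rfl
      map_mul' := fun _ _ => rfl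
      map_zero' := rfl
      map_add' := fun _ _ => rfl }
  let ι : A1 →ₐ[A₀] B :=
    { toFun := fun y => ⟨y, hA1B y.2⟩
      map_one' := rfl
      map_mul' := fun _ _ => rfl
      map_zero' := rfl
      map_add' := fun _ _ => rfl
      commutes' := fun _ => rfl }
  have hι : Function.Injective ι := fun x y h => Subtype.ext (congrArg (fun z : B => (z : Ω)) h)
  let j : B ⊗[A₀] B₀ →+* Ω := C.val.toRingHom.comp (e.symm : B ⊗[A₀] B₀ →+* C)
  have hj : Function.Injective j := Subtype.val_injective.comp e.symm.injective
  have hc : ∀ a, j (ι (algebraMap A A1 a) ⊗ₜ 1) = algebraMap A Ω a := fun a => by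
    change (e.symm (algebraMap B _ (ι (algebraMap A A1 a))) : Ω) = _
    rw [AlgEquiv.commutes]
    rfl
  obtain ⟨C', h1, h2, h3⟩ := exists_smooth_subalgebra_of_tensorProduct (A := A) ι hι j hj hc
  refine ⟨C', fun t ht => ?_, fun y hy => ?_, h2⟩
  · have h := h3 (S ⟨t, ht⟩) fun i hi => ⟨⟨i.1, hT1' _ ?_⟩, rfl⟩
    · rw [← hS] at h
      change (e.symm (e _) : Ω) ∈ C' at h
      rwa [AlgEquiv.symm_apply_apply] at h
    · exact Finset.mem_union_right _ (Finset.mem_biUnion.2 ⟨⟨t, ht⟩, Finset.mem_univ _,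
        Finset.mem_image_of_mem _ hi⟩)
  · obtain ⟨y, rfl⟩ := h1 hy
    exact hCD (e.symm y).2

open Polynomial

section Close

variable {Ω Γ : Type*} [Field Ω] [LinearOrderedCommGroupWithZero Γ]

/-- `a` and `b` have the same image in `Ωˣ / (1 + 𝔪)`. -/
def Valuation.Close (v : Valuation Ω Γ) (a b : Ω) : Prop := v (a - b) < v b

namespace Valuation.Close

variable {v : Valuation Ω Γ} {a b c d : Ω}

theorem ne_zero_right (h : v.Close a b) : b ≠ 0 := by
  rintro rfl
  simp [Close] at h

theorem map_eq (h : v.Close a b) : v a = v b := Valuation.map_eq_of_sub_lt v h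

theorem ne_zero_left (h : v.Close a b) : a ≠ 0 :=
  (v.ne_zero_iff).1 (h.map_eq ▸ (v.ne_zero_iff).2 h.ne_zero_right)

theorem refl (h : a ≠ 0) : v.Close a a := by
  simpa [Close, zero_lt_iff] using h

theorem symm (h : v.Close a b) : v.Close b a := by
  rw [Close, h.map_eq, v.map_sub_swap]
  exact h

theorem trans (h₁ : v.Close a b) (h₂ : v.Close b c) : v.Close a c := by
  have h : v (a - b) < v c := h₂.map_eq ▸ h₁
  rw [Close, ← sub_add_sub_cancel a b c]
  exact v.map_add_lt h h₂

theorem mul (h₁ : v.Close a b) (h₂ : v.Close c d) : v.Close (a * c) (b * d) := by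
  refine trans (b := b * c) ?_ ?_
  · have hc : 0 < v c := zero_lt_iff.2 (v.ne_zero_iff.2 h₂.ne_zero_left)
    rw [Close, ← sub_mul, map_mul, map_mul]
    exact mul_lt_mul_of_pos_right h₁ hc
  · have hb : 0 < v b := zero_lt_iff.2 (v.ne_zero_iff.2 h₁.ne_zero_right)
    rw [Close, ← mul_sub, map_mul, map_mul]
    exact mul_lt_mul_of_pos_left h₂ hb

theorem inv (h : v.Close a b) : v.Close a⁻¹ b⁻¹ := by
  have h1 := (h.symm).mul ((refl (v := v) (inv_ne_zero h.ne_zero_left)).mul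
    (refl (v := v) (inv_ne_zero h.ne_zero_right)))
  have ha := h.ne_zero_left
  have hb := h.ne_zero_right
  convert h1 using 1 <;> field_simp

theorem div (h₁ : v.Close a b) (h₂ : v.Close c d) : v.Close (a / c) (b / d) := by
  simpa [div_eq_mul_inv] using h₁.mul h₂.inv

theorem one_iff : v.Close a 1 ↔ v (a - 1) < 1 := by simp [Close]

theorem pow_one (h : v.Close a 1) (n : ℕ) : v.Close (a ^ n) 1 := by
  induction n with
  | zero => simpa using refl one_ne_zero
  | succ n ih => simpa [pow_succ] using ih.mul h

theorem multiset_prod {ι : Type*} {s : Multiset ι} {f g : ι → Ω}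
    (h : ∀ i ∈ s, v.Close (f i) (g i)) : v.Close (s.map f).prod (s.map g).prod := by
  induction s using Multiset.induction_on with
  | empty => simpa using refl one_ne_zero
  | cons i s ih =>
    simpa using (h i (by simp)).mul (ih fun j hj => h j (by simp [hj]))

theorem prod {ι : Type*} {s : Finset ι} {f g : ι → Ω}
    (h : ∀ i ∈ s, v.Close (f i) (g i)) : v.Close (∏ i ∈ s, f i) (∏ i ∈ s, g i) :=
  multiset_prod h

end Valuation.Close

theorem Valuation.close_add_of_lt {v : Valuation Ω Γ} {a b : Ω} (h : v a < v b) :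
    v.Close (a + b) b := by simpa [Close] using h

end Close

section Esymm

variable {Γ : Type*} [LinearOrderedCommGroupWithZero Γ]

theorem Finset.prod_lt_prod_of_forall_lt {ι : Type*} {s : Finset ι} (hs : s.Nonempty)
    {f g : ι → Γ} (h : ∀ i ∈ s, f i < g i) : ∏ i ∈ s, f i < ∏ i ∈ s, g i := by
  classical
  induction hs using Finset.Nonempty.cons_induction with
  | singleton a => simpa using h
  | cons a s ha hs ih =>
    rw [Finset.prod_cons, Finset.prod_cons]
    exact mul_lt_mul'' (h a (by simp)) (ih fun i hi => h i (by simp [hi])) zero_le zero_le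

theorem Finset.prod_lt_prod_of_card_eq {ι κ : Type*} {s : Finset ι} {t : Finset κ}
    (hs : s.Nonempty) (hst : s.card = t.card) {f : ι → Γ} {g : κ → Γ}
    (h : ∀ i ∈ s, ∀ j ∈ t, f i < g j) : ∏ i ∈ s, f i < ∏ j ∈ t, g j := by
  rw [← Finset.prod_coe_sort s, ← Finset.prod_coe_sort t,
    ← (Finset.equivOfCardEq hst).prod_comp]
  exact Finset.prod_lt_prod_of_forall_lt (by simpa using hs)
    fun i _ => h _ i.2 _ (Finset.equivOfCardEq hst i).2

variable {Ω : Type*} [Field Ω] (v : Valuation Ω Γ)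

theorem Valuation.close_esymm {ι : Type*} {s J : Finset ι} (hJ : J ⊆ s) (y : ι → Ω)
    (h0 : ∀ i ∈ J, y i ≠ 0) (h : ∀ i ∈ J, ∀ j ∈ s, j ∉ J → v (y j) < v (y i)) :
    v.Close ((s.val.map y).esymm J.card) (∏ i ∈ J, y i) := by
  classical
  have hne : v (∏ i ∈ J, y i) ≠ 0 := v.ne_zero_iff.2 (Finset.prod_ne_zero_iff.2 h0)
  rw [Finset.esymm_map_val, Valuation.Close,
    ← Finset.sum_erase_eq_sub (Finset.mem_powersetCard.2 ⟨hJ, rfl⟩)]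
  refine v.map_sum_lt hne fun A hA => ?_
  rw [Finset.mem_erase, Finset.mem_powersetCard] at hA
  obtain ⟨hne', hAs, hcard⟩ := hA
  have h1 : (A \ J).card = (J \ A).card := by
    rw [← Finset.card_sdiff_add_card_inter A J, ← Finset.card_sdiff_add_card_inter J A,
      Finset.inter_comm] at hcard
    omega
  have h2 : (A \ J).Nonempty := by
    rw [Finset.nonempty_iff_ne_empty]
    intro h
    exact hne' (Finset.eq_of_subset_of_card_le (Finset.sdiff_eq_empty_iff_subset.1 h) hcard.ge)
  have h3 : ∏ i ∈ A \ J, v (y i) < ∏ i ∈ J \ A, v (y i) :=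
    Finset.prod_lt_prod_of_card_eq h2 h1 fun i hi j hj => by
      rw [Finset.mem_sdiff] at hi hj
      exact h j hj.1 i (hAs hi.1) hi.2
  have h4 : 0 < ∏ i ∈ A ∩ J, v (y i) := zero_lt_iff.2 <| Finset.prod_ne_zero_iff.2 fun i hi =>
    v.ne_zero_iff.2 (h0 i (Finset.mem_inter.1 hi).2)
  rw [map_prod, map_prod, ← Finset.prod_inter_mul_prod_sdiff A J,
    ← Finset.prod_inter_mul_prod_sdiff J A, Finset.inter_comm J A]
  exact mul_lt_mul_of_pos_left h3 h4

end Esymm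

theorem Polynomial.coeff_prod_linear_lt {Ω Γ : Type*} [Field Ω] [LinearOrderedCommGroupWithZero Γ]
    (v : Valuation Ω Γ) {c : Ω} {s : Multiset Ω} (h : ∀ r ∈ s, v c < v r) :
    (s.map fun r => C r + C c * X).prod.coeff 0 = s.prod ∧
      ∀ j, 0 < j → v ((s.map fun r => C r + C c * X).prod.coeff j) < v s.prod := by
  induction s using Multiset.induction_on with
  | empty =>
    refine ⟨by simp, fun j hj => ?_⟩
    simp [Polynomial.coeff_one, hj.ne']
  | cons r s ih =>
    obtain ⟨h0, h1⟩ := ih fun r' hr' => h r' (by simp [hr'])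
    have hr := h r (by simp)
    have hr0 : 0 < v r := zero_le.trans_lt hr
    have hs0 : 0 < v s.prod := zero_le.trans_lt (h1 1 one_pos)
    refine ⟨by simp [add_mul, mul_assoc, h0], fun j hj => ?_⟩
    obtain ⟨j, rfl⟩ := Nat.exists_eq_succ_of_ne_zero hj.ne'
    rw [Multiset.map_cons, Multiset.prod_cons, Multiset.prod_cons, add_mul, mul_assoc, coeff_add,
      coeff_C_mul, coeff_C_mul, Nat.succ_eq_add_one, coeff_X_mul, map_mul]
    refine v.map_add_lt ?_ ?_
    · rw [map_mul]
      exact mul_lt_mul_of_pos_left (h1 _ (by simp)) hr0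
    · rw [map_mul]
      refine lt_of_le_of_lt (mul_le_mul_right ?_ _) (mul_lt_mul_of_pos_right hr hs0)
      rcases Nat.eq_zero_or_pos j with rfl | hj
      · rw [h0]
      · exact (h1 j hj).le

theorem Multiset.esymm_map_ringHom {R S : Type*} [CommSemiring R] [CommSemiring S] (f : R →+* S)
    (s : Multiset R) (n : ℕ) : (s.map f).esymm n = f (s.esymm n) := by
  simp [Multiset.esymm, Multiset.powersetCard_map, Multiset.map_map, map_multiset_sum,
    map_multiset_prod]

theorem Polynomial.esymm_map_aeval_aroots_mem_range {L Ω : Type*} [Field L] [Field Ω] [Algebra L Ω]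
    [CharZero L] {f : L[X]} (hf : (f.map (algebraMap L Ω)).Splits) (q : L[X]) (n : ℕ) :
    (((f.aroots Ω).map fun r => aeval r q).esymm n) ∈ Set.range (algebraMap L Ω) := by
  let N := f.SplittingField
  let ι : N →ₐ[L] Ω := SplittingField.lift f hf
  have : IsGalois L N := {}
  have hsplit : (f.map (algebraMap L N)).Splits := SplittingField.splits f
  have h1 : f.aroots Ω = (f.aroots N).map ι := by
    have := hsplit.roots_map (ι : N →+* Ω)
    rw [Polynomial.map_map, AlgHom.comp_algebraMap] at this
    exact this
  have h2 : ((f.aroots Ω).map fun r => aeval r q) =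
      ((f.aroots N).map fun r => aeval r q).map (ι : N →+* Ω) := by
    rw [h1, Multiset.map_map, Multiset.map_map]
    exact Multiset.map_congr rfl fun r _ => aeval_algHom_apply ι r q
  rw [h2, Multiset.esymm_map_ringHom]
  obtain ⟨a, ha⟩ : ((f.aroots N).map fun r => aeval r q).esymm n ∈ Set.range (algebraMap L N) := by
    rw [IsGalois.mem_range_algebraMap_iff_fixed]
    intro σ
    have h3 : (f.aroots N).map σ = f.aroots N := by
      have := hsplit.roots_map (σ : N →+* N)
      rw [Polynomial.map_map] at this
      have h4 : (σ : N →+* N).comp (algebraMap L N) = algebraMap L N := by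
        ext; simp
      rw [h4] at this
      exact this.symm
    refine (Multiset.esymm_map_ringHom (σ : N →+* N) _ _).symm.trans ?_
    congr 1
    conv_rhs => rw [← h3]
    rw [Multiset.map_map, Multiset.map_map]
    exact Multiset.map_congr rfl fun r _ => (aeval_algHom_apply σ r q).symm
  exact ⟨a, by rw [← ha]; simp⟩

/-- Hensel-type approximation: if `z` is congruent to `1` and its other conjugates over `L` have
positive valuation, then `L(z)` is an immediate extension of `L`. -/
theorem Valuation.exists_close_aeval {L Ω Γ : Type*} [Field L] [Field Ω]
    [LinearOrderedCommGroupWithZero Γ] [Algebra L Ω] [CharZero L] [IsAlgClosed Ω]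
    (v : Valuation Ω Γ) {z : Ω} (hz : IsIntegral L z) (hz1 : v.Close z 1)
    (hz' : ∀ r ∈ (minpoly L z).aroots Ω, r ≠ z → v r < 1) (q : L[X]) (hq : aeval z q ≠ 0) :
    ∃ a : L, v.Close (algebraMap L Ω a) (aeval z q) := by
  classical
  let f := minpoly L z
  let s := (f.aroots Ω).toFinset
  have hnodup : (f.aroots Ω).Nodup := nodup_aroots_iff_of_splits
    (minpoly.ne_zero hz) (IsAlgClosed.splits _) |>.2 (minpoly.irreducible hz).separable
  have hs : s.val = f.aroots Ω := by rw [Multiset.toFinset_val, hnodup.dedup]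
  have hzs : z ∈ s := Multiset.mem_toFinset.2
    (mem_aroots.2 ⟨minpoly.ne_zero hz, minpoly.aeval _ _⟩)
  have hs' : ∀ r ∈ s, r ≠ z → v r < 1 := fun r hr => hz' r (Multiset.mem_toFinset.1 hr)
  -- twist by a power of `z` to separate the valuations
  obtain ⟨k, hk⟩ : ∃ k : ℕ, ∀ r ∈ s, r ≠ z → v (aeval r q * r ^ k) ≠ v (aeval z q) := by
    have hfin : ∀ r ∈ s.erase z, {k : ℕ | v (aeval r q * r ^ k) = v (aeval z q)}.Finite := by
      intro r hr
      rw [Finset.mem_erase] at hr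
      refine Set.Subsingleton.finite fun k hk l hl => ?_
      rw [Set.mem_ofPred_eq, map_mul, map_pow] at hk hl
      have hq0 : v (aeval z q) ≠ 0 := v.ne_zero_iff.2 hq
      have hr1 : v (aeval r q) ≠ 0 := fun h => hq0 (by rw [← hk, h, zero_mul])
      have hkl : v r ^ k = v r ^ l := mul_left_cancel₀ hr1 (hk.trans hl.symm)
      by_cases hr0 : v r = 0
      · by_contra hne
        rcases Nat.eq_zero_or_pos k with rfl | hk0
        · rw [hr0, zero_pow (Ne.symm hne)] at hkl
          simp at hkl
        · rw [hr0, zero_pow hk0.ne', mul_zero] at hk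
          exact hq0 hk.symm
      · exact (pow_right_strictAnti₀ (zero_lt_iff.2 hr0) (hs' r hr.2 hr.1)).injective hkl
    have := (Set.Finite.biUnion (s.erase z).finite_toSet hfin).infinite_compl.nonempty
    obtain ⟨k, hk⟩ := this
    refine ⟨k, fun r hr hrz h => hk ?_⟩
    simp only [Set.mem_iUnion]
    exact ⟨r, by simp [hr, hrz], h⟩
  let y : Ω → Ω := fun r => aeval r (q * X ^ k)
  have hy : ∀ r, y r = aeval r q * r ^ k := fun r => by simp [y]
  have hyz : v.Close (y z) (aeval z q) := by
    rw [hy]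
    simpa using (Valuation.Close.refl (v := v) hq).mul (hz1.pow_one k)
  let J := s.filter fun r => v (y z) < v (y r)
  have hJs : J ⊆ s := Finset.filter_subset _ _
  have hzJ : z ∉ J := by simp [J]
  have hJ0 : ∀ i ∈ J, y i ≠ 0 := fun i hi h => by
    have := (Finset.mem_filter.1 hi).2
    simp [h] at this
  have hJlt : ∀ j ∈ s, j ∉ J → v (y j) ≤ v (y z) := fun j hj hjJ => by
    by_contra h
    exact hjJ (Finset.mem_filter.2 ⟨hj, not_le.1 h⟩)
  have e1 := v.close_esymm hJs y hJ0 fun i hi j hj hjJ =>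
    (hJlt j hj hjJ).trans_lt (Finset.mem_filter.1 hi).2
  have e2 := v.close_esymm (J := Finset.cons z J hzJ) (s := s)
    (by simpa [Finset.cons_eq_insert, Finset.insert_subset_iff, hzs] using hJs) y
    (by
      intro i hi
      rcases Finset.mem_cons.1 hi with rfl | hi
      · exact hyz.ne_zero_left
      · exact hJ0 i hi)
    (by
      intro i hi j hj hjJ
      rw [Finset.mem_cons, not_or] at hjJ
      have h1 : v (y j) < v (y z) := lt_of_le_of_ne (hJlt j hj hjJ.2) (by
        rw [hyz.map_eq, hy]
        exact hk j hj hjJ.1)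
      rcases Finset.mem_cons.1 hi with rfl | hi
      · exact h1
      · exact h1.trans (Finset.mem_filter.1 hi).2)
  rw [hs] at e1 e2
  obtain ⟨a1, ha1⟩ := esymm_map_aeval_aroots_mem_range (f := f)
    (IsAlgClosed.splits (f.map (algebraMap L Ω))) (q * X ^ k)
    J.card
  obtain ⟨a2, ha2⟩ := esymm_map_aeval_aroots_mem_range (f := f)
    (IsAlgClosed.splits (f.map (algebraMap L Ω))) (q * X ^ k)
    (Finset.cons z J hzJ).card
  refine ⟨a2 / a1, Valuation.Close.trans ?_ hyz⟩
  rw [map_div₀, ha1, ha2]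
  convert e2.div e1 using 1
  rw [Finset.prod_cons, mul_div_cancel_right₀ _ e1.ne_zero_right]

section IntegralLocalization

variable {P N Γ : Type*} [CommRing P] [Field N] [LinearOrderedCommGroupWithZero Γ] [Algebra P N]

/-- The localization, inside `N`, of the integral closure of `P` at the prime ideal of its elements
of positive valuation (assuming that `v` is at most one on `P`). -/
def Valuation.integralLocalization (v : Valuation N Γ) (P : Type*) [CommRing P] [Algebra P N] :
    Subalgebra P N where
  carrier := {w | ∃ β, IsIntegral P β ∧ v β = 1 ∧ IsIntegral P (β * w)}
  mul_mem' := by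
    rintro a b ⟨β, h1, h2, h3⟩ ⟨γ, h4, h5, h6⟩
    refine ⟨β * γ, h1.mul h4, by rw [map_mul, h2, h5, one_mul], ?_⟩
    rw [mul_mul_mul_comm]
    exact h3.mul h6
  add_mem' := by
    rintro a b ⟨β, h1, h2, h3⟩ ⟨γ, h4, h5, h6⟩
    refine ⟨β * γ, h1.mul h4, by rw [map_mul, h2, h5, one_mul], ?_⟩
    rw [show β * γ * (a + b) = γ * (β * a) + β * (γ * b) by ring]
    exact (h4.mul h3).add (h1.mul h6)
  algebraMap_mem' p := ⟨1, isIntegral_one, map_one v, by simpa using isIntegral_algebraMap⟩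

namespace Valuation

variable {v : Valuation N Γ}

theorem inv_mem_integralLocalization {w : N} (h : w ∈ v.integralLocalization P) (hw : v w = 1) :
    w⁻¹ ∈ v.integralLocalization P := by
  obtain ⟨β, h1, h2, h3⟩ := h
  refine ⟨β * w, h3, by rw [map_mul, h2, hw, one_mul], ?_⟩
  have : w ≠ 0 := by
    rintro rfl
    simp at hw
  rwa [mul_inv_cancel_right₀ this]

theorem exists_common_denominator (T : Finset N) (hT : ∀ w ∈ T, w ∈ v.integralLocalization P) :
    ∃ β, IsIntegral P β ∧ v β = 1 ∧ ∀ w ∈ T, IsIntegral P (β * w) := by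
  classical
  induction T using Finset.induction_on with
  | empty => exact ⟨1, isIntegral_one, map_one v, by simp⟩
  | insert a T ha ih =>
    obtain ⟨β, h1, h2, h3⟩ := ih fun w hw => hT w (by simp [hw])
    obtain ⟨γ, h4, h5, h6⟩ := hT a (by simp)
    refine ⟨β * γ, h1.mul h4, by rw [map_mul, h2, h5, one_mul], fun w hw => ?_⟩
    rcases Finset.mem_insert.1 hw with rfl | hw
    · rw [mul_assoc]
      exact h1.mul h6
    · rw [mul_comm β, mul_assoc]
      exact h4.mul (h3 w hw)

theorem le_one_of_isIntegral (hP : ∀ p, v (algebraMap P N p) ≤ 1) {w : N} (h : IsIntegral P w) :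
    v w ≤ 1 := by
  let f : P →+* v.integer := (algebraMap P N).codRestrict _ hP
  obtain ⟨p, hp, hw⟩ := h
  have : IsIntegral v.integer w := ⟨p.map f, hp.map f, by rwa [eval₂_map]⟩
  exact (Valuation.integer.integers v).mem_of_integral this

theorem mem_integralLocalization_of_aeval_eq_zero_aux (hP : ∀ p, v (algebraMap P N p) ≤ 1) {u : N}
    (hu : v u ≤ 1) (n : ℕ) : ∀ p : (integralClosure P N)[X], p.natDegree ≤ n → aeval u p = 0 →
      (∃ i, v (p.coeff i) = 1) → u ∈ v.integralLocalization P := by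
  have hint : ∀ w : integralClosure P N, v w ≤ 1 := fun w => le_one_of_isIntegral hP w.2
  have hlead : ∀ p : (integralClosure P N)[X], ∀ m, p.natDegree ≤ m → aeval u p = 0 →
      IsIntegral P ((p.coeff m : N) * u) := by
    intro p m hm hp
    rcases hm.lt_or_eq with hm | rfl
    · rw [coeff_eq_zero_of_natDegree_lt hm]
      simpa using isIntegral_zero
    · exact isIntegral_trans (A := integralClosure P N) _ (isIntegral_leadingCoeff_smul p u hp)
  induction n with
  | zero =>
    rintro p hp h0 ⟨i, hi⟩
    rw [eq_C_of_natDegree_le_zero hp] at h0 hi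
    rw [aeval_C] at h0
    have h2 : (p.coeff 0 : N) = 0 := h0
    rw [coeff_C] at hi
    split_ifs at hi
    · simp [h2] at hi
    · simp at hi
  | succ n ih =>
    rintro p hp h0 ⟨i, hi⟩
    have hα := hlead p _ hp h0
    by_cases h1 : v (p.coeff (n + 1)) = 1
    · exact ⟨p.coeff (n + 1), (p.coeff (n + 1)).2, h1, hα⟩
    let α : integralClosure P N := ⟨_, hα⟩
    have h1' : v (p.coeff (n + 1)) < 1 := lt_of_le_of_ne (hint _) h1
    have hα1 : v (α : N) < 1 := by
      rw [map_mul]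
      exact mul_lt_one_of_lt_of_le h1' hu
    have hcoeff : ∀ j, (p.erase (n + 1) + C α * X ^ n).coeff j =
        if j = n + 1 then 0 else if j = n then p.coeff j + α else p.coeff j := by
      intro j
      rw [coeff_add, coeff_erase, coeff_C_mul, coeff_X_pow]
      split_ifs <;> first | omega | simp
    refine ih (p.erase (n + 1) + C α * X ^ n) ?_ ?_ ⟨i, ?_⟩
    · rw [natDegree_le_iff_coeff_eq_zero]
      intro j hj
      rw [hcoeff]
      split_ifs with h2 h3
      · rfl
      · omega
      · exact coeff_eq_zero_of_natDegree_lt (by omega)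
    · have h2 := monomial_add_erase p (n + 1)
      rw [← h2, map_add, aeval_monomial] at h0
      rw [map_add, map_mul, aeval_C, map_pow, aeval_X, ← h0, add_comm]
      congr 1
      change ((p.coeff (n + 1) : N) * u) * u ^ n = (p.coeff (n + 1) : N) * u ^ (n + 1)
      ring
    · rw [hcoeff]
      have hi' : i ≠ n + 1 := fun h => h1 (h ▸ hi)
      rw [if_neg hi']
      split_ifs
      · change v ((p.coeff i : N) + α) = 1
        rw [v.map_add_eq_of_lt_left, hi]
        rwa [hi]
      · exact hi

theorem mem_integralLocalization_of_aeval_eq_zero (hP : ∀ p, v (algebraMap P N p) ≤ 1) {u : N}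
    (hu : v u ≤ 1) (p : N[X]) (hp : ∀ i, p.coeff i ∈ v.integralLocalization P) (h0 : p.eval u = 0)
    (h1 : ∃ i, v (p.coeff i) = 1) : u ∈ v.integralLocalization P := by
  classical
  obtain ⟨β, hβ, hβ1, h⟩ := exists_common_denominator (v := v) (P := P) p.coeffs (by
    intro w hw
    obtain ⟨i, -, rfl⟩ := mem_coeffs_iff.1 hw
    exact hp i)
  have h' : ∀ i, IsIntegral P ((C β * p).coeff i) := by
    intro i
    rw [coeff_C_mul]
    by_cases hi : p.coeff i = 0
    · simpa [hi] using isIntegral_zero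
    · exact h _ (coeff_mem_coeffs hi)
  obtain ⟨q, hq⟩ : ∃ q : (integralClosure P N)[X],
      q.map (algebraMap (integralClosure P N) N) = C β * p := by
    have : C β * p ∈ lifts (algebraMap (integralClosure P N) N) := by
      rw [lifts_iff_coeff_lifts]
      exact fun i => ⟨⟨_, h' i⟩, rfl⟩
    exact (mem_lifts _).1 this
  refine mem_integralLocalization_of_aeval_eq_zero_aux hP hu q.natDegree q le_rfl ?_ ?_
  · rw [← eval_map_algebraMap, hq, eval_mul, h0, mul_zero]
  · obtain ⟨i, hi⟩ := h1
    refine ⟨i, ?_⟩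
    have : (q.coeff i : N) = β * p.coeff i := by
      rw [← coeff_C_mul, ← hq, coeff_map]; rfl
    rw [this, map_mul, hβ1, hi, one_mul]

end Valuation

end IntegralLocalization

section Center

variable {R N Γ : Type*} [CommRing R] [Field N] [LinearOrderedCommGroupWithZero Γ]

/-- The center on `R` of a valuation, along a ring homomorphism `f`. -/
def Valuation.center (v : Valuation N Γ) (f : R →+* N) (hf : ∀ r, v (f r) ≤ 1) : Ideal R where
  carrier := {r | v (f r) < 1}
  add_mem' ha hb := by
    rw [Set.mem_ofPred_eq, map_add]
    exact v.map_add_lt ha hb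
  zero_mem' := by simp
  smul_mem' c x hx := by
    rw [Set.mem_ofPred_eq, smul_eq_mul, mul_comm, map_mul, map_mul]
    exact mul_lt_one_of_lt_of_le hx (hf c)

theorem Valuation.mem_center {v : Valuation N Γ} {f : R →+* N} {hf : ∀ r, v (f r) ≤ 1} {r : R} :
    r ∈ v.center f hf ↔ v (f r) < 1 := Iff.rfl

theorem Valuation.isPrime_center (v : Valuation N Γ) (f : R →+* N) (hf : ∀ r, v (f r) ≤ 1) :
    (v.center f hf).IsPrime := by
  refine ⟨fun h => ?_, fun {x y} h => ?_⟩
  · have := v.mem_center.1 ((Ideal.eq_top_iff_one _).1 h)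
    simp at this
  · by_contra! h'
    simp only [mem_center, not_lt] at h'
    rw [mem_center, map_mul, map_mul, (hf x).antisymm h'.1, (hf y).antisymm h'.2, mul_one] at h
    exact h.false

end Center

section Decomposition

variable {P k N Γ : Type*} [CommRing P] [Field k] [Field N] [Algebra P k] [Algebra k N]
  [Algebra P N] [IsScalarTower P k N] [FiniteDimensional k N] [IsGalois k N]
  [LinearOrderedCommGroupWithZero Γ] {v : Valuation N Γ}

/-- An element of the decomposition field of `v` congruent to `1`, whose conjugates by
automorphisms outside the decomposition group have positive valuation. -/
theorem Valuation.exists_decomposition_generator (hP : ∀ p, v (algebraMap P N p) ≤ 1)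
    (hmax : ∀ p, v (algebraMap P N p) = 1 → ∃ p', v (algebraMap P N (p * p') - 1) < 1)
    (F : IntermediateField k N)
    (hF : ∀ σ : N ≃ₐ[k] N, (∀ w, IsIntegral P w → v w < 1 → v (σ w) < 1) →
      σ ∈ F.fixingSubgroup) :
    ∃ z ∈ F, IsIntegral P z ∧ v.Close z 1 ∧ ∀ σ : N ≃ₐ[k] N, σ ∉ F.fixingSubgroup → v (σ z) < 1 := by
  classical
  have hint (σ : N ≃ₐ[k] N) {w : N} (hw : IsIntegral P w) : IsIntegral P (σ w) :=
    hw.map (σ.toAlgHom.restrictScalars P)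
  let R := integralClosure P N
  let f : (N ≃ₐ[k] N) → R →+* N := fun σ => (σ : N →+* N).comp (algebraMap R N)
  have hf : ∀ σ r, v (f σ r) ≤ 1 := fun σ r => le_one_of_isIntegral hP (hint σ r.2)
  let Q : (N ≃ₐ[k] N) → Ideal R := fun σ => v.center (f σ) (hf σ)
  have hQ : ∀ σ, (Q σ).IsMaximal := by
    intro σ
    have := v.isPrime_center (f σ) (hf σ)
    refine Ideal.isMaximal_of_isIntegral_of_isMaximal_comap (R := P) (Q σ) ?_
    have hmem : ∀ p, p ∈ (Q σ).comap (algebraMap P R) ↔ v (algebraMap P N p) < 1 := by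
      intro p
      change v (σ (algebraMap P N p)) < 1 ↔ _
      rw [IsScalarTower.algebraMap_apply P k N, AlgEquiv.commutes]
    refine Ideal.isMaximal_iff.2 ⟨?_, fun J p hJ hp hpJ => ?_⟩
    · rw [hmem]; simp
    · rw [hmem, not_lt] at hp
      obtain ⟨p', hp'⟩ := hmax p ((hP p).antisymm hp)
      have h1 : p * p' - 1 ∈ J := hJ ((hmem _).2 (by simpa using hp'))
      simpa using J.sub_mem (J.mul_mem_right p' hpJ) h1
  have hne : ∀ σ ∈ F.fixingSubgroup, ∀ τ ∉ F.fixingSubgroup, Q σ ⊔ Q τ = ⊤ := by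
    intro σ hσ τ hτ
    refine Ideal.IsMaximal.coprime_of_ne (hQ σ) (hQ τ) fun h => hτ ?_
    have : τ * σ⁻¹ ∈ F.fixingSubgroup := hF _ fun w hw hw1 => by
      have h1 : (⟨σ⁻¹ w, hint _ hw⟩ : R) ∈ Q σ := by
        change v (σ (σ⁻¹ w)) < 1
        rwa [← AlgEquiv.mul_apply, mul_inv_cancel, AlgEquiv.one_apply]
      rw [h] at h1
      exact h1
    simpa using mul_mem this hσ
  have htop : (⨅ σ ∈ Finset.univ.filter (· ∈ F.fixingSubgroup), Q σ) ⊔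
      (⨅ τ ∈ Finset.univ.filter (· ∉ F.fixingSubgroup), Q τ) = ⊤ := by
    refine Ideal.sup_iInf_eq_top fun τ hτ => ?_
    refine Ideal.iInf_sup_eq_top fun σ hσ => ?_
    exact hne σ (by simpa using hσ) τ (by simpa using hτ)
  obtain ⟨a, ha, e, he, hae⟩ := Submodule.mem_sup.1 ((Ideal.eq_top_iff_one _).1 htop)
  have ha' : ∀ σ ∈ F.fixingSubgroup, v (σ a) < 1 := fun σ hσ => by
    simp only [Ideal.mem_iInf] at ha
    exact ha σ (by simpa using hσ)
  have he' : ∀ τ ∉ F.fixingSubgroup, v (τ e) < 1 := fun σ hσ => by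
    simp only [Ideal.mem_iInf] at he
    exact he σ (by simpa using hσ)
  have hae' : (a : N) + e = 1 := by exact_mod_cast congrArg (algebraMap R N) hae
  let z : N := ∏ σ : F.fixingSubgroup, (σ : N ≃ₐ[k] N) e
  have hz : ∀ τ : N ≃ₐ[k] N, τ z = ∏ σ : F.fixingSubgroup, (τ * (σ : N ≃ₐ[k] N)) e := fun τ => by
    simp [z, map_prod]
  refine ⟨z, ?_, ?_, ?_, fun τ hτ => ?_⟩
  · rw [← IsGalois.fixedField_fixingSubgroup F, IntermediateField.mem_fixedField_iff]
    intro τ hτ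
    rw [hz]
    exact Fintype.prod_equiv (Equiv.mulLeft (⟨τ, hτ⟩ : F.fixingSubgroup)) _ _ fun σ => rfl
  · exact IsIntegral.prod _ fun σ _ => hint _ e.2
  · have : v.Close z (∏ σ : F.fixingSubgroup, 1) := Valuation.Close.prod fun σ _ => by
      have h := ha' σ σ.2
      rw [Valuation.Close.one_iff, ← v.map_neg]
      convert h using 2
      rw [eq_sub_of_add_eq hae', _root_.map_sub, _root_.map_one, neg_sub]
    simpa using this
  · rw [hz, map_prod]
    have hlt : ∀ σ : F.fixingSubgroup, v ((τ * (σ : N ≃ₐ[k] N)) e) < 1 := fun σ =>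
      he' _ fun h => hτ (by simpa using mul_mem h (inv_mem σ.2))
    rw [← Finset.prod_const_one (s := (Finset.univ : Finset F.fixingSubgroup))]
    exact Finset.prod_lt_prod_of_forall_lt Finset.univ_nonempty fun σ _ => hlt σ

end Decomposition

theorem StandardEtalePair.exists_mul_pow_eq {R : Type*} [CommRing R] (P : StandardEtalePair R)
    (r : P.Ring) : ∃ (n : ℕ) (a : R[X]), r * aeval P.X P.g ^ n = aeval P.X a := by
  obtain ⟨π, hπ, hC, hX⟩ : ∃ π : R[X][X] →+* P.Ring, Function.Surjective π ∧
      (∀ a, π (C a) = aeval P.X a) ∧ aeval P.X P.g * π X = 1 := by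
    refine ⟨Ideal.Quotient.mk _, Ideal.Quotient.mk_surjective, fun a => ?_, P.aeval_X_g_mul_mk_X⟩
    have : aeval (R := R) P.X = ((Ideal.Quotient.mkₐ R _ : R[X][X] →ₐ[R] P.Ring)).comp CAlgHom := by
      ext
      simp only [aeval_X]
      rfl
    rw [this]
    rfl
  obtain ⟨q, rfl⟩ := hπ r
  induction q using Polynomial.induction_on' with
  | add p q hp hq =>
    obtain ⟨n, a, ha⟩ := hp
    obtain ⟨m, b, hb⟩ := hq
    refine ⟨n + m, a * P.g ^ m + b * P.g ^ n, ?_⟩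
    rw [map_add, map_add, map_mul, map_mul, map_pow, map_pow, ← ha, ← hb]
    ring
  | monomial n a =>
    refine ⟨n, a, ?_⟩
    rw [← C_mul_X_pow_eq_monomial, map_mul, map_pow, hC, mul_assoc, ← mul_pow, mul_comm _ (aeval _ _),
      hX, one_pow, mul_one]

section Etale

variable {P k N Γ : Type*} [CommRing P] [IsDomain P] [IsIntegrallyClosed P] [Field k] [Field N]
  [Algebra P k] [IsFractionRing P k] [Algebra k N]
  [Algebra P N] [IsScalarTower P k N] [IsGalois k N]
  [LinearOrderedCommGroupWithZero Γ] {v : Valuation N Γ}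

theorem StandardEtalePair.injective_lift_of_minpoly [FaithfulSMul P N] {z : N}
    (hz : IsIntegral P z) (p : StandardEtalePair P) (hp : p.f = minpoly P z) (h : p.HasMap z) :
    Function.Injective (p.lift z h) := by
  rw [injective_iff_map_eq_zero]
  intro r hr
  obtain ⟨n, a, ha⟩ := p.exists_mul_pow_eq r
  have h1 : aeval z a = 0 := by
    have := congrArg (p.lift z h) ha
    rw [map_mul, hr, zero_mul, ← aeval_algHom_apply, p.lift_X] at this
    exact this.symm
  obtain ⟨b, rfl⟩ := minpoly.isIntegrallyClosed_dvd hz h1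
  rw [map_mul, ← hp, p.hasMap_X.1, zero_mul] at ha
  exact ((p.hasMap_X.2.pow n).mul_left_eq_zero).1 ha

theorem Valuation.aeval_derivative_minpoly_eq_one {z : N} (hz1 : v.Close z 1)
    (hz' : ∀ r ∈ (minpoly k z).aroots N, r ≠ z → v r < 1) :
    v (aeval z (derivative (minpoly k z))) = 1 := by
  classical
  have hzi : IsIntegral k z := Algebra.IsIntegral.isIntegral z
  have hs : ((minpoly k z).map (algebraMap k N)).Splits := Normal.splits inferInstance z
  have hnodup : ((minpoly k z).aroots N).Nodup := nodup_aroots_iff_of_splits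
    (minpoly.ne_zero hzi) hs |>.2 (Algebra.IsSeparable.isSeparable k z)
  have hzr : z ∈ (minpoly k z).aroots N := mem_aroots.2 ⟨minpoly.ne_zero hzi, minpoly.aeval _ _⟩
  rw [← eval_map_algebraMap, ← derivative_map,
    hs.eval_root_derivative ((minpoly.monic hzi).map _) hzr,
    map_multiset_prod, Multiset.map_map]
  refine Multiset.prod_eq_one fun x hx => ?_
  obtain ⟨r, hr, rfl⟩ := Multiset.mem_map.1 hx
  rw [hnodup.mem_erase_iff] at hr
  have h2 : v r < v z := by
    rw [hz1.map_eq, v.map_one]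
    exact hz' r hr.2 hr.1
  rw [Function.comp_apply, v.map_sub_eq_of_lt_left h2, hz1.map_eq, v.map_one]

variable [FiniteDimensional k N]

/-- Étale descent to the decomposition field: finitely many elements of `F` which are fractions of
integral elements with unit denominators lie in a common étale `P`-subalgebra of `F`, if the
decomposition group of `v` fixes `F`. -/
theorem Valuation.exists_smooth_subalgebra (hP : ∀ p, v (algebraMap P N p) ≤ 1)
    (hmax : ∀ p, v (algebraMap P N p) = 1 → ∃ p', v (algebraMap P N (p * p') - 1) < 1)
    (F : IntermediateField k N)
    (hF : ∀ σ : N ≃ₐ[k] N, (∀ w, IsIntegral P w → v w < 1 → v (σ w) < 1) →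
      σ ∈ F.fixingSubgroup)
    (T : Finset N) (hTF : ∀ w ∈ T, w ∈ F) (hT : ∀ w ∈ T, w ∈ v.integralLocalization P) :
    ∃ B : Subalgebra P N, (∀ w ∈ T, w ∈ B) ∧ (∀ w ∈ B, w ∈ F ∧ v w ≤ 1) ∧ Algebra.Smooth P B := by
  classical
  have hinj : Function.Injective (algebraMap P N) := by
    rw [IsScalarTower.algebraMap_eq P k N]
    exact (algebraMap k N).injective.comp (IsFractionRing.injective P k)
  have : FaithfulSMul P N := (faithfulSMul_iff_algebraMap_injective P N).2 hinj
  have hint (σ : N ≃ₐ[k] N) {w : N} (hw : IsIntegral P w) : IsIntegral P (σ w) :=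
    hw.map (σ.toAlgHom.restrictScalars P)
  obtain ⟨z, hzF, hz, hz1, hz'⟩ := exists_decomposition_generator hP hmax F hF
  have hroot : ∀ r ∈ (minpoly k z).aroots N, r ≠ z → v r < 1 := by
    intro r hr hrz
    obtain ⟨σ, rfl⟩ := minpoly.exists_algEquiv_of_root' (Algebra.IsAlgebraic.isAlgebraic z)
      (mem_aroots.1 hr).2
    exact hz' σ fun h => hrz (h ⟨z, hzF⟩)
  have hder := v.aeval_derivative_minpoly_eq_one hz1 hroot
  have hfk : minpoly k z = (minpoly P z).map (algebraMap P k) :=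
    minpoly.isIntegrallyClosed_eq_field_fractions' k hz
  have hder' : aeval z (derivative (minpoly k z)) = aeval z (derivative (minpoly P z)) := by
    rw [hfk, derivative_map, aeval_map_algebraMap]
  rw [hder'] at hder
  have hFz : ∀ y ∈ F, ∃ p : k[X], aeval z p = y := by
    have h1 : F ≤ IntermediateField.adjoin k {z} := by
      rw [← IsGalois.fixedField_fixingSubgroup F,
        ← IsGalois.fixedField_fixingSubgroup (IntermediateField.adjoin k {z})]
      refine IntermediateField.fixedField_antitone fun σ hσ => ?_
      by_contra h
      have h2 := hz' σ h
      have h3 : σ z = z := hσ ⟨z, IntermediateField.mem_adjoin_simple_self k z⟩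
      rw [h3, hz1.map_eq, v.map_one] at h2
      exact h2.false
    intro y hy
    have h2 : y ∈ (IntermediateField.adjoin k {z}).toSubalgebra := h1 hy
    rw [IntermediateField.adjoin_simple_toSubalgebra_of_isAlgebraic
      (Algebra.IsAlgebraic.isAlgebraic z), Algebra.adjoin_singleton_eq_range_aeval] at h2
    exact h2
  have hW : ∀ y ∈ F, IsIntegral P y →
      ∃ W : P[X], aeval z (derivative (minpoly P z)) * y = aeval z W := by
    intro y hy hyint
    let zF : F := ⟨z, hzF⟩
    let φ : k[X] →ₐ[P] F := (aeval zF).restrictScalars P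
    have hφ : Function.Surjective φ := by
      rintro ⟨y, hy⟩
      obtain ⟨p, rfl⟩ := hFz y hy
      refine ⟨p, Subtype.ext ?_⟩
      exact (aeval_algHom_apply F.val zF p).symm
    have hmin : minpoly k zF = minpoly k z :=
      (minpoly.algebraMap_eq (algebraMap F N).injective zF).symm
    obtain ⟨g, hg, hgint⟩ := exists_derivative_mul_eq_and_isIntegral_coeff (R := P) hφ
      (f := minpoly k z) (minpoly.monic (Algebra.IsIntegral.isIntegral z))
      (fun i => by
        rw [hfk, coeff_map]
        exact isIntegral_algebraMap)
      (by
        rw [← hmin]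
        exact minpoly.ker_aeval_eq_span_minpoly k zF)
      (y := ⟨y, hy⟩) ((isIntegral_algHom_iff (F.val.restrictScalars P) Subtype.val_injective).1 hyint)
    obtain ⟨W, hW⟩ : ∃ W : P[X], W.map (algebraMap P k) = g := by
      refine (mem_lifts _).1 ((lifts_iff_coeff_lifts _).2 fun i => ?_)
      exact IsIntegrallyClosed.isIntegral_iff.1 (hgint i)
    refine ⟨W, ?_⟩
    have := congrArg (algebraMap F N) hg
    rw [← hder', ← aeval_map_algebraMap k z W, hW]
    rw [map_mul] at this
    refine Eq.trans ?_ (this.trans ?_)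
    · congr 1
      exact (aeval_algHom_apply F.val zF _)
    · exact (aeval_algHom_apply F.val zF _).symm
  -- a common denominator in `F`
  obtain ⟨δ, hδF, hδ, hδ1, hδT⟩ : ∃ δ ∈ F, IsIntegral P δ ∧ v δ = 1 ∧
      ∀ w ∈ T, IsIntegral P (δ * w) := by
    let R := integralClosure P N
    let I : Ideal R :=
      { carrier := {β | ∀ w ∈ T, IsIntegral P ((β : N) * w)}
        add_mem' := fun ha hb w hw => by
          rw [AddMemClass.coe_add, add_mul]
          exact (ha w hw).add (hb w hw)
        zero_mem' := fun w hw => by simpa using isIntegral_zero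
        smul_mem' := fun c x hx w hw => by
          rw [smul_eq_mul, MulMemClass.coe_mul, mul_assoc]
          exact c.2.mul (hx w hw) }
    let f : (N ≃ₐ[k] N) → R →+* N := fun σ => (σ : N →+* N).comp (algebraMap R N)
    have hf : ∀ σ r, v (f σ r) ≤ 1 := fun σ r => le_one_of_isIntegral hP (hint σ r.2)
    obtain ⟨β₀, hβ₀, hβ₀1, hβ₀T⟩ := exists_common_denominator T hT
    have hnot : ¬ ((I : Set R) ⊆ ⋃ σ ∈ ((Finset.univ.filter (· ∈ F.fixingSubgroup) :
        Finset (N ≃ₐ[k] N)) : Set (N ≃ₐ[k] N)), (v.center (f σ) (hf σ) : Set R)) := by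
      rw [Ideal.subset_union_prime 1 1 fun σ _ _ _ => v.isPrime_center _ _]
      rintro ⟨σ, hσ, hle⟩
      have hσ' : σ⁻¹ ∈ F.fixingSubgroup := inv_mem (by simpa using hσ)
      have h1 : (⟨σ⁻¹ β₀, hint _ hβ₀⟩ : R) ∈ I := fun w hw => by
        have h2 : σ⁻¹ w = w := hσ' ⟨w, hTF w hw⟩
        change IsIntegral P (σ⁻¹ β₀ * w)
        rw [← h2, ← _root_.map_mul]
        exact hint _ (hβ₀T w hw)
      have h3 : v (σ (σ⁻¹ β₀)) < 1 := hle h1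
      rw [← AlgEquiv.mul_apply, mul_inv_cancel, AlgEquiv.one_apply, hβ₀1] at h3
      exact h3.false
    rw [Set.not_subset] at hnot
    obtain ⟨β, hβI, hβ⟩ := hnot
    have hβ' : ∀ σ ∈ F.fixingSubgroup, v (σ β) = 1 := fun σ hσ => by
      refine (hf σ β).antisymm (not_lt.1 fun h => hβ ?_)
      simp only [Set.mem_iUnion]
      exact ⟨σ, by simpa using hσ, h⟩
    have hprod : ∀ τ : N ≃ₐ[k] N, τ (∏ σ : F.fixingSubgroup, (σ : N ≃ₐ[k] N) β) =
        ∏ σ : F.fixingSubgroup, (τ * (σ : N ≃ₐ[k] N)) β := fun τ => by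
      simp [map_prod]
    refine ⟨∏ σ : F.fixingSubgroup, (σ : N ≃ₐ[k] N) β, ?_, ?_, ?_, fun w hw => ?_⟩
    · refine (IsGalois.fixedField_fixingSubgroup F).le
        ((IntermediateField.mem_fixedField_iff _ _).2 fun τ hτ => ?_)
      refine (hprod τ).trans ?_
      exact Fintype.prod_equiv (Equiv.mulLeft (⟨τ, hτ⟩ : F.fixingSubgroup)) _ _ fun σ => rfl
    · exact IsIntegral.prod _ fun σ _ => hint _ β.2
    · rw [map_prod]
      exact Finset.prod_eq_one fun σ _ => hβ' σ σ.2
    · rw [← Finset.mul_prod_erase _ _ (Finset.mem_univ (1 : F.fixingSubgroup)), mul_right_comm]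
      exact IsIntegral.mul (hβI w hw) (IsIntegral.prod _ fun σ _ => hint _ β.2)
  obtain ⟨Δ, hΔ⟩ := hW δ hδF hδ
  have hΔ1 : v (aeval z Δ) = 1 := by rw [← hΔ, _root_.map_mul, hder, hδ1, one_mul]
  let p : StandardEtalePair P :=
    { f := minpoly P z
      monic_f := minpoly.monic hz
      g := derivative (minpoly P z) * Δ
      cond := ⟨Δ, 0, 1, by simp⟩ }
  have hpg1 : v (aeval z p.g) = 1 := by
    rw [_root_.map_mul, _root_.map_mul, hder, hΔ1, one_mul]
  have hne : ∀ {a : N}, v a = 1 → a ≠ 0 := fun h h0 => by simp [h0] at h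
  have hmap : p.HasMap z := ⟨minpoly.aeval _ _, (hne hpg1).isUnit⟩
  have hzP : ∀ a : P[X], aeval z a ∈ F := fun a => by
    rw [← aeval_map_algebraMap k]
    exact aeval_algHom_apply F.val ⟨z, hzF⟩ (a.map (algebraMap P k)) ▸ (aeval (⟨z, hzF⟩ : F) _).2
  refine ⟨(p.lift z hmap).range, fun w hw => ?_, ?_,
    .of_equiv (AlgEquiv.ofInjective _ (p.injective_lift_of_minpoly hz rfl hmap))⟩
  · obtain ⟨W, hW⟩ := hW (δ * w) (F.mul_mem hδF (hTF w hw)) (hδT w hw)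
    obtain ⟨y, hy⟩ := p.hasMap_X.2
    have hyinv : aeval z p.g * p.lift z hmap ↑y⁻¹ = 1 := by
      have := congrArg (p.lift z hmap) y.mul_inv
      rwa [hy, _root_.map_mul, ← aeval_algHom_apply, p.lift_X, _root_.map_one] at this
    refine ⟨aeval p.X W * aeval p.X (derivative p.f) * ↑y⁻¹, ?_⟩
    change p.lift z hmap _ = w
    rw [_root_.map_mul, _root_.map_mul, ← aeval_algHom_apply, ← aeval_algHom_apply, p.lift_X, ← hW]
    have : aeval z p.g = aeval z (derivative (minpoly P z)) *
        (aeval z (derivative (minpoly P z)) * δ) := by rw [hΔ, ← _root_.map_mul]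
    rw [this] at hyinv
    linear_combination w * hyinv
  · rintro _ ⟨r, rfl⟩
    obtain ⟨n, a, ha⟩ := p.exists_mul_pow_eq r
    have h1 : p.lift z hmap r * aeval z p.g ^ n = aeval z a := by
      have := congrArg (p.lift z hmap) ha
      rwa [_root_.map_mul, _root_.map_pow, ← aeval_algHom_apply, ← aeval_algHom_apply, p.lift_X] at this
    change p.lift z hmap r ∈ F ∧ v (p.lift z hmap r) ≤ 1
    constructor
    · rw [eq_div_of_mul_eq (pow_ne_zero n (hne hpg1)) h1]
      exact F.div_mem (hzP _) (pow_mem (hzP p.g) n)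
    · have h2 := congrArg v h1
      rw [_root_.map_mul, _root_.map_pow, hpg1, one_pow, mul_one] at h2
      rw [h2]
      exact le_one_of_isIntegral hP (aeval_algHom_apply (integralClosure P N).val ⟨z, hz⟩ a ▸
        (aeval (⟨z, hz⟩ : integralClosure P N) a).2)

end Etale

section Decomposition

variable {P K M Γ : Type*} [CommRing P] [Field K] [Field M] [Algebra P K] [Algebra K M]
  [Algebra P M] [IsScalarTower P K M] [LinearOrderedCommGroupWithZero Γ] {v : Valuation M Γ}

theorem Valuation.Integers.le_one_tower (hv : (v.comap (algebraMap K M)).Integers P) (p : P) :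
    v (algebraMap P M p) ≤ 1 := by
  rw [IsScalarTower.algebraMap_apply P K M]
  exact hv.map_le_one p

theorem Valuation.Integers.exists_mul_sub_one_lt (hv : (v.comap (algebraMap K M)).Integers P)
    (p : P) (hp : v (algebraMap P M p) = 1) :
    ∃ p' : P, v (algebraMap P M (p * p') - 1) < 1 := by
  have h0 : algebraMap P M p ≠ 0 := fun h => by simp [h] at hp
  rw [IsScalarTower.algebraMap_apply P K M] at hp h0
  have h0' : algebraMap P K p ≠ 0 := fun h => h0 (by rw [h, _root_.map_zero])
  obtain ⟨p', hp'⟩ := hv.exists_of_le_one (r := (algebraMap P K p)⁻¹) (by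
    rw [map_inv₀, Valuation.comap_apply, hp, inv_one])
  refine ⟨p', ?_⟩
  rw [IsScalarTower.algebraMap_apply P K M, _root_.map_mul, hp', mul_inv_cancel₀ h0']
  simp

theorem Valuation.Integers.mem_integralLocalization
    (hv : (v.comap (algebraMap K M)).Integers P) {u : M} (hu : IsAlgebraic K u) (hu1 : v u ≤ 1) :
    u ∈ v.integralLocalization P := by
  classical
  obtain ⟨p, hp0, hp⟩ := hu
  obtain ⟨i, hi, hmax⟩ := Finset.exists_max_image p.support
    (fun i => v (algebraMap K M (p.coeff i))) (support_nonempty.2 hp0)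
  have hc : p.coeff i ≠ 0 := mem_support_iff.1 hi
  have hc' : algebraMap K M (p.coeff i) ≠ 0 := by simpa using hc
  let q : K[X] := C (p.coeff i)⁻¹ * p
  have hq : ∀ j, (q.map (algebraMap K M)).coeff j =
      (algebraMap K M (p.coeff i))⁻¹ * algebraMap K M (p.coeff j) := fun j => by
    rw [coeff_map, coeff_C_mul, _root_.map_mul, map_inv₀]
  have hq1 : ∀ j, v (algebraMap K M (q.coeff j)) ≤ 1 := fun j => by
    rw [← coeff_map, hq, _root_.map_mul, map_inv₀]
    rw [inv_mul_le_one₀ (v.pos_iff.2 hc')]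
    by_cases hj : p.coeff j = 0
    · simp [hj]
    · exact hmax j (mem_support_iff.2 hj)
  refine mem_integralLocalization_of_aeval_eq_zero hv.le_one_tower hu1 (q.map (algebraMap K M))
    (fun j => ?_) ?_ ⟨i, ?_⟩
  · obtain ⟨a, ha⟩ := hv.exists_of_le_one (hq1 j)
    rw [coeff_map, ← ha, ← IsScalarTower.algebraMap_apply]
    exact Subalgebra.algebraMap_mem _ a
  · rw [eval_map_algebraMap, _root_.map_mul, hp, mul_zero]
  · rw [hq, inv_mul_cancel₀ hc', v.map_one]

theorem Valuation.map_algEquiv_le_one [FiniteDimensional K M]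
    (hP : ∀ p, v (algebraMap P M p) ≤ 1)
    (σ : M ≃ₐ[K] M) (hσ : ∀ w, IsIntegral P w → v w < 1 → v (σ w) < 1) {w : M}
    (hw : w ∈ v.integralLocalization P) : v (σ w) ≤ 1 := by
  have hint (τ : M ≃ₐ[K] M) {w : M} (hw : IsIntegral P w) : IsIntegral P (τ w) :=
    hw.map (τ.toAlgHom.restrictScalars P)
  obtain ⟨n, hn, hσn⟩ := isOfFinOrder_iff_pow_eq_one.1 (isOfFinOrder_of_finite σ)
  obtain ⟨β, hβ, hβ1, hβw⟩ := exists_common_denominator {w} fun y hy =>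
    Finset.mem_singleton.1 hy ▸ hw
  have h1 : v (σ β) = 1 := by
    refine (le_one_of_isIntegral hP (hint σ hβ)).antisymm (not_lt.1 fun h => ?_)
    have h2 : ∀ m : ℕ, 0 < m → v ((σ ^ m) β) < 1 := by
      intro m hm
      induction m, hm using Nat.le_induction with
      | base => simpa using h
      | succ m hm ih =>
        rw [pow_succ', AlgEquiv.mul_apply]
        exact hσ _ (hint _ hβ) ih
    have h3 := h2 n hn
    rw [hσn, AlgEquiv.one_apply, hβ1] at h3
    exact h3.false
  have h3 := le_one_of_isIntegral hP (hint σ (hβw w (Finset.mem_singleton_self w)))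
  rwa [_root_.map_mul, _root_.map_mul, h1, one_mul] at h3

/-- An automorphism preserving the center of `v` on the integral closure preserves `v`. -/
theorem Valuation.Integers.map_algEquiv_eq [FiniteDimensional K M]
    (hv : (v.comap (algebraMap K M)).Integers P)
    (σ : M ≃ₐ[K] M) (hσ : ∀ w, IsIntegral P w → v w < 1 → v (σ w) < 1) (w : M) :
    v (σ w) = v w := by
  obtain ⟨n, hn, hσn⟩ := isOfFinOrder_iff_pow_eq_one.1 (isOfFinOrder_of_finite σ)
  have h2 : ∀ {w : M}, v w ≤ 1 → v (σ w) ≤ 1 := fun hw =>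
    map_algEquiv_le_one hv.le_one_tower σ hσ
      (hv.mem_integralLocalization (Algebra.IsAlgebraic.isAlgebraic _) hw)
  have h3 : ∀ {w₁ w₂ : M}, v w₁ ≤ v w₂ → v (σ w₁) ≤ v (σ w₂) := by
    intro w₁ w₂ h
    by_cases hw : w₂ = 0
    · simp only [hw, _root_.map_zero, le_zero_iff] at h ⊢
      rw [v.zero_iff] at h
      simp [h]
    have h4 := @h2 (w₁ / w₂) (by rwa [map_div₀, div_le_one₀ (v.pos_iff.2 hw)])
    rwa [map_div₀, map_div₀, div_le_one₀ (v.pos_iff.2 (by simpa using hw))] at h4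
  refine le_antisymm ?_ ?_
  · by_contra! h
    have h4 : ∀ m : ℕ, 0 < m → v (σ w) ≤ v ((σ ^ m) w) := by
      intro m hm
      induction m, hm using Nat.le_induction with
      | base => simp
      | succ m hm ih =>
        rw [pow_succ', AlgEquiv.mul_apply]
        exact h3 (h.le.trans ih)
    have h5 := h4 n hn
    rw [hσn, AlgEquiv.one_apply] at h5
    exact h5.not_gt h
  · by_contra! h
    have h4 : ∀ m : ℕ, 0 < m → v ((σ ^ m) w) ≤ v (σ w) := by
      intro m hm
      induction m, hm using Nat.le_induction with
      | base => simp
      | succ m hm ih =>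
        rw [pow_succ', AlgEquiv.mul_apply]
        exact h3 (ih.trans h.le)
    have h5 := h4 n hn
    rw [hσn, AlgEquiv.one_apply] at h5
    exact h5.not_gt h

variable [FiniteDimensional K M] [IsGalois K M]

theorem Valuation.Integers.exists_henselian_generator
    (hchar : ∀ n : ℕ, n ≠ 0 → v (n : M) = 1)
    (hv : (v.comap (algebraMap K M)).Integers P) :
    ∃ z : M, IsIntegral P z ∧ v.Close z 1 ∧
      (∀ r ∈ (minpoly K z).aroots M, r ≠ z → v r < 1) ∧
      ∀ r : M, ∃ p : K[X], ∀ q : K[X], v (aeval z p - aeval z q) ≤ v (r - aeval z q) := by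
  classical
  let D : Subgroup (M ≃ₐ[K] M) :=
    { carrier := {σ | ∀ w, v (σ w) = v w}
      one_mem' := fun w => rfl
      mul_mem' := fun {a b} ha hb w => by rw [AlgEquiv.mul_apply, ha, hb]
      inv_mem' := fun {a} ha w => by rw [← ha, ← AlgEquiv.mul_apply, mul_inv_cancel, AlgEquiv.one_apply] }
  have hDF : (IntermediateField.fixedField D).fixingSubgroup = D :=
    IntermediateField.fixingSubgroup_fixedField D
  obtain ⟨z, hzF, hz, hz1, hz'⟩ := exists_decomposition_generator hv.le_one_tower
    hv.exists_mul_sub_one_lt (IntermediateField.fixedField D) fun σ hσ => by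
      rw [hDF]
      exact hv.map_algEquiv_eq σ hσ
  rw [hDF] at hz'
  refine ⟨z, hz, hz1, ?_, fun r => ?_⟩
  · intro r hr hrz
    obtain ⟨σ, rfl⟩ := minpoly.exists_algEquiv_of_root' (Algebra.IsAlgebraic.isAlgebraic z)
      (mem_aroots.1 hr).2
    exact hz' σ fun h => hrz (hzF ⟨σ, h⟩)
  · let ρ : M := (Fintype.card D : M)⁻¹ * ∑ σ : D, (σ : M ≃ₐ[K] M) r
    have hcard : v (Fintype.card D : M) = 1 := hchar _ Fintype.card_ne_zero
    have hcard0 : (Fintype.card D : M) ≠ 0 := fun h => by simp [h] at hcard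
    have hρ : ρ ∈ IntermediateField.adjoin K {z} := by
      rw [← IsGalois.fixedField_fixingSubgroup (IntermediateField.adjoin K {z}),
        IntermediateField.mem_fixedField_iff]
      intro τ hτ
      have h3 : τ z = z := hτ ⟨z, IntermediateField.mem_adjoin_simple_self K z⟩
      have hτ' : τ ∈ D := by
        by_contra h
        have h2 := hz' τ h
        rw [h3, hz1.map_eq, v.map_one] at h2
        exact h2.false
      simp only [ρ, _root_.map_mul, map_inv₀, map_natCast, map_sum]
      congr 1
      exact Fintype.sum_equiv (Equiv.mulLeft (⟨τ, hτ'⟩ : D)) _ _ fun σ => rfl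
    have hρ' : ρ ∈ (IntermediateField.adjoin K {z}).toSubalgebra := hρ
    rw [IntermediateField.adjoin_simple_toSubalgebra_of_isAlgebraic
      (Algebra.IsAlgebraic.isAlgebraic z), Algebra.adjoin_singleton_eq_range_aeval] at hρ'
    obtain ⟨p, hp⟩ := hρ'
    refine ⟨p, fun q => ?_⟩
    change aeval z p = ρ at hp
    have hq : ∀ σ : D, (σ : M ≃ₐ[K] M) (aeval z q) = aeval z q := fun σ => by
      have h : (σ : M ≃ₐ[K] M) z = z := hzF σ
      rw [← aeval_algHom_apply, h]
    have : aeval z p - aeval z q =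
        (Fintype.card D : M)⁻¹ * ∑ σ : D, (σ : M ≃ₐ[K] M) (r - aeval z q) := by
      simp only [_root_.map_sub, hq, Finset.sum_sub_distrib, Finset.sum_const, Finset.card_univ,
        nsmul_eq_mul, mul_sub, hp, ρ]
      rw [inv_mul_cancel_left₀ hcard0]
    rw [this, _root_.map_mul, map_inv₀, hcard, inv_one, one_mul]
    exact v.map_sum_le fun σ _ => (σ.2 _).le

end Decomposition

section AlgClosed

variable {P K Ω Γ : Type*} [CommRing P] [Field K] [Field Ω] [Algebra P K] [Algebra K Ω]
  [Algebra P Ω] [IsScalarTower P K Ω] [IsAlgClosed Ω]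

theorem IntermediateField.exists_isGalois_of_finset [CharZero K] (S : Finset Ω)
    (hS : ∀ r ∈ S, IsIntegral K r) :
    ∃ N : IntermediateField K Ω, ↑S ⊆ (N : Set Ω) ∧ FiniteDimensional K N ∧ IsGalois K N := by
  classical
  let f : K[X] := ∏ r ∈ S, minpoly K r
  have hf : f ≠ 0 := Finset.prod_ne_zero_iff.2 fun r hr => minpoly.ne_zero (hS r hr)
  have : IsSplittingField K (adjoin K (f.rootSet Ω)) f :=
    adjoin_rootSet_isSplittingField (IsAlgClosed.splits _)
  refine ⟨adjoin K (f.rootSet Ω), fun r hr => subset_adjoin _ _ ?_,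
    IsSplittingField.finiteDimensional _ f, ?_⟩
  · rw [mem_rootSet]
    refine ⟨hf, ?_⟩
    rw [map_prod]
    exact Finset.prod_eq_zero hr (minpoly.aeval _ _)
  · have : Normal K (adjoin K (f.rootSet Ω)) := .of_isSplittingField f
    have := IsSplittingField.finiteDimensional (adjoin K (f.rootSet Ω)) f
    exact ⟨⟩

variable [LinearOrderedCommGroupWithZero Γ] {v : Valuation Ω Γ}

theorem Valuation.Integers.exists_henselian_generator_of_isAlgClosed [CharZero K]
    (hchar : ∀ n : ℕ, n ≠ 0 → v (n : Ω) = 1)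
    (hv : (v.comap (algebraMap K Ω)).Integers P) (S : Finset Ω) (hS : ∀ r ∈ S, IsIntegral K r) :
    ∃ z : Ω, IsIntegral P z ∧ v.Close z 1 ∧
      (∀ r ∈ (minpoly K z).aroots Ω, r ≠ z → v r < 1) ∧
      ∀ r ∈ S, ∃ p : K[X], ∀ q : K[X], v (aeval z p - aeval z q) ≤ v (r - aeval z q) := by
  obtain ⟨N, hSN, _, _⟩ := IntermediateField.exists_isGalois_of_finset S hS
  have hv' : ((v.comap (algebraMap N Ω)).comap (algebraMap K N)).Integers P := hv
  obtain ⟨z, hz, hz1, hz', hr⟩ := hv'.exists_henselian_generator fun n hn => by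
    simpa using hchar n hn
  have : IsScalarTower P N Ω := .of_algebraMap_eq fun _ => rfl
  refine ⟨z, hz.map (IsScalarTower.toAlgHom P N Ω), hz1, ?_, fun r hrS => ?_⟩
  · intro r hr hrz
    have hmin : minpoly K (z : Ω) = minpoly K z :=
      minpoly.algebraMap_eq (algebraMap N Ω).injective z
    have hs : ((minpoly K z).map (algebraMap K N)).Splits := Normal.splits inferInstance z
    rw [hmin, aroots, IsScalarTower.algebraMap_eq K N Ω, ← map_map, hs.roots_map,
      Multiset.mem_map] at hr
    obtain ⟨s, hs, rfl⟩ := hr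
    exact hz' s hs fun h => hrz (h ▸ rfl)
  · obtain ⟨p, hp⟩ := hr ⟨r, hSN hrS⟩
    refine ⟨p, fun q => ?_⟩
    have h1 : ∀ q : K[X], aeval (z : Ω) q = ((aeval z q : N) : Ω) := fun q =>
      aeval_algHom_apply N.val z q
    rw [h1, h1]
    exact hp q

end AlgClosed

open IntermediateField

/-- Every nonzero element of `L` is congruent to an element of `K` up to terms of strictly smaller
valuation. -/
def Valuation.IsImmediate {K Ω Γ : Type*} [Field K] [Field Ω] [Algebra K Ω]
    [LinearOrderedCommGroupWithZero Γ] (v : Valuation Ω Γ) (L : IntermediateField K Ω) : Prop :=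
  ∀ y ∈ L, y ≠ 0 → ∃ a : K, v.Close (algebraMap K Ω a) y

theorem IntermediateField.apply_eq_self_of_mem_adjoin_simple {K Ω : Type*} [Field K] [Field Ω]
    [Algebra K Ω] {N : IntermediateField K Ω} (σ : N ≃ₐ[K] N) {x : Ω} (hx : x ∈ N)
    (h : σ ⟨x, hx⟩ = ⟨x, hx⟩) (w : N) (hw : (w : Ω) ∈ K⟮x⟯) : σ w = w := by
  obtain ⟨r, s, hrs⟩ := (mem_adjoin_simple_iff K _).1 hw
  have h1 : ∀ p : K[X], aeval x p = ((aeval (⟨x, hx⟩ : N) p : N) : Ω) := fun p =>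
    aeval_algHom_apply N.val (⟨x, hx⟩ : N) p
  have h2 : w = aeval ⟨x, hx⟩ r / aeval ⟨x, hx⟩ s := Subtype.ext <| by
    rw [hrs, h1, h1]
    rfl
  rw [h2, map_div₀, ← aeval_algHom_apply, ← aeval_algHom_apply, h]

section

variable {P K Ω Γ : Type*} [CommRing P] [Field K] [Field Ω] [Algebra P K] [Algebra K Ω]
  [Algebra P Ω] [IsScalarTower P K Ω]
  [LinearOrderedCommGroupWithZero Γ] {v : Valuation Ω Γ}

/-- `Valuation.exists_smooth_subalgebra` inside a larger field. -/
theorem Valuation.exists_smooth_subalgebra_of_le [IsDomain P] [IsIntegrallyClosed P]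
    [IsFractionRing P K]
    (hP : ∀ p, v (algebraMap P Ω p) ≤ 1)
    (hmax : ∀ p, v (algebraMap P Ω p) = 1 → ∃ p', v (algebraMap P Ω (p * p') - 1) < 1)
    (N F : IntermediateField K Ω) (hFN : F ≤ N) [FiniteDimensional K N] [IsGalois K N]
    (hF : ∀ σ : N ≃ₐ[K] N, (∀ w : N, IsIntegral P w → v w < 1 → v (σ w) < 1) →
      ∀ w : N, (w : Ω) ∈ F → σ w = w)
    (T : Finset Ω) (hTF : ∀ w ∈ T, w ∈ F)
    (hT : ∀ w : N, (w : Ω) ∈ T → w ∈ (v.comap (algebraMap N Ω)).integralLocalization P) :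
    ∃ B : Subalgebra P Ω, (∀ w ∈ T, w ∈ B) ∧ (∀ w ∈ B, w ∈ F ∧ v w ≤ 1) ∧ Algebra.Smooth P B := by
  classical
  have : IsScalarTower P N Ω := .of_algebraMap_eq fun _ => rfl
  obtain ⟨B, hTB, hBF, hB⟩ := exists_smooth_subalgebra (P := P) (k := K) (N := N)
    (v := v.comap (algebraMap N Ω)) hP hmax (F.comap N.val)
    (fun σ hσ => fun w => hF σ hσ w w.2) (T.preimage (algebraMap N Ω) Subtype.val_injective.injOn)
    (fun w hw => hTF _ (Finset.mem_preimage.1 hw)) (fun w hw => hT _ (Finset.mem_preimage.1 hw))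
  let φ : N →ₐ[P] Ω := IsScalarTower.toAlgHom P N Ω
  refine ⟨B.map φ, fun w hw => ⟨⟨w, hFN (hTF w hw)⟩, hTB _ (Finset.mem_preimage.2 hw), rfl⟩, ?_,
    .of_equiv (B.equivMapOfInjective φ Subtype.val_injective)⟩
  rintro _ ⟨w, hw, rfl⟩
  exact hBF w hw

theorem Valuation.eq_of_close_one {z w : Ω} (hz : IsIntegral K z)
    (hz' : ∀ r ∈ (minpoly K z).aroots Ω, r ≠ z → v r < 1) (hw : aeval w (minpoly K z) = 0)
    (hw1 : v.Close w 1) : w = z := by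
  by_contra h
  have h1 := hz' w (mem_aroots.2 ⟨minpoly.ne_zero hz, hw⟩) h
  rw [hw1.map_eq, v.map_one] at h1
  exact h1.false

variable [IsAlgClosed Ω] [CharZero K]

theorem Valuation.IsImmediate.exists_close_sub {x z : Ω} (hx : v.IsImmediate K⟮x⟯)
    (hz : IsIntegral K z) (hz1 : v.Close z 1)
    (hz' : ∀ r ∈ (minpoly K z).aroots Ω, r ≠ z → v r < 1) (q : K[X]) (hq : x - aeval z q ≠ 0) :
    ∃ a : K, v.Close (algebraMap K Ω a) (x - aeval z q) := by
  have h0 : aeval z (C (AdjoinSimple.gen K x) - q.map (algebraMap K K⟮x⟯)) = x - aeval z q := by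
    simp [aeval_map_algebraMap]
  have : CharZero K⟮x⟯ := charZero_of_injective_algebraMap (algebraMap K K⟮x⟯).injective
  obtain ⟨a, ha⟩ := v.exists_close_aeval (L := K⟮x⟯) hz.tower_top hz1 (fun r hr hrz => hz' r (by
    rw [mem_aroots] at hr ⊢
    refine ⟨minpoly.ne_zero hz, ?_⟩
    obtain ⟨g, hg⟩ := minpoly.dvd_map_of_isScalarTower K K⟮x⟯ z
    rw [← aeval_map_algebraMap K⟮x⟯, hg, _root_.map_mul, hr.2, zero_mul]) hrz)
    (C (AdjoinSimple.gen K x) - q.map (algebraMap K K⟮x⟯)) (by rwa [h0])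
  rw [h0] at ha
  obtain ⟨b, hb⟩ := hx a a.2 (ha.ne_zero_left)
  exact ⟨b, hb.trans ha⟩

theorem Valuation.IsImmediate.exists_sub_lt {x z : Ω} (hx : v.IsImmediate K⟮x⟯)
    (hz : IsIntegral K z) (hz1 : v.Close z 1)
    (hz' : ∀ r ∈ (minpoly K z).aroots Ω, r ≠ z → v r < 1) (S : Finset Ω)
    (hS : ∀ r ∈ S, ∃ p : K[X], ∀ q : K[X], v (aeval z p - aeval z q) ≤ v (r - aeval z q)) :
    ∃ q : K[X], aeval z q = x ∨ ∀ r ∈ S, v (x - aeval z q) < v (x - r) := by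
  classical
  by_cases h : ∃ q : K[X], aeval z q = x
  · exact h.imp fun _ => .inl
  push Not at h
  have h1 : ∀ r ∈ S, ∃ q : K[X], v (x - aeval z q) < v (x - r) := by
    intro r hr
    obtain ⟨p, hp⟩ := hS r hr
    obtain ⟨a, ha⟩ := hx.exists_close_sub hz hz1 hz' p (sub_ne_zero.2 (h p).symm)
    refine ⟨p + C a, not_le.1 fun h2 => ?_⟩
    have h3 : v (x - aeval z (p + C a)) < v (x - aeval z p) := by
      rw [v.map_sub_swap]
      have : aeval z (p + C a) - x = algebraMap K Ω a - (x - aeval z p) := by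
        rw [map_add, aeval_C]
        ring
      rw [this]
      exact ha
    have h4 : v (r - aeval z (p + C a)) ≤ v (x - aeval z (p + C a)) := by
      have : r - aeval z (p + C a) = (x - aeval z (p + C a)) - (x - r) := by ring
      rw [this]
      exact (v.map_sub _ _).trans (max_le le_rfl h2)
    have h5 := (hp (p + C a)).trans h4
    rw [show aeval z p - aeval z (p + C a) = - algebraMap K Ω a by simp, v.map_neg,
      ha.map_eq] at h5
    exact h5.not_gt h3
  induction S using Finset.induction_on with
  | empty => exact ⟨0, .inr (by simp)⟩
  | insert r S hr ih =>
    obtain ⟨q₁, hq₁⟩ := ih (fun r hr => hS r (Finset.mem_insert_of_mem hr))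
      fun r hr => h1 r (Finset.mem_insert_of_mem hr)
    obtain ⟨q₂, hq₂⟩ := h1 r (Finset.mem_insert_self _ _)
    replace hq₁ := hq₁.resolve_left (h q₁)
    rcases le_total (v (x - aeval z q₁)) (v (x - aeval z q₂)) with h2 | h2
    · refine ⟨q₁, .inr fun s hs => ?_⟩
      rcases Finset.mem_insert.1 hs with rfl | hs
      · exact h2.trans_lt hq₂
      · exact hq₁ s hs
    · refine ⟨q₂, .inr fun s hs => ?_⟩
      rcases Finset.mem_insert.1 hs with rfl | hs
      · exact hq₂
      · exact h2.trans_lt (hq₁ s hs)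

theorem Valuation.IsImmediate.exists_smooth_of_isAlgebraic
    (hchar : ∀ n : ℕ, n ≠ 0 → v (n : Ω) = 1)
    (hv : (v.comap (algebraMap K Ω)).Integers P) {x : Ω} (hx : v.IsImmediate K⟮x⟯)
    (hxK : IsAlgebraic K x) (T : Finset Ω) (hT : ∀ t ∈ T, t ∈ K⟮x⟯ ∧ v t ≤ 1) :
    ∃ B : Subalgebra P Ω, (∀ w ∈ T, w ∈ B) ∧ (∀ w ∈ B, w ∈ K⟮x⟯ ∧ v w ≤ 1) ∧
      Algebra.Smooth P B := by
  classical
  obtain ⟨z, hz, hz1, hz', hS⟩ := hv.exists_henselian_generator_of_isAlgClosed hchar {x}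
    fun r hr => Finset.mem_singleton.1 hr ▸ hxK.isIntegral
  have hzK : IsIntegral K z := hz.tower_top
  obtain ⟨q, hq⟩ := hx.exists_sub_lt hzK hz1 hz' {x} hS
  replace hq : aeval z q = x := hq.resolve_right fun h => by simpa using h x (by simp)
  obtain ⟨N, hxN, _, _⟩ := IntermediateField.exists_isGalois_of_finset (K := K) {x, z} fun r hr => by
    rcases Finset.mem_insert.1 hr with rfl | hr
    · exact hxK.isIntegral
    · exact Finset.mem_singleton.1 hr ▸ hzK
  have hxN' : x ∈ N := hxN (by simp)
  have hzN : z ∈ N := hxN (by simp)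
  have hle : K⟮x⟯ ≤ N := adjoin_simple_le_iff.2 hxN'
  have := hv.isFractionRing
  have := hv.isIntegrallyClosed
  have := hv.hom_inj.isDomain
  have : IsScalarTower P N Ω := .of_algebraMap_eq fun _ => rfl
  refine exists_smooth_subalgebra_of_le hv.le_one_tower hv.exists_mul_sub_one_lt N K⟮x⟯ hle ?_ T
    (fun w hw => (hT w hw).1) fun w hw => ?_
  · intro σ hσ w hw
    have h1 : IsIntegral P (⟨z, hzN⟩ - 1 : N) := by
      refine IsIntegral.sub ?_ isIntegral_one
      exact (isIntegral_algHom_iff (IsScalarTower.toAlgHom P N Ω) Subtype.val_injective).1 hz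
    have h2 := hσ _ h1 (by simpa [Close] using hz1)
    have h3 : ((σ ⟨z, hzN⟩ : N) : Ω) = z := by
      refine eq_of_close_one hzK hz' ?_ (by simpa [Close] using h2)
      have h4 : aeval (⟨z, hzN⟩ : N) (minpoly K z) = 0 := by
        apply (algebraMap N Ω).injective
        rw [← aeval_algebraMap_apply, _root_.map_zero]
        exact minpoly.aeval K z
      rw [show ((σ ⟨z, hzN⟩ : N) : Ω) = (N.val.comp σ.toAlgHom) ⟨z, hzN⟩ from rfl,
        aeval_algHom_apply, h4, _root_.map_zero]
    refine apply_eq_self_of_mem_adjoin_simple σ hxN' ?_ w hw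
    have h4 : (⟨x, hxN'⟩ : N) = aeval ⟨z, hzN⟩ q :=
      Subtype.ext (hq.symm.trans (aeval_algHom_apply N.val (⟨z, hzN⟩ : N) q))
    have h5 : σ ⟨z, hzN⟩ = ⟨z, hzN⟩ := Subtype.ext h3
    rw [h4, ← aeval_algHom_apply, h5]
  · exact Valuation.Integers.mem_integralLocalization (K := K) hv (M := N) (v := v.comap (algebraMap N Ω))
      (Algebra.IsAlgebraic.isAlgebraic w) (hT w hw).2

end

/-- The constant coefficient has strictly larger valuation than all the other coefficients. -/
def Valuation.ConstDominant {Ω Γ : Type*} [Field Ω] [LinearOrderedCommGroupWithZero Γ]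
    (v : Valuation Ω Γ) (Q : Polynomial Ω) : Prop :=
  Q.coeff 0 ≠ 0 ∧ ∀ j, 0 < j → v (Q.coeff j) < v (Q.coeff 0)

section

variable {Ω Γ : Type*} [Field Ω] [LinearOrderedCommGroupWithZero Γ] {v : Valuation Ω Γ} {Q : Polynomial Ω}

namespace Valuation.ConstDominant

theorem C_mul (h : v.ConstDominant Q) {a : Ω} (ha : a ≠ 0) : v.ConstDominant (C a * Q) := by
  refine ⟨by simp [ha, h.1], fun j hj => ?_⟩
  rw [coeff_C_mul, coeff_C_mul, _root_.map_mul, _root_.map_mul]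
  exact mul_lt_mul_of_pos_left (h.2 j hj) (v.pos_iff.2 ha)

theorem le (h : v.ConstDominant Q) (j : ℕ) : v (Q.coeff j) ≤ v (Q.coeff 0) := by
  rcases j.eq_zero_or_pos with rfl | hj
  · exact le_rfl
  · exact (h.2 j hj).le

theorem close_eval (h : v.ConstDominant Q) {u : Ω} (hu : v u ≤ 1) :
    v.Close (Q.eval u) (Q.coeff 0) := by
  rw [eval_eq_sum_range, Finset.sum_range_succ', pow_zero, mul_one]
  refine close_add_of_lt (v.map_sum_lt (v.ne_zero_iff.2 h.1) fun i _ => ?_)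
  rw [_root_.map_mul, _root_.map_pow]
  exact (mul_le_of_le_one_right' (pow_le_one' hu _)).trans_lt (h.2 _ i.succ_pos)

theorem eq_of_mul_eval_eq (h : v.ConstDominant Q) {u w : Ω} (hu : v u ≤ 1) (hw : v w ≤ 1)
    (huw : w * Q.eval w = u * Q.eval u) : w = u := by
  by_contra hne
  have hpow : ∀ n : ℕ, v (w ^ n - u ^ n) ≤ v (w - u) := by
    intro n
    induction n with
    | zero => simp
    | succ n ih =>
      have : w ^ (n + 1) - u ^ (n + 1) = w * (w ^ n - u ^ n) + (w - u) * u ^ n := by ring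
      rw [this]
      refine (v.map_add _ _).trans (max_le ?_ ?_)
      · rw [_root_.map_mul]
        exact (mul_le_of_le_one_left' hw).trans ih
      · rw [_root_.map_mul, _root_.map_pow]
        exact mul_le_of_le_one_right' (pow_le_one' hu _)
  have hsum : ∑ i ∈ Finset.range Q.natDegree, Q.coeff (i + 1) * (w ^ (i + 2) - u ^ (i + 2)) =
      - (Q.coeff 0 * (w - u)) := by
    rw [eval_eq_sum_range, eval_eq_sum_range, Finset.sum_range_succ', Finset.sum_range_succ',
      mul_add, mul_add, Finset.mul_sum, Finset.mul_sum] at huw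
    simp only [mul_sub, Finset.sum_sub_distrib]
    have (x : Ω) : ∑ i ∈ Finset.range Q.natDegree, Q.coeff (i + 1) * x ^ (i + 2) =
        ∑ i ∈ Finset.range Q.natDegree, x * (Q.coeff (i + 1) * x ^ (i + 1)) :=
      Finset.sum_congr rfl fun i _ => by ring
    rw [this, this]
    linear_combination huw
  have h0 : v (w - u) ≠ 0 := v.ne_zero_iff.2 (sub_ne_zero.2 hne)
  have hlt : v (∑ i ∈ Finset.range Q.natDegree, Q.coeff (i + 1) * (w ^ (i + 2) - u ^ (i + 2))) <
      v (Q.coeff 0 * (w - u)) := by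
    refine v.map_sum_lt (by simpa [h.1] using h0) fun i _ => ?_
    rw [_root_.map_mul, _root_.map_mul]
    exact (mul_le_mul_right (hpow _) _).trans_lt
      (mul_lt_mul_of_pos_right (h.2 _ i.succ_pos) (zero_lt_iff.2 h0))
  rw [hsum, v.map_neg] at hlt
  exact hlt.false

theorem comp_linear [IsAlgClosed Ω] {p : Polynomial Ω} (hp : p ≠ 0) {b c : Ω}
    (h : ∀ r ∈ p.roots, v c < v (b - r)) : v.ConstDominant (p.comp (C b + C c * X)) := by
  have h1 := (IsAlgClosed.splits p).eq_prod_roots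
  have h2 : p.comp (C b + C c * X) = C p.leadingCoeff *
      ((p.roots.map (b - ·)).map fun r => C r + C c * X).prod := by
    conv_lhs => rw [h1]
    rw [mul_comp, C_comp, multiset_prod_comp, Multiset.map_map, Multiset.map_map]
    congr 3
    ext r : 1
    simp only [Function.comp_apply, sub_comp, X_comp, C_comp, _root_.map_sub]
    ring
  have h3 : ∀ r ∈ p.roots.map (b - ·), v c < v r := by
    intro r hr
    obtain ⟨s, hs, rfl⟩ := Multiset.mem_map.1 hr
    exact h s hs
  obtain ⟨h4, h5⟩ := coeff_prod_linear_lt v h3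
  rw [h2]
  refine C_mul ⟨?_, fun j hj => ?_⟩ (leadingCoeff_ne_zero.2 hp)
  · rw [h4]
    refine Multiset.prod_ne_zero ?_
    intro h0
    simpa using h3 0 h0
  · rw [h4]
    exact h5 j hj

theorem divX_comp_linear [IsAlgClosed Ω] {p : Polynomial Ω} (hp : p ≠ 0) (hp' : p.roots.Nodup) {b c : Ω}
    (hc : c ≠ 0) (hb : p.eval b = 0)
    (h : ∀ r ∈ p.roots, r ≠ b → v c < v (b - r)) :
    v.ConstDominant (p.comp (C b + C c * X)).divX ∧
      (p.comp (C b + C c * X)).divX.coeff 0 = c * p.derivative.eval b := by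
  classical
  obtain ⟨g, rfl⟩ := dvd_iff_isRoot.2 hb
  have hg : g ≠ 0 := right_ne_zero_of_mul hp
  have h1 : (((X - C b) * g).comp (C b + C c * X)).divX = C c * g.comp (C b + C c * X) := by
    have : ((X - C b) * g).comp (C b + C c * X) = (C c * g.comp (C b + C c * X)) * X := by
      simp only [mul_comp, sub_comp, X_comp, C_comp]
      ring
    rw [this]
    ext n
    rw [coeff_divX, coeff_mul_X]
  rw [roots_mul hp, roots_X_sub_C, Multiset.singleton_add, Multiset.nodup_cons] at hp'
  rw [h1]
  refine ⟨(comp_linear hg fun r hr => h r ?_ ?_).C_mul hc, ?_⟩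
  · rw [roots_mul hp]
    exact Multiset.mem_add.2 (.inr hr)
  · rintro rfl
    exact hp'.1 hr
  · simp [coeff_zero_eq_eval_zero, eval_comp]

end Valuation.ConstDominant

end

section

variable {K Ω Γ : Type*} [Field K] [Field Ω] [Algebra K Ω] [IsAlgClosed Ω]
  [LinearOrderedCommGroupWithZero Γ] {v : Valuation Ω Γ}

theorem exists_mem_aroots_minpoly_eq_aeval {z r : Ω} (hz : IsIntegral K z) (q : K[X])
    (hr : r ∈ (minpoly K (aeval z q)).aroots Ω) :
    ∃ w ∈ (minpoly K z).aroots Ω, r = aeval w q := by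
  have : Algebra.IsAlgebraic K K⟮z⟯ := isAlgebraic_adjoin_simple hz
  have h1 := Algebra.IsAlgebraic.range_eval_eq_rootSet_minpoly (F := K) (K := K⟮z⟯) Ω
    (aeval (AdjoinSimple.gen K z) q)
  have h2 : aeval z q = algebraMap K⟮z⟯ Ω (aeval (AdjoinSimple.gen K z) q) := by
    rw [← aeval_algebraMap_apply, AdjoinSimple.algebraMap_gen]
  rw [h2, minpoly.algebraMap_eq (algebraMap K⟮z⟯ Ω).injective] at hr
  rw [mem_aroots, ← mem_rootSet, ← h1] at hr
  obtain ⟨ψ, rfl⟩ := hr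
  refine ⟨ψ (AdjoinSimple.gen K z), ?_, ?_⟩
  · rw [mem_aroots, aeval_algHom_apply]
    refine ⟨minpoly.ne_zero hz, ?_⟩
    rw [← minpoly_gen K z, minpoly.aeval, _root_.map_zero]
  · rw [aeval_algHom_apply]

variable [CharZero K]

/-- Perturbing `aeval z q` inside `K(z)` to a nearby element which is at least as close to `x` and
closer to `x` than all its other conjugates. -/
theorem Valuation.IsImmediate.exists_separated_approx {x z : Ω}
    (hchar : ∀ n : ℕ, n ≠ 0 → v (n : Ω) = 1) (hx : v.IsImmediate K⟮x⟯)
    (hz : IsIntegral K z) (hz1 : v.Close z 1)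
    (hz' : ∀ r ∈ (minpoly K z).aroots Ω, r ≠ z → v r < 1) (q : K[X]) (hq : x - aeval z q ≠ 0) :
    ∃ q' : K[X], v (x - aeval z q') < v (x - aeval z q) ∧
      ∀ r ∈ (minpoly K (aeval z q')).aroots Ω, r ≠ aeval z q' →
        v (x - aeval z q') < v (aeval z q' - r) := by
  classical
  obtain ⟨d, hd⟩ := hx.exists_close_sub hz hz1 hz' q hq
  set d' := algebraMap K Ω d with hd'
  have hd0 : v d' ≠ 0 := v.ne_zero_iff.2 hd.ne_zero_left
  let g : ℕ → Ω → Ω := fun n w => (aeval z q - aeval w q) + d' * (n * (z - w))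
  have hzw : ∀ w ∈ (minpoly K z).aroots Ω, w ≠ z → v (z - w) = 1 := by
    intro w hw hwz
    have h2 : v w < v z := by
      rw [hz1.map_eq, v.map_one]
      exact hz' w hw hwz
    rw [v.map_sub_eq_of_lt_left h2, hz1.map_eq, v.map_one]
  have hbad : ∀ w ∈ (minpoly K z).aroots Ω, w ≠ z → {n : ℕ | v (g n w) < v d'}.Subsingleton := by
    intro w hw hwz
    have h1 : ∀ m n : ℕ, v (g m w) < v d' → v (g n w) < v d' → m ≤ n := by
      intro m n hm hn
      by_contra! h
      have h2 : v (g m w - g n w) < v d' := v.map_sub_lt hm hn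
      have h3 : g m w - g n w = d' * (((m - n : ℕ) : Ω) * (z - w)) := by
        rw [Nat.cast_sub h.le]
        simp only [g]
        ring
      rw [h3, _root_.map_mul, _root_.map_mul, hzw w hw hwz, hchar _ (Nat.sub_ne_zero_of_lt h), mul_one,
        mul_one] at h2
      exact h2.false
    exact fun m hm n hn => (h1 m n hm hn).antisymm (h1 n m hn hm)
  have hfin : (⋃ w ∈ {w ∈ (minpoly K z).aroots Ω |>.toFinset | w ≠ z},
      {n : ℕ | v (g n w) < v d'}).Finite := by
    refine Set.Finite.biUnion (Finset.finite_toSet _) fun w hw => (hbad w ?_ ?_).finite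
    · simpa using (Finset.mem_filter.1 hw).1
    · exact (Finset.mem_filter.1 hw).2
  obtain ⟨n, hn⟩ := hfin.exists_notMem
  replace hn : ∀ w ∈ (minpoly K z).aroots Ω, w ≠ z → v d' ≤ v (g n w) := by
    intro w hw hwz
    by_contra! h
    exact hn (Set.mem_biUnion (x := w) (by
      simp only [Finset.mem_coe, Finset.mem_filter, Multiset.mem_toFinset]
      exact ⟨hw, hwz⟩) h)
  refine ⟨q + C d * (C (n : K) * (X - 1) + 1), ?_⟩
  have hev : ∀ w : Ω, aeval w (q + C d * (C (n : K) * (X - 1) + 1)) =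
      aeval w q + d' * (n * (w - 1) + 1) := fun w => by simp [hd']
  have hlt : v (x - aeval z (q + C d * (C (n : K) * (X - 1) + 1))) < v d' := by
    have : x - aeval z (q + C d * (C (n : K) * (X - 1) + 1)) =
        -(d' - (x - aeval z q)) - d' * (n * (z - 1)) := by
      rw [hev]
      ring
    rw [this]
    refine v.map_sub_lt ?_ ?_
    · rw [v.map_neg, hd.map_eq]
      exact hd
    · rw [_root_.map_mul]
      refine mul_lt_of_lt_one_right (zero_lt_iff.2 hd0) ?_
      rw [_root_.map_mul]
      refine (mul_le_of_le_one_left' ?_).trans_lt (Close.one_iff.1 hz1)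
      rcases eq_or_ne n 0 with rfl | h
      · simp
      · exact (hchar n h).le
  refine ⟨hd.map_eq ▸ hlt, fun r hr hrb => ?_⟩
  obtain ⟨w, hw, rfl⟩ := exists_mem_aroots_minpoly_eq_aeval hz _ hr
  have hwz : w ≠ z := by
    rintro rfl
    exact hrb rfl
  refine hlt.trans_le ((hn w hw hwz).trans_eq ?_)
  congr 1
  rw [hev, hev]
  simp only [g]
  ring

end

theorem Valuation.ConstDominant.mem_integralLocalization {R N Γ : Type*} [CommRing R] [Field N]
    [Algebra R N] [LinearOrderedCommGroupWithZero Γ] {v : Valuation N Γ}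
    (hP : ∀ r, v (algebraMap R N r) ≤ 1) {H : N[X]} (hH1 : v (H.coeff 0) = 1)
    (hH : ∀ i, H.coeff i ∈ v.integralLocalization R) {u : N} (hu : v u ≤ 1)
    {θ : R} (hθ : u * H.eval u = algebraMap R N θ) : u ∈ v.integralLocalization R := by
  refine mem_integralLocalization_of_aeval_eq_zero hP hu (H * X - C (algebraMap R N θ)) ?_ ?_ ⟨1, ?_⟩
  · intro i
    rw [coeff_sub]
    refine sub_mem ?_ ?_
    · cases i with
      | zero => simp
      | succ i =>
        rw [coeff_mul_X]
        exact hH i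
    · rw [coeff_C]
      split_ifs
      · exact Subalgebra.algebraMap_mem _ θ
      · exact zero_mem _
  · simp [← hθ, mul_comm]
  · rw [coeff_sub, coeff_mul_X, coeff_C_of_ne_zero one_ne_zero, sub_zero, hH1]

section

variable {P K R k Ω Γ : Type*} [CommRing P] [Field K] [CommRing R] [Field k] [Field Ω]
  [Algebra P K] [Algebra K Ω] [Algebra P Ω] [IsScalarTower P K Ω]
  [Algebra R k] [Algebra k Ω] [Algebra R Ω] [IsScalarTower R k Ω]
  [Algebra K k] [IsScalarTower K k Ω] [Algebra P k] [IsScalarTower P k Ω] [Algebra P R] [IsScalarTower P R Ω]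
  [LinearOrderedCommGroupWithZero Γ] {v : Valuation Ω Γ} [IsAlgClosed Ω] [CharZero k]

theorem Valuation.Integers.exists_smooth_of_mul_eval_eq
    (hv : (v.comap (algebraMap K Ω)).Integers P)
    [IsDomain R] [IsIntegrallyClosed R] [IsFractionRing R k]
    (hR : ∀ r, v (algebraMap R Ω r) ≤ 1)
    (hmax : ∀ r, v (algebraMap R Ω r) = 1 → ∃ r', v (algebraMap R Ω (r * r') - 1) < 1)
    {z : Ω} (hz : IsIntegral P z) (hz1 : v.Close z 1)
    (hz' : ∀ r ∈ (minpoly K z).aroots Ω, r ≠ z → v r < 1)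
    {H : K[X][X]} (hH : v.ConstDominant (H.map (aeval z : K[X] →ₐ[K] Ω).toRingHom))
    (hH1 : v (aeval z (H.coeff 0)) = 1) {u : Ω} (hu : v u ≤ 1) {θ : R}
    (hθ : u * (H.map (aeval z : K[X] →ₐ[K] Ω).toRingHom).eval u = algebraMap R Ω θ)
    {x : Ω} (hx : IsAlgebraic k x) {b : K[X]} {c : K} (hc : c ≠ 0)
    (hxu : x = aeval z b + algebraMap K Ω c * u) (T : Finset Ω) (hTx : ∀ t ∈ T, t ∈ k⟮x⟯)
    (hT : ∀ t ∈ T, ∃ a : P, ∃ E₁ E₂ : K[X][X],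
      (∀ i, v (aeval z (E₁.coeff i)) ≤ 1) ∧ (∀ i, v (aeval z (E₂.coeff i)) ≤ 1) ∧
      v ((E₂.map (aeval z : K[X] →ₐ[K] Ω).toRingHom).eval u) = 1 ∧
      t = algebraMap P Ω a * (E₁.map (aeval z : K[X] →ₐ[K] Ω).toRingHom).eval u *
        ((E₂.map (aeval z : K[X] →ₐ[K] Ω).toRingHom).eval u)⁻¹) :
    ∃ B : Subalgebra R Ω, (∀ w ∈ T, w ∈ B) ∧ (∀ w ∈ B, w ∈ k⟮x⟯ ∧ v w ≤ 1) ∧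
      Algebra.Smooth R B := by
  classical
  have hzK : IsIntegral K z := hz.tower_top
  obtain ⟨N, hxN, _, _⟩ := IntermediateField.exists_isGalois_of_finset (K := k) {x, z} fun r hr => by
    rcases Finset.mem_insert.1 hr with rfl | hr
    · exact hx.isIntegral
    · exact Finset.mem_singleton.1 hr ▸ hzK.tower_top
  have hxN' : x ∈ N := hxN (by simp)
  have hzN : z ∈ N := hxN (by simp)
  have hle : k⟮x⟯ ≤ N := adjoin_simple_le_iff.2 hxN'
  have : IsScalarTower R N Ω := .of_algebraMap_eq fun _ => rfl
  have : IsScalarTower K N Ω := .of_algebraMap_eq fun _ => rfl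
  have : IsScalarTower P N Ω := .of_algebraMap_eq fun _ => rfl
  have : IsScalarTower P R N := .of_algebraMap_eq fun p => Subtype.ext <|
    IsScalarTower.algebraMap_apply P R Ω p
  have : IsScalarTower P K N := .of_algebraMap_eq fun p => Subtype.ext <|
    IsScalarTower.algebraMap_apply P K Ω p
  let zN : N := ⟨z, hzN⟩
  let xN : N := ⟨x, hxN'⟩
  let ι : N →ₐ[K] Ω := IsScalarTower.toAlgHom K N Ω
  have hι : Function.Injective ι := Subtype.val_injective
  have hev (p : K[X]) : ι (aeval zN p) = aeval z p := (aeval_algHom_apply ι zN p).symm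
  let uN : N := (xN - aeval zN b) / algebraMap K N c
  have hc' : algebraMap K Ω c ≠ 0 := by simpa using hc
  have hcN : algebraMap K N c ≠ 0 := by simpa using hc
  have huN : ι uN = u := by
    simp only [uN, map_div₀, _root_.map_sub, hev]
    rw [show ι xN = x from rfl, ι.commutes, hxu]
    field_simp
    ring
  have hxuN : xN = aeval zN b + algebraMap K N c * uN := by
    simp only [uN]
    field_simp
    ring
  let vN := v.comap (algebraMap N Ω)
  let φN : K[X] →+* N := (aeval zN : K[X] →ₐ[K] N).toRingHom
  have hcomp : (aeval z : K[X] →ₐ[K] Ω).toRingHom = (ι : N →+* Ω).comp φN :=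
    RingHom.ext fun p => (hev p).symm
  have heval (E : K[X][X]) : ι ((E.map φN).eval uN) =
      (E.map (aeval z : K[X] →ₐ[K] Ω).toRingHom).eval u := by
    rw [hcomp, ← Polynomial.map_map, ← huN]
    exact (eval_map_apply (ι : N →+* Ω) uN).symm
  have hmem (w : N) (hw : IsAlgebraic K w) (hw1 : vN w ≤ 1) : w ∈ vN.integralLocalization R := by
    have hvN : (vN.comap (algebraMap K N)).Integers P := by
      have : vN.comap (algebraMap K N) = v.comap (algebraMap K Ω) := by
        rw [IsScalarTower.algebraMap_eq K N Ω]
        rfl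
      rwa [this]
    obtain ⟨β, h1, h2, h3⟩ := hvN.mem_integralLocalization hw hw1
    exact ⟨β, h1.tower_top, h2, h3.tower_top⟩
  have halg (p : K[X]) : IsAlgebraic K (aeval zN p) := by
    have hzN : IsIntegral K zN := (isIntegral_algHom_iff ι hι).1 hzK
    exact (show IsIntegral K (aeval zN p) from
      adjoin_le_integralClosure hzN (aeval_mem_adjoin_singleton K zN)).isAlgebraic
  have hcoef (E : K[X][X]) (hE : ∀ i, v (aeval z (E.coeff i)) ≤ 1) (i : ℕ) :
      (E.map φN).coeff i ∈ vN.integralLocalization R := by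
    rw [coeff_map]
    refine hmem _ (halg _) ?_
    change v (ι (aeval zN (E.coeff i))) ≤ 1
    rw [hev]
    exact hE i
  have hHle (i : ℕ) : v (aeval z (H.coeff i)) ≤ 1 := by
    have := hH.le i
    rw [coeff_map, coeff_map] at this
    exact this.trans_eq hH1
  have huN1 : vN uN ≤ 1 := by
    change v (ι uN) ≤ 1
    rwa [huN]
  have hHN1 : vN ((H.map φN).coeff 0) = 1 := by
    rw [coeff_map]
    change v (ι (aeval zN (H.coeff 0))) = 1
    rwa [hev]
  have hHN : vN.ConstDominant (H.map φN) := by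
    rw [hcomp, ← Polynomial.map_map] at hH
    refine ⟨fun h => hH.1 ?_, fun j hj => ?_⟩
    · rw [coeff_map, h, _root_.map_zero]
    · have := hH.2 j hj
      rwa [coeff_map _ j, coeff_map _ 0] at this
  have hθN : uN * (H.map φN).eval uN = algebraMap R N θ := by
    apply hι
    rw [_root_.map_mul, heval, huN, hθ]
    rfl
  have humem : uN ∈ vN.integralLocalization R :=
    ConstDominant.mem_integralLocalization (v := vN) hR hHN1 (hcoef H hHle) huN1 hθN
  have hemem (E : K[X][X]) (hE : ∀ i, v (aeval z (E.coeff i)) ≤ 1) :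
      (E.map φN).eval uN ∈ vN.integralLocalization R := by
    rw [eval_eq_sum_range]
    exact sum_mem fun i _ => mul_mem (hcoef E hE i) (pow_mem humem i)
  refine exists_smooth_subalgebra_of_le hR hmax N k⟮x⟯ hle ?_ T hTx fun w hw => ?_
  · intro σ hσ w hw
    have h1 : IsIntegral R (zN - 1 : N) := by
      refine IsIntegral.sub ?_ isIntegral_one
      exact ((isIntegral_algHom_iff (IsScalarTower.toAlgHom P N Ω) Subtype.val_injective
        (x := zN)).1 hz).tower_top
    have h2 := hσ _ h1 (by simpa [Close] using hz1)
    have : IsScalarTower K k N := .of_algebraMap_eq fun p => Subtype.ext <|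
      IsScalarTower.algebraMap_apply K k Ω p
    let σK : N →ₐ[K] N := σ.toAlgHom.restrictScalars K
    have h3 : σK zN = zN := by
      apply hι
      change ι (σK zN) = z
      refine eq_of_close_one hzK hz' ?_ ?_
      · rw [aeval_algHom_apply, aeval_algHom_apply]
        have h4 : aeval zN (minpoly K z) = 0 := by
          apply hι
          rw [hev, minpoly.aeval, _root_.map_zero]
        rw [h4, _root_.map_zero, _root_.map_zero]
      · rw [_root_.map_sub, _root_.map_one] at h2
        exact Close.one_iff.2 h2
    have hfix (p : K[X]) : σK (aeval zN p) = aeval zN p := by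
      rw [← aeval_algHom_apply, h3]
    have hmapσ : (H.map φN).map (σK : N →+* N) = H.map φN := by
      rw [Polynomial.map_map]
      congr 1
      exact RingHom.ext hfix
    have h5 : σK uN = uN := by
      refine hHN.eq_of_mul_eval_eq huN1 (map_algEquiv_le_one (v := vN) hR σ hσ humem) ?_
      have h6 : σK ((H.map φN).eval uN) = (H.map φN).eval (σK uN) := by
        conv_rhs => rw [← hmapσ]
        exact (eval_map_apply (σK : N →+* N) uN).symm
      rw [← h6, ← _root_.map_mul, hθN]
      exact (σ.toAlgHom.restrictScalars R).commutes θ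
    refine apply_eq_self_of_mem_adjoin_simple σ hxN' ?_ w hw
    change σK xN = xN
    rw [hxuN, map_add, _root_.map_mul, hfix, h5, σK.commutes]
  · obtain ⟨a, E₁, E₂, h1, h2, h3, h4⟩ := hT _ hw
    have : w = algebraMap R N (algebraMap P R a) * (E₁.map φN).eval uN *
        ((E₂.map φN).eval uN)⁻¹ := by
      apply hι
      rw [_root_.map_mul, _root_.map_mul, map_inv₀, heval, heval, ← IsScalarTower.algebraMap_apply]
      exact h4
    rw [this]
    refine mul_mem (mul_mem (Subalgebra.algebraMap_mem _ _) (hemem E₁ h1))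
      (inv_mem_integralLocalization (hemem E₂ h2) ?_)
    change v (ι _) = 1
    rw [heval, h3]

end

section

variable {P K Ω : Type*} [CommRing P] [Field K] [Field Ω]
  [Algebra P K] [Algebra K Ω] [Algebra P Ω] [IsScalarTower P K Ω]

theorem Transcendental.isFractionRing_adjoin_simple [IsFractionRing P K] {θ : Ω}
    (hθ : Transcendental K θ) [Algebra P[X] K⟮θ⟯]
    (h : ∀ p : P[X], algebraMap P[X] K⟮θ⟯ p = Polynomial.aeval (AdjoinSimple.gen K θ) p) :
    IsFractionRing P[X] K⟮θ⟯ := by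
  have : IsScalarTower P K⟮θ⟯ Ω := .of_algebraMap_eq fun _ => rfl
  have hev (p : P[X]) : ((algebraMap P[X] K⟮θ⟯ p : K⟮θ⟯) : Ω) = Polynomial.aeval θ p := by
    rw [h]
    exact (aeval_algHom_apply (IsScalarTower.toAlgHom P K⟮θ⟯ Ω) (AdjoinSimple.gen K θ) p).symm
  have hθP : Transcendental P θ := hθ.restrictScalars (IsFractionRing.injective P K)
  have : FaithfulSMul P[X] K⟮θ⟯ := by
    rw [faithfulSMul_iff_algebraMap_injective]
    intro p q hpq
    apply transcendental_iff_injective.1 hθP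
    rw [← hev, ← hev, hpq]
  refine IsFractionRing.of_field _ _ fun w => ?_
  obtain ⟨r, s, hrs⟩ := (mem_adjoin_simple_iff K _).1 w.2
  obtain ⟨c, hc, hc'⟩ := IsLocalization.integerNormalization_spec (nonZeroDivisors P) r
  obtain ⟨d, hd, hd'⟩ := IsLocalization.integerNormalization_spec (nonZeroDivisors P) s
  have h0 : ∀ c ∈ nonZeroDivisors P, algebraMap P Ω c ≠ 0 := fun c hc => by
    rw [IsScalarTower.algebraMap_apply P K Ω]
    exact (_root_.map_ne_zero _).2 (IsLocalization.map_units K ⟨c, hc⟩).ne_zero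
  have hr : Polynomial.aeval θ (IsLocalization.integerNormalization (nonZeroDivisors P) r) =
      algebraMap P Ω c * Polynomial.aeval θ r := by
    rw [← aeval_map_algebraMap K, hc', ← algebraMap_smul K c r, _root_.map_smul, algebraMap_smul, Algebra.smul_def]
  have hs : Polynomial.aeval θ (IsLocalization.integerNormalization (nonZeroDivisors P) s) =
      algebraMap P Ω d * Polynomial.aeval θ s := by
    rw [← aeval_map_algebraMap K, hd', ← algebraMap_smul K d s, _root_.map_smul, algebraMap_smul, Algebra.smul_def]
  refine ⟨C d * IsLocalization.integerNormalization (nonZeroDivisors P) r,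
    C c * IsLocalization.integerNormalization (nonZeroDivisors P) s, Subtype.ext ?_⟩
  have hc0 := h0 c hc
  have hd0 := h0 d hd
  rw [IntermediateField.coe_div, hev, hev, _root_.map_mul, _root_.map_mul, aeval_C, aeval_C, hr, hs, hrs]
  by_cases h1 : Polynomial.aeval θ s = 0
  · simp [h1]
  · field_simp

variable {Γ : Type*} [LinearOrderedCommGroupWithZero Γ] {v : Valuation Ω Γ}

theorem Valuation.map_aeval_le_one (hP : ∀ p, v (algebraMap P Ω p) ≤ 1) {θ : Ω} (hθ : v θ ≤ 1)
    (r : P[X]) : v (aeval θ r) ≤ 1 := by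
  rw [aeval_eq_sum_range]
  refine v.map_sum_le fun i _ => ?_
  rw [Algebra.smul_def, _root_.map_mul, _root_.map_pow]
  exact mul_le_one' (hP _) (pow_le_one' hθ _)

theorem Valuation.exists_aeval_mul_sub_one_lt (hP : ∀ p, v (algebraMap P Ω p) ≤ 1)
    (hmax : ∀ p, v (algebraMap P Ω p) = 1 → ∃ p', v (algebraMap P Ω (p * p') - 1) < 1)
    {θ : Ω} (hθ : v.Close θ 1) (r : P[X]) (hr : v (aeval θ r) = 1) :
    ∃ r', v (aeval θ (r * r') - 1) < 1 := by
  obtain ⟨g, hg⟩ := X_sub_C_dvd_sub_C_eval (a := 1) (p := r)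
  have hθ1 : v θ ≤ 1 := (hθ.map_eq.trans v.map_one).le
  have h1 : v (aeval θ r - algebraMap P Ω (r.eval 1)) < 1 := by
    have := congrArg (fun p => v (aeval θ p)) hg
    simp only [_root_.map_sub, aeval_C, _root_.map_mul, aeval_X, _root_.map_one] at this
    rw [this]
    exact (mul_le_of_le_one_right' (map_aeval_le_one hP hθ1 g)).trans_lt (Close.one_iff.1 hθ)
  have h2 : v (algebraMap P Ω (r.eval 1)) = 1 := by
    rw [v.map_sub_swap, ← hr] at h1
    rw [← hr]
    exact Valuation.map_eq_of_sub_lt v h1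
  obtain ⟨p', hp'⟩ := hmax _ h2
  refine ⟨C p', ?_⟩
  have : aeval θ (r * C p') - 1 = (aeval θ r - algebraMap P Ω (r.eval 1)) * algebraMap P Ω p' +
      (algebraMap P Ω (r.eval 1 * p') - 1) := by
    rw [_root_.map_mul, _root_.map_mul, aeval_C]
    ring
  rw [this]
  refine v.map_add_lt ?_ hp'
  rw [_root_.map_mul]
  exact (mul_le_of_le_one_right' (hP _)).trans_lt h1

variable [IsAlgClosed Ω] [CharZero K]

theorem Valuation.Integers.exists_smooth_of_transcendental_mul_eval
    (hv : (v.comap (algebraMap K Ω)).Integers P)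
    {z : Ω} (hz : IsIntegral P z) (hz1 : v.Close z 1)
    (hz' : ∀ r ∈ (minpoly K z).aroots Ω, r ≠ z → v r < 1)
    {H : K[X][X]} (hH : v.ConstDominant (H.map (aeval z : K[X] →ₐ[K] Ω).toRingHom))
    (hH1 : v (aeval z (H.coeff 0)) = 1) {u : Ω} (hu : v u ≤ 1) {θ : Ω}
    (hθ : u * (H.map (aeval z : K[X] →ₐ[K] Ω).toRingHom).eval u = θ) (hθ1 : v.Close θ 1)
    (hθK : Transcendental K θ)
    {x : Ω} (hx : IsAlgebraic K⟮θ⟯ x) (hθx : θ ∈ K⟮x⟯) {b : K[X]} {c : K} (hc : c ≠ 0)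
    (hxu : x = aeval z b + algebraMap K Ω c * u) (T : Finset Ω) (hTx : ∀ t ∈ T, t ∈ K⟮x⟯)
    (hT : ∀ t ∈ T, ∃ a : P, ∃ E₁ E₂ : K[X][X],
      (∀ i, v (aeval z (E₁.coeff i)) ≤ 1) ∧ (∀ i, v (aeval z (E₂.coeff i)) ≤ 1) ∧
      v ((E₂.map (aeval z : K[X] →ₐ[K] Ω).toRingHom).eval u) = 1 ∧
      t = algebraMap P Ω a * (E₁.map (aeval z : K[X] →ₐ[K] Ω).toRingHom).eval u *
        ((E₂.map (aeval z : K[X] →ₐ[K] Ω).toRingHom).eval u)⁻¹) :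
    ∃ B : Subalgebra P Ω, (∀ w ∈ T, w ∈ B) ∧ (∀ w ∈ B, w ∈ K⟮x⟯ ∧ v w ≤ 1) ∧
      Algebra.Smooth P B := by
  have := hv.isFractionRing
  have := hv.isIntegrallyClosed
  have := hv.hom_inj.isDomain
  have : IsScalarTower P K⟮θ⟯ Ω := .of_algebraMap_eq fun _ => rfl
  let f : P[X] →ₐ[P] K⟮θ⟯ := aeval (AdjoinSimple.gen K θ)
  let g : P[X] →ₐ[P] Ω := aeval θ
  let : Algebra P[X] K⟮θ⟯ := f.toAlgebra
  let : Algebra P[X] Ω := g.toAlgebra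
  have hfr : IsFractionRing P[X] K⟮θ⟯ := hθK.isFractionRing_adjoin_simple fun p => rfl
  have : IsScalarTower P[X] K⟮θ⟯ Ω := .of_algebraMap_eq fun p =>
    aeval_algHom_apply (IsScalarTower.toAlgHom P K⟮θ⟯ Ω) (AdjoinSimple.gen K θ) p
  have : IsScalarTower P P[X] Ω := .of_algebraMap_eq fun p => (g.commutes p).symm
  have : CharZero K⟮θ⟯ := charZero_of_injective_algebraMap (algebraMap K K⟮θ⟯).injective
  have hle : ((K⟮θ⟯)⟮x⟯).restrictScalars K ≤ K⟮x⟯ := by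
    rw [adjoin_simple_adjoin_simple, adjoin_le_iff]
    rintro y (rfl | rfl)
    · exact hθx
    · exact mem_adjoin_simple_self K _
  have hge : K⟮x⟯ ≤ ((K⟮θ⟯)⟮x⟯).restrictScalars K :=
    adjoin_simple_le_iff.2 (mem_adjoin_simple_self K⟮θ⟯ x)
  obtain ⟨B, hTB, hBx, hB⟩ := hv.exists_smooth_of_mul_eval_eq (R := P[X]) (k := K⟮θ⟯)
    (map_aeval_le_one hv.le_one_tower (hθ1.map_eq.trans v.map_one).le)
    (exists_aeval_mul_sub_one_lt hv.le_one_tower hv.exists_mul_sub_one_lt hθ1)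
    hz hz1 hz' hH hH1 hu (θ := X) (hθ.trans (aeval_X θ).symm) hx hc hxu T
    (fun t ht => hge (hTx t ht)) hT
  refine ⟨B.restrictScalars P, hTB, fun w hw => ⟨hle (hBx w hw).1, (hBx w hw).2⟩, ?_⟩
  have : IsScalarTower P P[X] B := .of_algebraMap_eq fun p => Subtype.ext (g.commutes p).symm
  have : Algebra.Smooth P P[X] := { }
  exact Algebra.Smooth.comp P P[X] B

end

section

variable {P K Ω Γ : Type*} [CommRing P] [Field K] [Field Ω]
  [Algebra P K] [Algebra K Ω] [Algebra P Ω] [IsScalarTower P K Ω]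
  [LinearOrderedCommGroupWithZero Γ] {v : Valuation Ω Γ}

theorem Polynomial.map_aeval_comp_linear (p b : K[X]) (c : K) (z : Ω) :
    ((p.map C).comp (C b + C (C c) * X)).map (aeval z : K[X] →ₐ[K] Ω).toRingHom =
      (p.map (algebraMap K Ω)).comp (C (aeval z b) + C (algebraMap K Ω c) * X) := by
  have : (aeval z : K[X] →ₐ[K] Ω).toRingHom.comp C = algebraMap K Ω :=
    RingHom.ext fun a => aeval_C z a
  rw [map_comp, Polynomial.map_map, this]
  simp

theorem Polynomial.map_divX {R S : Type*} [Semiring R] [Semiring S] (f : R →+* S) (p : Polynomial R) :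
    p.divX.map f = (p.map f).divX := by
  ext n
  simp [coeff_divX]

theorem IntermediateField.aeval_mem_adjoin_simple (x : Ω) (p : K[X]) : aeval x p ∈ K⟮x⟯ :=
  algebra_adjoin_le_adjoin K _ (aeval_mem_adjoin_singleton K x)

variable [IsAlgClosed Ω]

/-- Expanding a polynomial around a centre that is closer to `x` than to its roots. -/
theorem Valuation.IsImmediate.exists_eval_eq {x z u : Ω} (hx : v.IsImmediate K⟮x⟯)
    {b : K[X]} {c : K} (hxu : x = aeval z b + algebraMap K Ω c * u) (hu : v u ≤ 1)
    {p : K[X]} (hp : aeval x p ≠ 0)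
    (hroots : ∀ r ∈ p.aroots Ω, v (algebraMap K Ω c) < v (aeval z b - r)) :
    ∃ d : K, ∃ E : K[X][X], (∀ i, v (aeval z (E.coeff i)) ≤ 1) ∧
      v ((E.map (aeval z : K[X] →ₐ[K] Ω).toRingHom).eval u) = 1 ∧
      aeval x p = algebraMap K Ω d * (E.map (aeval z : K[X] →ₐ[K] Ω).toRingHom).eval u := by
  obtain ⟨d, hd⟩ := hx _ (aeval_mem_adjoin_simple x p) hp
  have hd0 := hd.ne_zero_left
  have hp0 : p.map (algebraMap K Ω) ≠ 0 := by
    rw [Polynomial.map_ne_zero_iff (algebraMap K Ω).injective]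
    rintro rfl
    simp at hp
  let E : K[X][X] := C (C d⁻¹) * (p.map C).comp (C b + C (C c) * X)
  have hE : E.map (aeval z : K[X] →ₐ[K] Ω).toRingHom = C (algebraMap K Ω d)⁻¹ *
      (p.map (algebraMap K Ω)).comp (C (aeval z b) + C (algebraMap K Ω c) * X) := by
    rw [Polynomial.map_mul, map_aeval_comp_linear, map_C]
    congr 2
    simp
  have hdom : v.ConstDominant (E.map (aeval z : K[X] →ₐ[K] Ω).toRingHom) := by
    rw [hE]
    exact (ConstDominant.comp_linear hp0 hroots).C_mul (inv_ne_zero hd0)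
  have heval : (E.map (aeval z : K[X] →ₐ[K] Ω).toRingHom).eval u =
      (algebraMap K Ω d)⁻¹ * aeval x p := by
    rw [hE, eval_mul, eval_C, eval_comp, eval_add, eval_mul, eval_C, eval_C, eval_X, ← hxu,
      eval_map_algebraMap]
  have h1 : v ((E.map (aeval z : K[X] →ₐ[K] Ω).toRingHom).eval u) = 1 := by
    rw [heval, _root_.map_mul, map_inv₀, hd.map_eq, inv_mul_cancel₀ (v.ne_zero_iff.2 hp)]
  refine ⟨d, E, fun i => ?_, h1, ?_⟩
  · have h2 := hdom.le i
    rw [← (hdom.close_eval hu).map_eq, h1, coeff_map] at h2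
    exact h2
  · rw [heval, mul_inv_cancel_left₀ hd0]

variable [CharZero K]

theorem Valuation.IsImmediate.exists_smooth_of_transcendental
    (hchar : ∀ n : ℕ, n ≠ 0 → v (n : Ω) = 1)
    (hv : (v.comap (algebraMap K Ω)).Integers P) {x : Ω} (hx : v.IsImmediate K⟮x⟯)
    (hxK : Transcendental K x) (T : Finset Ω) (hT : ∀ t ∈ T, t ∈ K⟮x⟯ ∧ v t ≤ 1) :
    ∃ B : Subalgebra P Ω, (∀ w ∈ T, w ∈ B) ∧ (∀ w ∈ B, w ∈ K⟮x⟯ ∧ v w ≤ 1) ∧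
      Algebra.Smooth P B := by
  classical
  have hfrac : ∀ t ∈ T, ∃ p q : K[X], t = aeval x p / aeval x q := fun t ht =>
    (mem_adjoin_simple_iff K _).1 (hT t ht).1
  choose! p q hpq using hfrac
  let S : Finset Ω := T.biUnion fun t => ((p t).aroots Ω + (q t).aroots Ω).toFinset
  have hSint : ∀ r ∈ S, IsIntegral K r := by
    intro r hr
    obtain ⟨t, -, ht⟩ := Finset.mem_biUnion.1 hr
    rw [Multiset.mem_toFinset, Multiset.mem_add, mem_aroots, mem_aroots] at ht
    rcases ht with ⟨h1, h2⟩ | ⟨h1, h2⟩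
    · exact (show IsAlgebraic K r from ⟨_, h1, h2⟩).isIntegral
    · exact (show IsAlgebraic K r from ⟨_, h1, h2⟩).isIntegral
  obtain ⟨z, hz, hz1, hz', hS⟩ := hv.exists_henselian_generator_of_isAlgClosed hchar S hSint
  have hzK : IsIntegral K z := hz.tower_top
  have halg (q : K[X]) : IsIntegral K (aeval z q) :=
    adjoin_le_integralClosure hzK (aeval_mem_adjoin_singleton K z)
  have hne (q : K[X]) : x - aeval z q ≠ 0 := fun h => hxK <| by
    rw [sub_eq_zero.1 h]
    exact (halg q).isAlgebraic
  obtain ⟨q₀, hq₀⟩ := hx.exists_sub_lt hzK hz1 hz' S hS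
  replace hq₀ := hq₀.resolve_left fun h => hne q₀ (by rw [h, sub_self])
  obtain ⟨b, hb, hb'⟩ := hx.exists_separated_approx hchar hzK hz1 hz' q₀ (hne q₀)
  set β := aeval z b with hβ
  have hSβ : ∀ r ∈ S, v (x - β) < v (β - r) := by
    intro r hr
    have h1 := hb.trans (hq₀ r hr)
    have h2 : β - r = (x - r) - (x - β) := by ring
    rwa [h2, v.map_sub_eq_of_lt_left h1]
  obtain ⟨c, hc⟩ := hx.exists_close_sub hzK hz1 hz' b (hne b)
  rw [← hβ] at hc
  have hc0 : algebraMap K Ω c ≠ 0 := hc.ne_zero_left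
  let u : Ω := (x - β) / algebraMap K Ω c
  have hxu : x = β + algebraMap K Ω c * u := by
    simp only [u]
    field_simp
    ring
  have hu1 : v.Close u 1 := by
    have := hc.symm.div (Close.refl (v := v) hc0)
    rwa [div_self hc0] at this
  have hu : v u ≤ 1 := (hu1.map_eq.trans v.map_one).le
  have hβK : IsIntegral K β := halg b
  let f := minpoly K β
  have hf : f.Monic := minpoly.monic hβK
  have hf0 : f.map (algebraMap K Ω) ≠ 0 := (hf.map _).ne_zero
  have hfβ : (f.map (algebraMap K Ω)).eval β = 0 := by
    rw [eval_map_algebraMap]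
    exact minpoly.aeval K β
  obtain ⟨hG, hG0⟩ := ConstDominant.divX_comp_linear (v := v) hf0
    (nodup_roots (minpoly.irreducible hβK).separable.map) hc0 hfβ
    (fun r hr hrβ => by
      rw [hc.map_eq]
      exact hb' r hr hrβ)
  have hder : (f.map (algebraMap K Ω)).derivative.eval β = aeval z (f.derivative.comp b) := by
    rw [derivative_map, eval_map_algebraMap, aeval_comp]
  have hder0 : aeval z (f.derivative.comp b) ≠ 0 := by
    rw [← hder]
    exact right_ne_zero_of_mul (hG0 ▸ hG.1)
  obtain ⟨d, hd⟩ := v.exists_close_aeval hzK hz1 hz' _ hder0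
  have hd0 : algebraMap K Ω d ≠ 0 := hd.ne_zero_left
  let H : K[X][X] := C (C (c * d)⁻¹) * ((f.map C).comp (C b + C (C c) * X)).divX
  have hH : H.map (aeval z : K[X] →ₐ[K] Ω).toRingHom = C (algebraMap K Ω (c * d))⁻¹ *
      ((f.map (algebraMap K Ω)).comp (C β + C (algebraMap K Ω c) * X)).divX := by
    rw [Polynomial.map_mul, map_divX, map_aeval_comp_linear, map_C]
    congr 2
    simp
  have hcd0 : algebraMap K Ω (c * d) ≠ 0 := by
    rw [_root_.map_mul]
    exact mul_ne_zero hc0 hd0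
  have hcd : c * d ≠ 0 := fun h => hcd0 (by rw [h, _root_.map_zero])
  have hHdom : v.ConstDominant (H.map (aeval z : K[X] →ₐ[K] Ω).toRingHom) := by
    rw [hH]
    exact hG.C_mul (inv_ne_zero hcd0)
  have hH0 : v.Close ((H.map (aeval z : K[X] →ₐ[K] Ω).toRingHom).coeff 0) 1 := by
    rw [hH, coeff_C_mul, hG0, hder, ← inv_mul_cancel₀ hcd0]
    refine (Close.refl (inv_ne_zero hcd0)).mul ?_
    rw [_root_.map_mul]
    exact (Close.refl hc0).mul hd.symm
  have hH1 : v (aeval z (H.coeff 0)) = 1 := by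
    have := hH0.map_eq
    rw [coeff_map, v.map_one] at this
    exact this
  let F : K[X] := C (c * d)⁻¹ * f
  have hθ : u * (H.map (aeval z : K[X] →ₐ[K] Ω).toRingHom).eval u = aeval x F := by
    have h1 := congrArg (eval u)
      (divX_mul_X_add ((f.map (algebraMap K Ω)).comp (C β + C (algebraMap K Ω c) * X)))
    rw [coeff_zero_eq_eval_zero] at h1
    simp only [eval_add, eval_mul, eval_X, eval_C, eval_comp, mul_zero, add_zero, hfβ, ← hxu,
      eval_map_algebraMap] at h1
    have h2 : aeval x F = (algebraMap K Ω (c * d))⁻¹ * aeval x f := by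
      simp only [F]
      rw [_root_.map_mul (aeval x), aeval_C, map_inv₀]
    rw [hH, eval_mul, eval_C, h2, ← h1]
    ring
  have hθ1 : v.Close (aeval x F) 1 := by
    have h1 := hu1.mul ((hHdom.close_eval hu).trans hH0)
    rwa [hθ, one_mul] at h1
  have hFdeg : F.natDegree ≠ 0 := by
    rw [natDegree_C_mul (inv_ne_zero hcd)]
    exact (minpoly.natDegree_pos hβK).ne'
  have hFlead : F.leadingCoeff ≠ 0 := leadingCoeff_ne_zero.2 fun h => by simp [h] at hFdeg
  refine hv.exists_smooth_of_transcendental_mul_eval hz hz1 hz' hHdom hH1 hu hθ hθ1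
    (hxK.aeval F hFdeg (mem_nonZeroDivisors_of_ne_zero hFlead)) ?_ (aeval_mem_adjoin_simple x F)
    (b := b) (c := c) (by rintro rfl; simp at hc0) hxu T (fun t ht => (hT t ht).1) fun t ht => ?_
  · refine IsAlgebraic.of_aeval (F.map (algebraMap K K⟮aeval x F⟯)) ?_ ?_ ?_
    · rwa [natDegree_map]
    · rw [leadingCoeff_map]
      exact mem_nonZeroDivisors_of_ne_zero ((_root_.map_ne_zero _).2 hFlead)
    · rw [aeval_map_algebraMap]
      exact isAlgebraic_algebraMap (AdjoinSimple.gen K (aeval x F))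
  · rcases eq_or_ne t 0 with rfl | ht0
    · exact ⟨0, 0, 1, by simp, fun i => by
        rw [coeff_one]
        split_ifs <;> simp, by simp, by simp⟩
    have h1 := hpq t ht
    have hp0 : aeval x (p t) ≠ 0 := by
      intro h
      rw [h, zero_div] at h1
      exact ht0 h1
    have hq0 : aeval x (q t) ≠ 0 := by
      intro h
      rw [h, div_zero] at h1
      exact ht0 h1
    obtain ⟨d₁, E₁, h2, h3, h4⟩ := hx.exists_eval_eq hxu hu hp0 fun r hr => by
      rw [hc.map_eq]
      exact hSβ r (Finset.mem_biUnion.2 ⟨t, ht, by simp only [Multiset.mem_toFinset, Multiset.mem_add, hr, true_or]⟩)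
    obtain ⟨d₂, E₂, h5, h6, h7⟩ := hx.exists_eval_eq hxu hu hq0 fun r hr => by
      rw [hc.map_eq]
      exact hSβ r (Finset.mem_biUnion.2 ⟨t, ht, by simp only [Multiset.mem_toFinset, Multiset.mem_add, hr, or_true]⟩)
    have h8 : t = algebraMap K Ω (d₁ / d₂) *
        (E₁.map (aeval z : K[X] →ₐ[K] Ω).toRingHom).eval u *
        ((E₂.map (aeval z : K[X] →ₐ[K] Ω).toRingHom).eval u)⁻¹ := by
      rw [map_div₀, h1, h4, h7]
      ring
    have h9 : v (algebraMap K Ω (d₁ / d₂)) ≤ 1 := by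
      have := (hT t ht).2
      rwa [h8, _root_.map_mul, _root_.map_mul, map_inv₀, h3, h6, inv_one, mul_one, mul_one] at this
    obtain ⟨a, ha⟩ := hv.exists_of_le_one h9
    refine ⟨a, E₁, E₂, h2, h5, h6, ?_⟩
    rw [IsScalarTower.algebraMap_apply P K Ω, ha]
    exact h8

end

section

variable {Ω : Type u} {Γ : Type*} [Field Ω] [LinearOrderedCommGroupWithZero Γ] {v : Valuation Ω Γ}
  [IsAlgClosed Ω] [CharZero Ω]

theorem Valuation.isLocallySmoothIn_closure_insert (hchar : ∀ n : ℕ, n ≠ 0 → v (n : Ω) = 1)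
    {K : Subfield Ω} {x : Ω}
    (hx : ∀ y ∈ Subfield.closure ((K : Set Ω) ∪ {x}), y ≠ 0 → ∃ a ∈ K, v.Close a y) :
    IsLocallySmoothIn ↥(v.integer ⊓ K.toSubring)
      ((v.integer ⊓ (Subfield.closure ((K : Set Ω) ∪ {x})).toSubring : Subring Ω) : Set Ω) := by
  let f : ↥(v.integer ⊓ K.toSubring) →+* K :=
    Subring.inclusion (inf_le_right : v.integer ⊓ K.toSubring ≤ K.toSubring)
  let := f.toAlgebra
  have : IsScalarTower ↥(v.integer ⊓ K.toSubring) K Ω := .of_algebraMap_eq fun _ => rfl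
  have hv : (v.comap (algebraMap K Ω)).Integers ↥(v.integer ⊓ K.toSubring) :=
    { hom_inj := Subring.inclusion_injective _
      map_le_one := fun a => a.2.1
      exists_of_le_one := fun {r} hr => ⟨⟨r, hr, r.2⟩, rfl⟩ }
  have hadj : ∀ w : Ω, w ∈ K⟮x⟯ ↔ w ∈ Subfield.closure ((K : Set Ω) ∪ {x}) := by
    intro w
    have : Set.range (algebraMap K Ω) = K := Subtype.range_coe
    rw [← this]
    rfl
  have hx' : v.IsImmediate K⟮x⟯ := by
    intro y hy hy0
    obtain ⟨a, ha, h⟩ := hx y ((hadj y).1 hy) hy0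
    exact ⟨⟨a, ha⟩, h⟩
  intro T hT
  have hT' : ∀ t ∈ T, t ∈ K⟮x⟯ ∧ v t ≤ 1 := fun t ht => ⟨(hadj t).2 (hT ht).2, (hT ht).1⟩
  have : ∃ B : Subalgebra ↥(v.integer ⊓ K.toSubring) Ω, (∀ w ∈ T, w ∈ B) ∧
      (∀ w ∈ B, w ∈ K⟮x⟯ ∧ v w ≤ 1) ∧ Algebra.Smooth ↥(v.integer ⊓ K.toSubring) B := by
    by_cases hxK : IsAlgebraic K x
    · exact hx'.exists_smooth_of_isAlgebraic hchar hv hxK T hT'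
    · exact hx'.exists_smooth_of_transcendental hchar hv hxK T hT'
  obtain ⟨B, h1, h2, h3⟩ := this
  exact ⟨B, h1, fun w hw => ⟨(h2 w hw).2, (hadj w).1 (h2 w hw).1⟩, h3⟩

theorem Valuation.isLocallySmoothIn_closure_finset (hchar : ∀ n : ℕ, n ≠ 0 → v (n : Ω) = 1)
    (S : Finset Ω) : ∀ {K : Subfield Ω},
    (∀ y ∈ Subfield.closure ((K : Set Ω) ∪ S), y ≠ 0 → ∃ a ∈ K, v.Close a y) →
    IsLocallySmoothIn ↥(v.integer ⊓ K.toSubring)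
      ((v.integer ⊓ (Subfield.closure ((K : Set Ω) ∪ S)).toSubring : Subring Ω) : Set Ω) := by
  classical
  induction S using Finset.induction_on with
  | empty =>
    intro K hK T hT
    refine ⟨⊥, fun t ht => ?_, fun w hw => ?_, .of_equiv (Algebra.botEquivOfInjective Subtype.val_injective).symm⟩
    · have := hT ht
      rw [Finset.coe_empty, Set.union_empty, Subfield.closure_eq] at this
      exact Algebra.mem_bot.2 ⟨⟨t, this⟩, rfl⟩
    · rw [Finset.coe_empty, Set.union_empty, Subfield.closure_eq]
      obtain ⟨a, rfl⟩ := Algebra.mem_bot.1 hw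
      exact a.2
  | insert x S hxS ih =>
    intro K hK
    have h1 : Subfield.closure ((Subfield.closure ((K : Set Ω) ∪ {x}) : Set Ω) ∪ S) =
        Subfield.closure ((K : Set Ω) ∪ (insert x S : Finset Ω)) := by
      rw [Finset.coe_insert, Set.insert_eq, ← Set.union_assoc, Subfield.closure_union,
        Subfield.closure_eq, ← Subfield.closure_union]
    have hle : Subfield.closure ((K : Set Ω) ∪ {x}) ≤
        Subfield.closure ((K : Set Ω) ∪ (insert x S : Finset Ω)) :=
      Subfield.closure_mono (Set.union_subset_union_right _ (by simp))
    have hKle : K ≤ Subfield.closure ((K : Set Ω) ∪ {x}) :=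
      fun y hy => Subfield.subset_closure (.inl hy)
    have h2 := isLocallySmoothIn_closure_insert hchar (K := K) (x := x)
      fun y hy hy0 => hK y (hle hy) hy0
    have h3 := ih (K := Subfield.closure ((K : Set Ω) ∪ {x})) fun y hy hy0 => by
      obtain ⟨a, ha, h⟩ := hK y (h1 ▸ hy) hy0
      exact ⟨a, hKle ha, h⟩
    rw [h1] at h3
    exact h2.trans h3

/-- If `v` is immediate over `K` on `L`, then the valuation ring of `L` is locally smooth over the
valuation ring of `K`. -/
theorem Valuation.isLocallySmoothIn (hchar : ∀ n : ℕ, n ≠ 0 → v (n : Ω) = 1)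
    {K L : Subfield Ω} (hKL : K ≤ L) (h : ∀ y ∈ L, y ≠ 0 → ∃ a ∈ K, v.Close a y) :
    IsLocallySmoothIn ↥(v.integer ⊓ K.toSubring)
      ((v.integer ⊓ L.toSubring : Subring Ω) : Set Ω) := by
  intro T hT
  have hle : Subfield.closure ((K : Set Ω) ∪ T) ≤ L :=
    Subfield.closure_le.2 (Set.union_subset hKL fun t ht => (hT ht).2)
  obtain ⟨C, h1, h2, h3⟩ := isLocallySmoothIn_closure_finset hchar T (K := K)
    (fun y hy => h y (hle hy)) T fun t ht => ⟨(hT ht).1, Subfield.subset_closure (.inr ht)⟩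
  exact ⟨C, h1, fun w hw => ⟨(h2 hw).1, hle (h2 hw).2⟩, h3⟩

end

theorem exists_smooth_algEquiv (A : Type u) (S : Type v) [CommRing A] [CommRing S] [Algebra A S]
    [Algebra.Smooth A S] :
    ∃ (S' : Type u) (_ : CommRing S') (_ : Algebra A S'),
      Algebra.Smooth A S' ∧ Nonempty (S ≃ₐ[A] S') := by
  obtain ⟨n, f, hf, -⟩ := Algebra.FinitePresentation.out (R := A) (A := S)
  let e := Ideal.quotientKerAlgEquivOfSurjective hf
  exact ⟨_, inferInstance, inferInstance, .of_equiv e.symm, ⟨e.symm⟩⟩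

section

variable {R Ω Γ : Type*} [CommRing R] [Field Ω] [LinearOrderedCommGroupWithZero Γ]
  {v : Valuation Ω Γ}

theorem Subfield.exists_div_of_mem_closure_range (j : R →+* Ω) {w : Ω}
    (hw : w ∈ Subfield.closure (Set.range j)) : ∃ y z, w = j y / j z := by
  obtain ⟨y, hy, z, hz, rfl⟩ := Subfield.mem_closure_iff.1 hw
  rw [← RingHom.coe_range, Subring.closure_eq] at hy hz
  obtain ⟨y, rfl⟩ := hy
  obtain ⟨z, rfl⟩ := hz
  exact ⟨y, z, rfl⟩

theorem Valuation.integer_inf_closure_range [IsDomain R] [ValuationRing R] (j : R →+* Ω) (hle : ∀ x, v (j x) ≤ 1)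
    (hunit : ∀ x, v (j x) = 1 → IsUnit x) :
    v.integer ⊓ (Subfield.closure (Set.range j)).toSubring = j.range := by
  ext w
  constructor
  · rintro ⟨hw1 : v w ≤ 1, hw2⟩
    obtain ⟨y, z, rfl⟩ := Subfield.exists_div_of_mem_closure_range j hw2
    by_cases hz : j z = 0
    · simp [hz]
    obtain ⟨q, rfl | rfl⟩ := ValuationRing.cond y z
    · have hy : j y ≠ 0 := fun h => hz (by simp [h])
      have hq : j q ≠ 0 := fun h => hz (by simp [h])
      have h1 : j y / j (y * q) = (j q)⁻¹ := by
        rw [_root_.map_mul]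
        field_simp
      rw [h1, map_inv₀, inv_le_one₀ (zero_lt_iff.2 ((Valuation.ne_zero_iff _).2 hq))] at hw1
      obtain ⟨u, rfl⟩ := hunit q (le_antisymm (hle q) hw1)
      refine ⟨(u⁻¹ : Rˣ), ?_⟩
      rw [h1]
      refine eq_inv_of_mul_eq_one_left ?_
      rw [← _root_.map_mul, Units.inv_mul, _root_.map_one]
    · exact ⟨q, by rw [_root_.map_mul]; field_simp⟩
  · rintro ⟨x, rfl⟩
    exact ⟨hle x, Subfield.subset_closure ⟨x, rfl⟩⟩

end

section

variable {V : Type u} {V' Ω : Type v} [CommRing V] [CommRing V'] [CommRing Ω]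

theorem RingHom.isIndSmooth_of_isLocallySmoothIn (f : V →+* V') (j : V' →+* Ω)
    (hf : Function.Injective f) (hj : Function.Injective j)
    (h : IsLocallySmoothIn (j.comp f).range (j.range : Set Ω)) : f.IsIndSmooth := by
  classical
  intro E _ _ _ w hw
  obtain ⟨s, hs⟩ := (inferInstance : Algebra.FiniteType V E).out
  obtain ⟨C, h1, h2, h3⟩ := h (s.image fun x => j (w x)) (by
    intro _ hx
    obtain ⟨x, -, rfl⟩ := Finset.mem_image.1 (Finset.mem_coe.1 hx)
    exact ⟨w x, rfl⟩)
  let φ : V →+* (j.comp f).range := (j.comp f).rangeRestrict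
  let _ : Algebra V (j.comp f).range := φ.toAlgebra
  let _ : Algebra V C := ((algebraMap (j.comp f).range C).comp φ).toAlgebra
  have : IsScalarTower V (j.comp f).range C := .of_algebraMap_eq fun _ => rfl
  have hφ : Function.Bijective (Algebra.ofId V (j.comp f).range) :=
    ⟨fun a b hab => hf (hj (congrArg Subtype.val hab)), (j.comp f).rangeRestrict_surjective⟩
  have : Algebra.Smooth V (j.comp f).range := .of_equiv (AlgEquiv.ofBijective _ hφ)
  have : Algebra.Smooth V C := .comp V (j.comp f).range C
  have hwV (a : V) : w (algebraMap V E a) = f a := congrArg (· a) hw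
  have hwC (x : E) : j (w x) ∈ C := by
    have hx : x ∈ Algebra.adjoin V (s : Set E) := hs ▸ Algebra.mem_top
    induction hx using Algebra.adjoin_induction with
    | mem x hx => exact h1 (Finset.mem_coe.2 (Finset.mem_image_of_mem _ hx))
    | algebraMap a =>
      rw [hwV]
      exact C.algebraMap_mem (φ a)
    | add x y _ _ hx hy => simpa using C.add_mem hx hy
    | mul x y _ _ hx hy => simpa using C.mul_mem hx hy
  let g : E →ₐ[V] C :=
    { (j.comp w).codRestrict C hwC with
      commutes' := fun a => Subtype.ext (congrArg j (hwV a)) }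
  let e : V' ≃+* j.range := RingEquiv.ofBijective j.rangeRestrict
    ⟨fun a b hab => hj (congrArg Subtype.val hab), j.rangeRestrict_surjective⟩
  let h : C →+* V' := (e.symm : j.range →+* V').comp
    (C.subtype.codRestrict j.range fun c => h2 c.2)
  have hh (c : C) : j (h c) = c := congrArg Subtype.val (e.apply_symm_apply _)
  obtain ⟨S, _, _, hS, ⟨ε⟩⟩ := exists_smooth_algEquiv V C
  refine ⟨S, inferInstance, inferInstance, hS, ε.toAlgHom.comp g,
    h.comp (ε.symm : S ≃+* C).toRingHom, ?_, ?_⟩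
  · ext x
    refine hj ?_
    exact (hh (ε.symm (ε (g x)))).trans (congrArg Subtype.val (ε.symm_apply_apply (g x)))
  · ext a
    refine hj ?_
    exact (hh (ε.symm (algebraMap V S a))).trans (congrArg Subtype.val (ε.symm.commutes a))

end

/-- An immediate extension `V ⊆ V'` of valuation rings containing `ℚ`
(trivial value group extension and trivial residue field extension) is ind-smooth. -/
theorem immediate_extension_isIndSmooth
    (V : Type u) (V' : Type v) [CommRing V] [IsDomain V] [ValuationRing V]
    [CommRing V'] [IsDomain V'] [ValuationRing V']
    [Algebra ℚ V] [Algebra ℚ V'] [Algebra V V']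
    (hinj : Function.Injective (algebraMap V V'))
    [IsLocalHom (algebraMap V V')]
    (hvalue : (algebraMap V V').HasTrivialValueGroupExt)
    (hresidue : Function.Bijective (IsLocalRing.ResidueField.map (algebraMap V V'))) :
    (algebraMap V V').IsIndSmooth := by
  let K' := FractionRing V'
  let Ω := AlgebraicClosure K'
  let j : V' →+* Ω := (algebraMap K' Ω).comp (algebraMap V' K')
  have hj : Function.Injective j :=
    (algebraMap K' Ω).injective.comp (IsFractionRing.injective V' K')
  obtain ⟨O, hO, hloc⟩ := IsLocalRing.exists_factor_valuationRing j
  let v := O.valuation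
  have hle (x : V') : v (j x) ≤ 1 := (O.valuation_le_one_iff _).2 (hO x)
  have hunit (x : V') (hx : v (j x) = 1) : IsUnit x :=
    hloc.map_nonunit x ((O.valuation_eq_one_iff ⟨j x, hO x⟩).2 hx)
  have hunit' (x : V') (hx : IsUnit x) : v (j x) = 1 :=
    (O.valuation_eq_one_iff ⟨j x, hO x⟩).1 (hx.map (j.codRestrict O.toSubring hO))
  have hchar (n : ℕ) (hn : n ≠ 0) : v (n : Ω) = 1 := by
    rw [← map_natCast j]
    refine hunit' _ ?_
    rw [← map_natCast (algebraMap ℚ V')]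
    exact (IsUnit.mk0 (n : ℚ) (by exact_mod_cast hn)).map _
  have hchar0 : CharZero Ω := charZero_of_inj_zero fun n hn => by
    by_contra h0
    simpa [hn] using hchar n h0
  let f := algebraMap V V'
  refine RingHom.isIndSmooth_of_isLocallySmoothIn f j hinj hj ?_
  have key := Valuation.isLocallySmoothIn (v := v) hchar
    (K := Subfield.closure (Set.range (j.comp f))) (L := Subfield.closure (Set.range j))
    (Subfield.closure_mono (by rintro _ ⟨x, rfl⟩; exact ⟨f x, rfl⟩)) fun y hy hy0 => ?_
  · rwa [Valuation.integer_inf_closure_range j hle hunit,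
      Valuation.integer_inf_closure_range (j.comp f) (fun x => hle _) fun x hx =>
        (hunit _ hx).of_map] at key
  obtain ⟨x, z, rfl⟩ := Subfield.exists_div_of_mem_closure_range j hy
  have hjx : j x ≠ 0 := fun h => hy0 (by simp [h])
  have hjz : j z ≠ 0 := fun h => hy0 (by simp [h])
  obtain ⟨a, b, ha, hb, ε, hε⟩ := hvalue x z (fun h => hjx (by simp [h])) fun h => hjz (by simp [h])
  obtain ⟨c, hc⟩ := hresidue.surjective (IsLocalRing.residue V' (ε⁻¹ : V'ˣ))
  obtain ⟨c, rfl⟩ := IsLocalRing.residue_surjective c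
  rw [IsLocalRing.ResidueField.map_residue, ← sub_eq_zero, ← _root_.map_sub,
    IsLocalRing.residue_eq_zero_iff] at hc
  have hlt : v (j (f c - (ε⁻¹ : V'ˣ))) < 1 :=
    (hle _).lt_of_ne fun h => hc (hunit _ h)
  have hmem (t : V) : j (f t) ∈ Subfield.closure (Set.range (j.comp f)) :=
    Subfield.subset_closure ⟨t, rfl⟩
  refine ⟨j (f a) / j (f b) * j (f c), mul_mem (div_mem (hmem a) (hmem b)) (hmem c), ?_⟩
  have hfa : j (f a) ≠ 0 := (map_ne_zero_iff _ hj).2 ((map_ne_zero_iff _ hinj).2 ha)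
  have hfb : j (f b) ≠ 0 := (map_ne_zero_iff _ hj).2 ((map_ne_zero_iff _ hinj).2 hb)
  have hε1 : j ε * j (ε⁻¹ : V'ˣ) = 1 := by rw [← _root_.map_mul, Units.mul_inv, _root_.map_one]
  have hε2 : j x * j (f b) * j ε = j z * j (f a) := by
    simpa only [_root_.map_mul] using congrArg j hε
  have hy : j x / j z = j (f a) / j (f b) * j (ε⁻¹ : V'ˣ) := by
    rw [div_mul_eq_mul_div, div_eq_div_iff hjz hfb]
    linear_combination (j (ε⁻¹ : V'ˣ)) * hε2 - j x * j (f b) * hε1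
  have hy1 : v (j x / j z) = v (j (f a) / j (f b)) := by
    rw [hy, _root_.map_mul, hunit' _ (Units.isUnit _), mul_one]
  rw [Valuation.Close, hy1, hy, ← mul_sub, ← _root_.map_sub, _root_.map_mul]
  refine mul_lt_of_lt_one_right (zero_lt_iff.2 ((Valuation.ne_zero_iff _).2 ?_)) hlt
  exact div_ne_zero hfa hfb
end

section
/- Let V ⊆ V' be an extension of valuation rings containing ℚ (i.e., both are ℚ-algebras) whose value group extension is trivial. Then V' is ind-smooth over V (no finiteness assumption on the fraction field extension is needed). -/
universe u v

theorem Derivation.exists_algHom_sub {A P Q : Type*} [CommRing A] [CommRing P] [CommRing Q]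
    [Algebra A P] [Algebra A Q] (D : Derivation A P P) (π : P →ₐ[A] Q) (c : Q) (hc : c * c = 0) :
    ∃ σ : P →ₐ[A] Q, ∀ a, σ a = π a - c * π (D a) := by
  refine ⟨AlgHom.ofLinearMap
    (π.toLinearMap - (LinearMap.mulLeft A c ∘ₗ π.toLinearMap ∘ₗ D.toLinearMap)) ?_ ?_,
    fun _ => rfl⟩
  · simp [LinearMap.sub_apply]
  · intro a b
    simp only [LinearMap.sub_apply, LinearMap.comp_apply, AlgHom.toLinearMap_apply,
      LinearMap.mulLeft_apply, Derivation.coeFn_coe,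
      Derivation.leibniz, smul_eq_mul, map_add, map_mul]
    linear_combination (-π (D a) * π (D b)) * hc

/-- The hypersurface `p = 0` in a smooth algebra is smooth if some derivation of `p` is a unit
along it. -/
theorem Algebra.Smooth.quotient_span_singleton {A P : Type*} [CommRing A] [CommRing P]
    [Algebra A P] [Algebra.Smooth A P] (p v : P) (D : Derivation A P P) (h : p ∣ v * D p - 1) :
    Algebra.Smooth A (P ⧸ Ideal.span {p}) := by
  refine ⟨?_, Algebra.FinitePresentation.quotient ⟨{p}, by simp⟩⟩
  let f : P →ₐ[A] (P ⧸ Ideal.span {p}) := Ideal.Quotient.mkₐ A _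
  let π : P →ₐ[A] P ⧸ RingHom.ker f.toRingHom ^ 2 := Ideal.Quotient.mkₐ A _
  have hπ : ∀ b, f.kerSquareLift (π b) = f b := fun b => rfl
  have hp2 : π p * π p = 0 := by
    rw [← map_mul]
    refine Ideal.Quotient.eq_zero_iff_mem.mpr ?_
    rw [show RingHom.ker f.toRingHom = Ideal.span {p} from Ideal.mk_ker,
      Ideal.span_singleton_pow, pow_two]
    exact Ideal.mem_span_singleton_self _
  obtain ⟨σ, hσ⟩ := D.exists_algHom_sub π (π p * π v) (by linear_combination (π v) ^ 2 * hp2)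
  have hσp : σ p = 0 := by
    obtain ⟨c, hc⟩ := h
    have h2 := congr_arg π hc
    simp only [map_mul, map_sub, map_one] at h2
    rw [hσ]
    linear_combination (-π p) * h2 - π c * hp2
  refine Algebra.FormallySmooth.of_split f (Ideal.Quotient.liftₐ _ σ ?_) ?_
  · intro a ha
    obtain ⟨c, rfl⟩ := Ideal.mem_span_singleton.mp ha
    rw [map_mul, hσp, zero_mul]
  · refine Ideal.Quotient.algHom_ext _ (AlgHom.ext fun a => ?_)
    have hfp : f p = 0 := Ideal.Quotient.eq_zero_iff_mem.mpr (Ideal.mem_span_singleton_self _)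
    have : f.kerSquareLift (σ a) = f a := by
      rw [hσ, map_sub, map_mul, map_mul, hπ, hπ, hfp]
      simp
    exact this

/-- The derivation of `S[X]` acting as `D` on coefficients and killing `X`. -/
noncomputable def Derivation.polynomialMap {A S : Type*} [CommRing A] [CommRing S] [Algebra A S]
    (D : Derivation A S S) : Derivation A (Polynomial S) (Polynomial S) :=
  (PolynomialModule.equivPolynomialSelf.toLinearMap).compDer D.mapCoeffs

theorem Derivation.polynomialMap_C {A S : Type*} [CommRing A] [CommRing S] [Algebra A S]
    (D : Derivation A S S) (s : S) :
    D.polynomialMap (Polynomial.C s) = Polynomial.C (D s) := by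
  simp [Derivation.polynomialMap]

theorem Derivation.polynomialMap_X {A S : Type*} [CommRing A] [CommRing S] [Algebra A S]
    (D : Derivation A S S) : D.polynomialMap Polynomial.X = 0 := by
  simp [Derivation.polynomialMap]

open Polynomial in
/-- Adjoin to `S` a root `Z` of `C a - C b * X`, with an extension of a compatible derivation. -/
theorem exists_smooth_adjoin {A B S : Type v} [CommRing A] [CommRing B] [CommRing S] [Algebra A S]
    [Algebra A B] [Algebra.Smooth A S] (φ : S →ₐ[A] B) (a b : S) (z : B) (hz : φ a = φ b * z)
    (D : Derivation A S[X] S[X]) (v : S[X]) (hD : (C a - C b * X) ∣ v * D (C a - C b * X) - 1)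
    (D' : Derivation A S[X] S[X]) (hD' : (C a - C b * X) ∣ D' (C a - C b * X)) :
    ∃ (S' : Type v) (_ : CommRing S') (_ : Algebra A S') (_ : Algebra.Smooth A S')
      (ψ : S[X] →ₐ[A] S') (φ' : S' →ₐ[A] B) (d : Derivation A S' S'),
      (∀ s, φ' (ψ (C s)) = φ s) ∧ φ' (ψ X) = z ∧ ψ (C a) = ψ (C b) * ψ X ∧
      ∀ s, d (ψ s) = ψ (D' s) := by
  set p : S[X] := C a - C b * X with hp
  have hS : Algebra.Smooth A S[X] := have : Algebra.Smooth S S[X] := ⟨inferInstance, inferInstance⟩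
    Algebra.Smooth.comp A S S[X]
  have hsm := Algebra.Smooth.quotient_span_singleton p v D hD
  let ψ : S[X] →ₐ[A] (S[X] ⧸ Ideal.span {p}) := Ideal.Quotient.mkₐ A _
  have hψ : ∀ s, ψ s = 0 ↔ p ∣ s := fun s => by
    rw [← Ideal.mem_span_singleton]
    exact Ideal.Quotient.eq_zero_iff_mem
  have hψs : Function.Surjective ψ := Ideal.Quotient.mk_surjective
  let φ₁ : S[X] →ₐ[A] B := Polynomial.eval₂AlgHom φ z (fun _ => Commute.all _ _)
  have hC : ∀ s, φ₁ (C s) = φ s := fun s => by simp [φ₁]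
  have hX : φ₁ X = z := by simp [φ₁]
  let φ' : (S[X] ⧸ Ideal.span {p}) →ₐ[A] B := Ideal.Quotient.liftₐ _ φ₁ (by
    intro s hs
    obtain ⟨c, rfl⟩ := Ideal.mem_span_singleton.mp hs
    rw [map_mul, hp, map_sub, map_mul, hC, hC, hX, hz, sub_self, zero_mul])
  have hφ' : ∀ s, φ' (ψ s) = φ₁ s := fun s => rfl
  refine ⟨_, _, _, hsm, ψ, φ', Derivation.liftOfSurjective (f := ψ) hψs (d := D') ?_,
    ?_, ?_, ?_, ?_⟩
  · intro s hs
    rw [hψ] at hs ⊢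
    obtain ⟨c, rfl⟩ := hs
    rw [Derivation.leibniz, smul_eq_mul, smul_eq_mul]
    exact dvd_add (dvd_mul_right _ _) (hD'.mul_left c)
  · intro s; rw [hφ', hC]
  · rw [hφ', hX]
  · rw [← map_mul, ← sub_eq_zero, ← map_sub, hψ]
  · intro s
    exact Derivation.liftOfSurjective_apply hψs _ s

open Polynomial in
/-- `Polynomial.derivative` as a derivation over a base of the coefficient ring. -/
noncomputable def Polynomial.derivativeOver (A S : Type*) [CommRing A] [CommRing S] [Algebra A S] :
    Derivation A S[X] S[X] := Polynomial.derivative'.restrictScalars A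

open Polynomial in
theorem exists_smooth_away {A B S : Type v} [CommRing A] [CommRing B] [CommRing S] [Algebra A S]
    [Algebra A B] [Algebra.Smooth A S] (φ : S →ₐ[A] B) (q : S) (hq : IsUnit (φ q))
    (D : Derivation A S S) :
    ∃ (S' : Type v) (_ : CommRing S') (_ : Algebra A S') (_ : Algebra.Smooth A S')
      (ψ : S →ₐ[A] S') (φ' : S' →ₐ[A] B) (d : Derivation A S' S'),
      (∀ s, φ' (ψ s) = φ s) ∧ IsUnit (ψ q) ∧ ∀ s, d (ψ s) = ψ (D s) := by
  obtain ⟨z, hz⟩ := hq.exists_right_inv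
  have e1 : ∀ s, Polynomial.derivativeOver A S s = derivative s := fun _ => rfl
  obtain ⟨S', i1, i2, i3, ψ, φ', d, h1, h2, h3, h4⟩ := exists_smooth_adjoin φ 1 q z (by simp [hz])
    (Polynomial.derivativeOver A S) (-X) ⟨-1, by simp [e1]⟩
    (D.polynomialMap - (C (D q) * X ^ 2) • Polynomial.derivativeOver A S)
    ⟨-(C (D q) * X), by
      simp [e1, Derivation.polynomialMap_C, Derivation.polynomialMap_X]; ring⟩
  refine ⟨S', i1, i2, i3, ψ.comp (IsScalarTower.toAlgHom A S S[X]), φ', d, ?_, ?_, ?_⟩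
  · exact h1
  · refine .of_mul_eq_one (ψ X) ?_
    rw [map_one, map_one] at h3
    exact h3.symm
  · intro s
    have := h4 (C s)
    simpa [e1, Derivation.polynomialMap_C] using this

open Polynomial in
theorem exists_smooth_dilation {A B S : Type v} [CommRing A] [CommRing B] [CommRing S] [Algebra A S]
    [Algebra A B] [Algebra.Smooth A S] (φ : S →ₐ[A] B) (t : A) (G : S) (z : B) (hz : φ G = t • z)
    (D : Derivation A S S) (hG : IsUnit (D G)) :
    ∃ (S' : Type v) (_ : CommRing S') (_ : Algebra A S') (_ : Algebra.Smooth A S')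
      (ψ : S →ₐ[A] S') (φ' : S' →ₐ[A] B) (d : Derivation A S' S') (Z : S'),
      (∀ s, φ' (ψ s) = φ s) ∧ φ' Z = z ∧ ψ G = t • Z ∧ ∀ s, d (ψ s) = t • ψ (D s) := by
  obtain ⟨v, hv⟩ := hG.exists_left_inv
  have e1 : ∀ s, Polynomial.derivativeOver A S s = derivative s := fun _ => rfl
  obtain ⟨S', i1, i2, i3, ψ, φ', d, h1, h2, h3, h4⟩ := exists_smooth_adjoin φ G
    (algebraMap A S t) z (by simp [hz, Algebra.smul_def])
    D.polynomialMap (C v) ⟨0, by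
      simp [Derivation.polynomialMap_C, Derivation.polynomialMap_X, ← C_mul, hv]⟩
    (t • D.polynomialMap + (C (D G)) • Polynomial.derivativeOver A S)
    ⟨0, by
      simp [e1, Derivation.polynomialMap_C, Derivation.polynomialMap_X, Algebra.smul_def,
        Polynomial.algebraMap_apply]; ring⟩
  refine ⟨S', i1, i2, i3, ψ.comp (IsScalarTower.toAlgHom A S S[X]), φ', d, ψ X, h1, h2, ?_, ?_⟩
  · rw [Algebra.smul_def, ← ψ.commutes]
    exact h3
  · intro s
    have := h4 (C s)
    simpa [e1, Derivation.polynomialMap_C, -Polynomial.smul_C, ← Polynomial.smul_C] using this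

/-- `B` is an extension of the subring `A` which is closed under those divisions that are possible
in `B`, and every element of `B` is a unit times an element of `A`. -/
structure IsImmediateExt (A B : Type*) [CommRing A] [CommRing B] [Algebra A B] : Prop where
  injective : Function.Injective (algebraMap A B)
  dvd_of_dvd : ∀ a b : A, algebraMap A B a ∣ algebraMap A B b → a ∣ b
  exists_associated : ∀ b : B, ∃ a : A, Associated (algebraMap A B a) b

theorem IsImmediateExt.flat {A B : Type*} [CommRing A] [CommRing B] [Algebra A B] [IsDomain B]
    [ValuationRing B] (h : IsImmediateExt A B) : Module.Flat A B := by
  have : IsDomain A := h.injective.isDomain _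
  have : ValuationRing A := by
    rw [ValuationRing.iff_dvd_total]
    refine ⟨fun a b => ?_⟩
    rcases ValuationRing.dvd_total (algebraMap A B a) (algebraMap A B b) with h1 | h1
    · exact .inl (h.dvd_of_dvd _ _ h1)
    · exact .inr (h.dvd_of_dvd _ _ h1)
  rw [Module.Flat.flat_iff_torsion_eq_bot_of_isBezout, Submodule.eq_bot_iff]
  intro b hb
  obtain ⟨⟨a, ha⟩, hab⟩ := (Submodule.mem_torsion_iff b).mp hb
  have hab' : algebraMap A B a * b = 0 := by
    rw [← Algebra.smul_def]; exact hab
  rcases mul_eq_zero.mp hab' with h0 | h0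
  · exact absurd ((map_eq_zero_iff _ h.injective).mp h0) (nonZeroDivisors.ne_zero ha)
  · exact h0

theorem smul_right_injective_of_flat {A M : Type*} [CommRing A] [IsDomain A] [AddCommGroup M]
    [Module A M] [Module.Flat A M] {a : A} (ha : a ≠ 0) {m n : M} (h : a • m = a • n) : m = n := by
  have := Module.Flat.torsion_eq_bot (R := A) (M := M)
  rw [← sub_eq_zero, ← Submodule.mem_bot A, ← this, Submodule.mem_torsion_iff]
  exact ⟨⟨a, mem_nonZeroDivisors_of_ne_zero ha⟩, by
    change a • (m - n) = 0
    rw [smul_sub, h, sub_self]⟩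

section Aug
open TensorProduct

variable {A B S : Type*} [CommRing A] [CommRing B] [CommRing S] [Algebra A S]
    [Algebra A B]

/-- The `B`-algebra map `B ⊗ S → B` induced by `φ : S → B`. -/
noncomputable def AlgHom.aug (φ : S →ₐ[A] B) : B ⊗[A] S →ₐ[B] B :=
  Algebra.TensorProduct.lift (AlgHom.id B B) φ (fun _ _ => Commute.all _ _)

@[simp] theorem AlgHom.aug_tmul (φ : S →ₐ[A] B) (b : B) (s : S) :
    φ.aug (b ⊗ₜ s) = b * φ s := by simp [AlgHom.aug]

theorem AlgHom.aug_map {S' : Type*} [CommRing S'] [Algebra A S'] (φ : S →ₐ[A] B)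
    (φ' : S' →ₐ[A] B) (ψ : S →ₐ[A] S') (h : ∀ s, φ' (ψ s) = φ s) (y : B ⊗[A] S) :
    φ'.aug (Algebra.TensorProduct.map (AlgHom.id B B) ψ y) = φ.aug y := by
  have : φ'.aug.comp (Algebra.TensorProduct.map (AlgHom.id B B) ψ) = φ.aug := by
    ext s
    simp [h]
  exact DFunLike.congr_fun this y

/-- Divisibility of `f` by `c` descends from `B ⊗ S` to `S`, locally at the point `φ`. -/
theorem AlgHom.exists_mul_eq_smul [IsLocalRing B] [Module.Flat A B] (φ : S →ₐ[A] B) (f : S)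
    (c : A) (G U : B ⊗[A] S) (hG : IsUnit (φ.aug G)) (h : G * (1 ⊗ₜ f) = c • U) :
    ∃ q u : S, IsUnit (φ q) ∧ q * f = c • u := by
  let R : Submodule A S := LinearMap.range (LinearMap.lsmul A S c)
  let L : S →ₗ[A] S ⧸ R := R.mkQ ∘ₗ LinearMap.mulRight A f
  have hex : Function.Exact (LinearMap.ker L).subtype L := LinearMap.exact_subtype_ker_map L
  have hex2 := Module.Flat.lTensor_exact B hex
  have hL : L.lTensor B G = 0 := by
    have h1 : ∀ y : B ⊗[A] S, L.lTensor B y = R.mkQ.lTensor B (y * (1 ⊗ₜ f)) := by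
      intro y
      induction y with
      | zero => simp
      | tmul b s => simp [L]
      | add y z hy hz => rw [map_add, hy, hz, add_mul, map_add]
    have h2 : ∀ y : B ⊗[A] S, R.mkQ.lTensor B (c • y) = 0 := by
      intro y
      induction y with
      | zero => simp
      | tmul b s =>
        rw [← TensorProduct.tmul_smul, LinearMap.lTensor_tmul]
        have : R.mkQ (c • s) = 0 := by
          rw [Submodule.mkQ_apply, Submodule.Quotient.mk_eq_zero]
          exact ⟨s, rfl⟩
        rw [this, TensorProduct.tmul_zero]
      | add y z hy hz => rw [smul_add, map_add, hy, hz, add_zero]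
    rw [h1, h, h2]
  obtain ⟨y, hy⟩ := (hex2 G).mp hL
  by_contra hcon
  push Not at hcon
  have key : ∀ y : B ⊗[A] LinearMap.ker L,
      φ.aug ((LinearMap.ker L).subtype.lTensor B y) ∈ IsLocalRing.maximalIdeal B := by
    intro y
    induction y with
    | zero => simp
    | tmul b s =>
      rw [LinearMap.lTensor_tmul, AlgHom.aug_tmul]
      refine Ideal.mul_mem_left _ _ ((IsLocalRing.mem_maximalIdeal _).mpr fun hu => ?_)
      have hs := s.2
      rw [LinearMap.mem_ker] at hs
      have hs' : (s : S) * f ∈ R := by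
        rwa [← Submodule.Quotient.mk_eq_zero]
      obtain ⟨u, hu'⟩ := hs'
      exact hcon s u hu hu'.symm
    | add y z hy hz => rw [map_add, map_add]; exact Ideal.add_mem _ hy hz
  exact (IsLocalRing.mem_maximalIdeal _).mp (key y) (hy ▸ hG)

end Aug

section Taylor
open Polynomial TensorProduct

theorem exists_pow_mul_aeval_eq_smul {B T : Type*} [CommRing B] [CommRing T] [Algebra B T]
    (P : B[X]) (e H : B) (b : ℕ → B) (hb : ∀ j, P.coeff j * e ^ j = H * b j)
    (g y ξ : T) (hy : g * y = e • ξ) (ε : T →ₐ[B] B) (hξ : ε ξ = 0) :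
    ∃ Q : T, g ^ P.natDegree * aeval y P = H • Q ∧ ε Q = b 0 * ε g ^ P.natDegree := by
  refine ⟨∑ j ∈ Finset.range (P.natDegree + 1), b j • (ξ ^ j * g ^ (P.natDegree - j)), ?_, ?_⟩
  · rw [aeval_eq_sum_range, Finset.mul_sum, Finset.smul_sum]
    refine Finset.sum_congr rfl fun j hj => ?_
    have hj' : j ≤ P.natDegree := by simpa [Nat.lt_succ_iff] using hj
    obtain ⟨k, hk⟩ := Nat.exists_eq_add_of_le hj'
    have h1 : g ^ P.natDegree * y ^ j = g ^ k * (e • ξ) ^ j := by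
      rw [← hy, hk, mul_pow, pow_add]; ring
    rw [mul_smul_comm, h1, smul_smul, ← hb, hk, Nat.add_sub_cancel_left, _root_.smul_pow,
      mul_smul_comm, smul_smul, mul_comm (g ^ k)]
  · rw [map_sum, Finset.sum_eq_single 0]
    · simp
    · intro j _ hj
      simp [hξ, hj]
    · simp

variable {A B : Type*} [CommRing A] [CommRing B] [Algebra A B]

/-- The `j`-th Taylor coefficient of `h` at `x`. -/
noncomputable def taylorAt (x : B) (h : A[X]) : B[X] := taylor x (h.map (algebraMap A B))

theorem taylorAt_coeff_zero (x : B) (h : A[X]) : (taylorAt x h).coeff 0 = aeval x h := by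
  rw [taylorAt, taylor_coeff_zero, aeval_def, eval_map]

theorem taylorAt_derivative (x : B) (h : A[X]) :
    taylorAt x (derivative h) = derivative (taylorAt x h) := by
  simp [taylorAt, derivative_map, taylor_apply, derivative_comp]

theorem aeval_taylorAt {S : Type*} [CommRing S] [Algebra A S] (x : B) (X : S) (h : A[X]) :
    aeval ((1 : B) ⊗ₜ[A] X - x ⊗ₜ[A] (1 : S)) (taylorAt x h) = (1 : B) ⊗ₜ[A] aeval X h := by
  have h1 : ((1 : B) ⊗ₜ[A] X - x ⊗ₜ[A] (1 : S)) + algebraMap B (B ⊗[A] S) x = 1 ⊗ₜ[A] X := by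
    rw [Algebra.TensorProduct.algebraMap_apply]; simp
  rw [taylorAt, taylor_apply, aeval_comp]
  simp only [map_add, aeval_X, aeval_C]
  rw [h1, aeval_map_algebraMap]
  exact (aeval_algHom_apply (Algebra.TensorProduct.includeRight : S →ₐ[A] B ⊗[A] S) X h)

end Taylor

section Stage
open Polynomial TensorProduct

/-- A smooth `A`-algebra `S` with a point `S → B` mapping `X` to `x`, on which `X` is, after
base change to `B` and near the point, congruent to `x` modulo `e`, while `e` generates the image
of `X` under a derivation. -/
structure Stage {A B : Type v} [CommRing A] [CommRing B] [Algebra A B] (x : B) (e : A) where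
  S : Type v
  [commRing : CommRing S]
  [algebra : Algebra A S]
  [smooth : Algebra.Smooth A S]
  φ : S →ₐ[A] B
  X : S
  D : Derivation A S S
  w : S
  g : B ⊗[A] S
  ξ : B ⊗[A] S
  map_X : φ X = x
  D_X : D X = e • w
  isUnit_w : IsUnit (φ w)
  isUnit_g : IsUnit (φ.aug g)
  aug_ξ : φ.aug ξ = 0
  close : g * (1 ⊗ₜ X - x ⊗ₜ 1) = e • ξ

attribute [instance] Stage.commRing Stage.algebra Stage.smooth

variable {A B : Type v} [CommRing A] [CommRing B] [Algebra A B] {x : B} {e : A}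

theorem Stage.nonempty_one (x : B) : Nonempty (Stage x (1 : A)) := by
  have : Algebra.Smooth A A[X] := ⟨inferInstance, inferInstance⟩
  exact ⟨{
    S := A[X]
    φ := aeval x
    X := Polynomial.X
    D := Polynomial.derivative'
    w := 1
    g := 1
    ξ := 1 ⊗ₜ Polynomial.X - x ⊗ₜ 1
    map_X := by simp
    D_X := by simp [Polynomial.derivative']
    isUnit_w := by simp
    isUnit_g := by simp
    aug_ξ := by simp
    close := by simp }⟩

theorem Stage.exists_away (T : Stage x e) (q : T.S) (hq : IsUnit (T.φ q)) :
    ∃ (T' : Stage x e) (ψ : T.S →ₐ[A] T'.S), (∀ s, T'.φ (ψ s) = T.φ s) ∧ ψ T.X = T'.X ∧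
      IsUnit (ψ q) ∧ ∀ s, T'.D (ψ s) = ψ (T.D s) := by
  obtain ⟨S', i1, i2, i3, ψ, φ', d, h1, h2, h3⟩ := exists_smooth_away T.φ q hq T.D
  refine ⟨{
    S := S'
    φ := φ'
    X := ψ T.X
    D := d
    w := ψ T.w
    g := Algebra.TensorProduct.map (AlgHom.id B B) ψ T.g
    ξ := Algebra.TensorProduct.map (AlgHom.id B B) ψ T.ξ
    map_X := by rw [h1, T.map_X]
    D_X := by rw [h3, T.D_X, map_smul]
    isUnit_w := by rw [h1]; exact T.isUnit_w
    isUnit_g := by rw [AlgHom.aug_map T.φ φ' ψ h1]; exact T.isUnit_g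
    aug_ξ := by rw [AlgHom.aug_map T.φ φ' ψ h1]; exact T.aug_ξ
    close := ?_ }, ψ, h1, rfl, h2, h3⟩
  have := congr_arg (Algebra.TensorProduct.map (AlgHom.id B B) ψ) T.close
  rw [map_mul, map_sub, ← algebraMap_smul B e, map_smul, algebraMap_smul] at this
  simpa using this

/-- All Taylor terms of `h` at `x` are divisible by the constant one at distance `e`. -/
def IsGood (x : B) (h : A[X]) (e : A) : Prop :=
  ∀ j, aeval x h ∣ (taylorAt x h).coeff j * algebraMap A B e ^ j

theorem IsGood.of_dvd {h : A[X]} {e e' : A} (H : IsGood x h e) (he : e ∣ e') :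
    IsGood x h e' := by
  intro j
  obtain ⟨c, rfl⟩ := he
  rw [map_mul, mul_pow, ← mul_assoc]
  exact (H j).mul_right _

theorem isGood_zero (x : B) (h : A[X]) : IsGood x h (0 : A) := by
  intro j
  rcases j with _ | j
  · rw [taylorAt_coeff_zero]; simp
  · simp

theorem isGood_of_taylorAt_coeff {h : A[X]} (H : ∀ j, (taylorAt x h).coeff (j + 1) = 0) :
    IsGood x h e := by
  intro j
  rcases j with _ | j
  · rw [taylorAt_coeff_zero]; simp
  · simp [H]

variable [IsDomain B] [ValuationRing B]

theorem Stage.exists_isUnit_mul (hAB : IsImmediateExt A B) (T : Stage x e) {h : A[X]}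
    (hh : IsGood x h e) {c : A} (hc : Associated (algebraMap A B c) (aeval x h)) :
    ∃ (T' : Stage x e) (ψ : T.S →ₐ[A] T'.S) (u : T'.S), (∀ s, T'.φ (ψ s) = T.φ s) ∧
      ψ T.X = T'.X ∧ aeval T'.X h = c • u ∧ IsUnit u := by
  have := hAB.flat
  obtain ⟨μ, hμ⟩ := hc
  choose b hb using hh
  let b' : ℕ → B := fun j => if j = 0 then 1 else b j
  have hb' : ∀ j, (taylorAt x h).coeff j * algebraMap A B e ^ j = aeval x h * b' j := by
    intro j
    rcases j with _ | j
    · rw [taylorAt_coeff_zero]; simp [b']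
    · simp [b', hb]
  have hcl := T.close
  rw [← algebraMap_smul B e] at hcl
  obtain ⟨Q, hQ, hεQ⟩ := exists_pow_mul_aeval_eq_smul _ _ _ b' hb' _ _ _ hcl T.φ.aug T.aug_ξ
  rw [aeval_taylorAt, ← hμ, mul_smul, algebraMap_smul] at hQ
  obtain ⟨q, u, hq, hu⟩ := T.φ.exists_mul_eq_smul _ c _ _ (by
    rw [map_pow]; exact T.isUnit_g.pow _) hQ
  obtain ⟨T₁, ψ₁, h1, h2, h3, -⟩ := T.exists_away q hq
  have hq1 := congr_arg ψ₁ hu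
  rw [map_mul, map_smul, ← aeval_algHom_apply, h2] at hq1
  obtain ⟨r, hr⟩ := h3.exists_left_inv
  have hT₁ : aeval T₁.X h = c • (r * ψ₁ u) := by
    rw [← mul_smul_comm, ← hq1, ← mul_assoc, hr, one_mul]
  by_cases hc0 : c = 0
  · exact ⟨T₁, ψ₁, 1, h1, h2, by simp [hT₁, hc0], isUnit_one⟩
  have hu1 : IsUnit (T₁.φ (r * ψ₁ u)) := by
    have := congr_arg T₁.φ hT₁
    rw [map_smul, ← aeval_algHom_apply, T₁.map_X, ← hμ, Algebra.smul_def] at this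
    have hc1 : algebraMap A B c ≠ 0 := by rwa [Ne, map_eq_zero_iff _ hAB.injective]
    rw [← mul_left_cancel₀ hc1 this]
    exact μ.isUnit
  obtain ⟨T₂, ψ₂, h1', h2', h3', -⟩ := T₁.exists_away _ hu1
  refine ⟨T₂, ψ₂.comp ψ₁, ψ₂ (r * ψ₁ u), ?_, ?_, ?_, h3'⟩
  · intro s; simp [h1', h1]
  · simp [h2, h2']
  · rw [← h2', aeval_algHom_apply, hT₁, map_smul]

end Stage

section Dilation
open Polynomial TensorProduct

variable {A B : Type v} [CommRing A] [CommRing B] [Algebra A B] {x : B} {e : A}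

theorem dvd_of_dvd_natCast_succ_mul {B : Type*} [CommRing B] [Algebra ℚ B] {a b : B} (n : ℕ)
    (h : a ∣ b * ((n : B) + 1)) : a ∣ b := by
  have hu : IsUnit ((n : B) + 1) := by
    have : ((n : B) + 1) = algebraMap ℚ B (n + 1) := by simp
    rw [this]
    exact (IsUnit.mk0 _ (by positivity)).map _
  exact (hu.dvd_mul_right).mp h

theorem IsGood.dvd_coeff_succ [Algebra ℚ B] {h : A[X]} (hh : IsGood x (derivative h) e) (j : ℕ) :
    aeval x (derivative h) ∣ (taylorAt x h).coeff (j + 1) * algebraMap A B e ^ j := by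
  have := hh j
  rw [taylorAt_derivative, coeff_derivative] at this
  refine dvd_of_dvd_natCast_succ_mul j ?_
  convert this using 1
  ring

/-- The dilation of a stage along `t`, with centre `G`. -/
theorem Stage.exists_dilation (T : Stage x e) (t : A) (G : T.S)
    (z : B) (hG : T.φ G = t • z) (hD : IsUnit (T.D G)) (P Q : B ⊗[A] T.S)
    (hQ : IsUnit (T.φ.aug Q)) (hPQ : P * (1 ⊗ₜ G - (t • z) ⊗ₜ 1) = T.ξ * Q) :
    Nonempty (Stage x (e * t)) := by
  obtain ⟨S', i1, i2, i3, ψ, φ', d, Z, h1, h2, h3, h4⟩ :=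
    exists_smooth_dilation T.φ t G z hG T.D hD
  let Ψ := Algebra.TensorProduct.map (AlgHom.id B B) ψ
  have haug : ∀ y, φ'.aug (Ψ y) = T.φ.aug y := AlgHom.aug_map T.φ φ' ψ h1
  have hsmul : ∀ (a : A) y, Ψ (a • y) = a • Ψ y := fun a y => by
    rw [← algebraMap_smul B a, map_smul, algebraMap_smul]
  refine ⟨{
    S := S'
    φ := φ'
    X := ψ T.X
    D := d
    w := ψ T.w
    g := Ψ (T.g * Q)
    ξ := Ψ P * (1 ⊗ₜ Z - z ⊗ₜ 1)
    map_X := by rw [h1, T.map_X]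
    D_X := by rw [h4, T.D_X, map_smul, smul_smul, mul_comm]
    isUnit_w := by rw [h1]; exact T.isUnit_w
    isUnit_g := by rw [haug, map_mul]; exact T.isUnit_g.mul hQ
    aug_ξ := by rw [map_mul]; simp [h2]
    close := ?_ }⟩
  have c1 := congr_arg Ψ T.close
  have c2 := congr_arg Ψ hPQ
  rw [map_mul, map_sub, hsmul] at c1
  rw [map_mul, map_sub, map_mul] at c2
  have e1 : ∀ s, Ψ (1 ⊗ₜ s) = 1 ⊗ₜ ψ s := fun s => by simp [Ψ]
  have e2 : ∀ b : B, Ψ (b ⊗ₜ 1) = b ⊗ₜ 1 := fun s => by simp [Ψ]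
  rw [e1, e2] at c1 c2
  rw [h3, TensorProduct.tmul_smul, ← TensorProduct.smul_tmul', ← smul_sub] at c2
  rw [map_mul, mul_right_comm, c1, smul_mul_assoc, ← c2, mul_smul_comm, smul_smul]

theorem Stage.exists_isGood_of_derivative [IsDomain B] [ValuationRing B] [Algebra ℚ B]
    (hAB : IsImmediateExt A B) (T : Stage x e) {h : A[X]} (hh : IsGood x (derivative h) e) :
    ∃ e', e ∣ e' ∧ IsGood x h e' ∧ Nonempty (Stage x e') := by
  have hflat := hAB.flat
  have hdom : IsDomain A := hAB.injective.isDomain _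
  by_cases he : e = 0
  · exact ⟨e, dvd_rfl, he ▸ isGood_zero x h, ⟨T⟩⟩
  have he' : algebraMap A B e ≠ 0 := by rwa [Ne, map_eq_zero_iff _ hAB.injective]
  by_cases hH1 : aeval x (derivative h) = 0
  · refine ⟨e, dvd_rfl, isGood_of_taylorAt_coeff fun j => ?_, ⟨T⟩⟩
    have := hh.dvd_coeff_succ j
    rw [hH1, zero_dvd_iff] at this
    exact (mul_eq_zero.mp this).resolve_right (pow_ne_zero _ he')
  set H₀ := aeval x h with hH₀
  set H₁ := aeval x (derivative h) with hH₁
  rcases ValuationRing.dvd_total H₀ (H₁ * algebraMap A B e) with hdvd | ⟨h0, hdvd⟩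
  · refine ⟨e, dvd_rfl, fun j => ?_, ⟨T⟩⟩
    rcases j with _ | j
    · rw [taylorAt_coeff_zero]; simp
    · rw [pow_succ, ← mul_assoc]
      exact hdvd.trans (mul_dvd_mul_right (hh.dvd_coeff_succ j) _)
  -- `h(X) - h(x) = (X - x) R(X - x)`, where `R` is `divX` of the Taylor polynomial
  choose b hb using hh.dvd_coeff_succ
  have hb0 : b 0 = 1 := by
    have := hb 0
    have hd : (taylorAt x h).coeff (0 + 1) = H₁ := by
      rw [hH₁, ← taylorAt_coeff_zero, taylorAt_derivative, coeff_derivative]; simp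
    rw [hd] at this
    exact (mul_left_cancel₀ hH1 (by simpa using this)).symm
  obtain ⟨d, μ, hμ⟩ := hAB.exists_associated (H₁ * algebraMap A B e)
  have hd0 : d ≠ 0 := by
    rintro rfl
    rw [map_zero, zero_mul] at hμ
    exact mul_ne_zero hH1 he' hμ.symm
  have hd0' : algebraMap A B d ≠ 0 := by rwa [Ne, map_eq_zero_iff _ hAB.injective]
  have hH0 : H₀ = algebraMap A B d * (μ * h0) := by rw [hdvd, ← hμ, mul_assoc]
  have expand : ∀ T : Stage x e, ∃ P Q : B ⊗[A] T.S, IsUnit (T.φ.aug P) ∧ IsUnit (T.φ.aug Q) ∧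
      P * (1 ⊗ₜ aeval T.X h - H₀ ⊗ₜ 1) = d • (T.ξ * Q) := by
    intro T
    have hcl := T.close
    rw [← algebraMap_smul B e] at hcl
    obtain ⟨Q, hQ, hεQ⟩ := exists_pow_mul_aeval_eq_smul (divX (taylorAt x h)) _ H₁ b
      (by intro j; rw [coeff_divX]; exact hb j) _ _ _ hcl T.φ.aug T.aug_ξ
    have hR := congr_arg (aeval ((1 : B) ⊗ₜ[A] T.X - x ⊗ₜ[A] (1 : T.S)))
      (divX_mul_X_add (taylorAt x h))
    rw [aeval_taylorAt, map_add, map_mul, aeval_X, aeval_C, taylorAt_coeff_zero,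
      Algebra.TensorProduct.algebraMap_apply] at hR
    refine ⟨T.g ^ ((divX (taylorAt x h)).natDegree + 1), (μ : B) • Q, ?_, ?_, ?_⟩
    · rw [map_pow]; exact T.isUnit_g.pow _
    · rw [map_smul, hεQ, hb0, one_mul, smul_eq_mul]
      exact μ.isUnit.mul (T.isUnit_g.pow _)
    · rw [← hR]
      rw [Algebra.algebraMap_self_apply, add_sub_cancel_right, pow_succ, mul_mul_mul_comm, hQ,
        hcl, smul_mul_smul_comm, ← hμ, mul_smul, algebraMap_smul, mul_smul_comm, mul_comm Q]
  have cancel : ∀ y z : B, algebraMap A B d * y = algebraMap A B d * z → y = z :=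
    fun y z hyz => mul_left_cancel₀ hd0' hyz
  obtain ⟨P, Q, hP, hQ, hPQ⟩ := expand T
  obtain ⟨q, u, hq, hqu⟩ := T.φ.exists_mul_eq_smul (aeval T.X h) d P
    (T.ξ * Q + P * ((μ * h0) ⊗ₜ 1)) hP (by
      rw [smul_add, ← hPQ, mul_sub, ← mul_smul_comm, TensorProduct.smul_tmul', Algebra.smul_def,
        ← hH0]
      ring)
  obtain ⟨T₁, ψ₁, h1, h2, h3, -⟩ := T.exists_away q hq
  obtain ⟨r, hr⟩ := h3.exists_left_inv
  have hT₁ : aeval T₁.X h = d • (r * ψ₁ u) := by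
    have hq1 := congr_arg ψ₁ hqu
    rw [map_mul, map_smul, ← aeval_algHom_apply, h2] at hq1
    rw [← mul_smul_comm, ← hq1, ← mul_assoc, hr, one_mul]
  set G := r * ψ₁ u
  have hφG : T₁.φ G = μ * h0 := by
    refine cancel _ _ ?_
    rw [← hH0, ← Algebra.smul_def, ← map_smul, ← hT₁, ← aeval_algHom_apply, T₁.map_X]
  have hDG : IsUnit (T₁.φ (T₁.D G)) := by
    have : T₁.φ (T₁.D G) = μ * T₁.φ T₁.w := by
      refine cancel _ _ ?_
      rw [← Algebra.smul_def, ← map_smul, ← Derivation.map_smul, ← hT₁, Derivation.map_aeval,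
        T₁.D_X, smul_eq_mul, map_mul, map_smul, ← aeval_algHom_apply, T₁.map_X, Algebra.smul_def,
        ← mul_assoc, ← mul_assoc, hμ]
    rw [this]
    exact μ.isUnit.mul T₁.isUnit_w
  obtain ⟨T₂, ψ₂, h1', h2', h3', h4'⟩ := T₁.exists_away _ hDG
  have hT₂ : aeval T₂.X h = d • ψ₂ G := by
    rw [← h2', aeval_algHom_apply, hT₁, map_smul]
  obtain ⟨t, ν, hν⟩ := hAB.exists_associated (μ * h0)
  obtain ⟨P₂, Q₂, -, hQ₂, hPQ₂⟩ := expand T₂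
  refine ⟨e * t, dvd_mul_right _ _, fun j => ?_, T₂.exists_dilation t (ψ₂ G) ν ?_ ?_ P₂ Q₂ hQ₂ ?_⟩
  · rcases j with _ | j
    · rw [taylorAt_coeff_zero]; simp
    · have e1 : (taylorAt x h).coeff (j + 1) * algebraMap A B (e * t) ^ (j + 1) =
          (algebraMap A B d * algebraMap A B t) * (μ * b j * algebraMap A B t ^ j) := by
        have hbj : _ = H₁ * b j := hb j
        rw [map_mul]
        linear_combination (algebraMap A B e * algebraMap A B t ^ (j + 1)) * hbj -
          (b j * algebraMap A B t ^ (j + 1)) * hμ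
      rw [e1, ← hH₀, hH0, ← hν, ← mul_assoc]
      exact (ν.isUnit.mul_right_dvd.mpr dvd_rfl).mul_right _
  · rw [h1', hφG, ← hν, Algebra.smul_def]
  · rw [h4']; exact h3'
  · refine smul_right_injective_of_flat hd0 ?_
    rw [← hPQ₂, hT₂, ← mul_smul_comm, smul_sub, TensorProduct.tmul_smul, hH0,
      Algebra.smul_def t, hν, TensorProduct.smul_tmul' d (μ * h0 : B),
      Algebra.smul_def d (μ * h0 : B)]

theorem Stage.exists_isGood [IsDomain B] [ValuationRing B] [Algebra ℚ B]
    (hAB : IsImmediateExt A B) (n : ℕ) :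
    ∀ {h : A[X]}, h.natDegree ≤ n → ∀ {e : A}, Nonempty (Stage x e) →
      ∃ e', e ∣ e' ∧ IsGood x h e' ∧ Nonempty (Stage x e') := by
  induction n with
  | zero =>
    intro h hn e T
    refine ⟨e, dvd_rfl, isGood_of_taylorAt_coeff fun j => ?_, T⟩
    rw [eq_C_of_natDegree_le_zero hn]
    simp [taylorAt]
  | succ n ih =>
    intro h hn e T
    obtain ⟨e₁, he₁, hg, ⟨T₁⟩⟩ := ih (h := derivative h) (by
      have := natDegree_derivative_le h
      omega) T
    obtain ⟨e₂, he₂, hg₂, T₂⟩ := T₁.exists_isGood_of_derivative hAB hg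
    exact ⟨e₂, he₁.trans he₂, hg₂, T₂⟩

theorem Stage.exists_forall_isGood [IsDomain B] [ValuationRing B] [Algebra ℚ B]
    (hAB : IsImmediateExt A B) (l : Finset A[X]) :
    ∃ e : A, (∀ h ∈ l, IsGood x h e) ∧ Nonempty (Stage x e) := by
  classical
  induction l using Finset.induction_on with
  | empty => exact ⟨1, by simp, Stage.nonempty_one x⟩
  | insert h l _ ih =>
    obtain ⟨e, he, T⟩ := ih
    obtain ⟨e', hee, hg, T'⟩ := Stage.exists_isGood hAB _ (le_refl h.natDegree) T
    refine ⟨e', fun k hk => ?_, T'⟩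
    rcases Finset.mem_insert.mp hk with rfl | hk
    · exact hg
    · exact (he k hk).of_dvd hee

/-- Given finitely many polynomials, some smooth algebra contains a lift `X` of `x` at which
each of them is a unit multiple of a scalar with the right valuation. -/
theorem exists_smooth_aeval_eq_smul [IsDomain B] [ValuationRing B] [Algebra ℚ B]
    (hAB : IsImmediateExt A B) (x : B) (l : Finset A[X]) (c : A[X] → A)
    (hc : ∀ h ∈ l, Associated (algebraMap A B (c h)) (aeval x h)) :
    ∃ (S : Type v) (_ : CommRing S) (_ : Algebra A S) (_ : Algebra.Smooth A S) (φ : S →ₐ[A] B)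
      (X : S), φ X = x ∧ ∀ h ∈ l, ∃ u : S, IsUnit u ∧ aeval X h = c h • u := by
  classical
  obtain ⟨e, he, ⟨T₀⟩⟩ := Stage.exists_forall_isGood (x := x) hAB l
  have : ∀ l' ⊆ l, ∃ T : Stage x e, ∀ h ∈ l', ∃ u : T.S, IsUnit u ∧ aeval T.X h = c h • u := by
    intro l' hl'
    induction l' using Finset.induction_on with
    | empty => exact ⟨T₀, by simp⟩
    | insert k l' _ ih =>
      obtain ⟨T, hT⟩ := ih fun i hi => hl' (Finset.mem_insert_of_mem hi)
      have hk := hl' (Finset.mem_insert_self k l')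
      obtain ⟨T', ψ, u, -, h2, h3, h4⟩ := T.exists_isUnit_mul hAB (he k hk) (hc k hk)
      refine ⟨T', fun i hi => ?_⟩
      rcases Finset.mem_insert.mp hi with rfl | hi
      · exact ⟨u, h4, h3⟩
      · obtain ⟨v, hv, hv'⟩ := hT i hi
        exact ⟨ψ v, hv.map ψ, by rw [← h2, aeval_algHom_apply, hv', map_smul]⟩
  obtain ⟨T, hT⟩ := this l subset_rfl
  exact ⟨T.S, _, _, T.smooth, T.φ, T.X, T.map_X, hT⟩

end Dilation

section Simple
open Polynomial

variable {A B : Type v} [CommRing A] [CommRing B] [Algebra A B]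

/-- A polynomial expression in fractions of polynomials is a fraction of polynomials,
universally. -/
theorem exists_common_denominator [IsDomain B] {ι : Type*} (x : B) (p q : ι → A[X])
    (hq : ∀ i, aeval x (q i) ≠ 0) (R : MvPolynomial ι A) :
    ∃ Q r : A[X], aeval x Q ≠ 0 ∧ ∀ (C : Type v) [CommRing C] [Algebra A C] (z : C) (y : ι → C),
      (∀ i, aeval z (q i) * y i = aeval z (p i)) →
        aeval z Q * MvPolynomial.aeval y R = aeval z r := by
  induction R using MvPolynomial.induction_on with
  | C a => exact ⟨1, C a, by simp, fun C _ _ z y _ => by simp⟩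
  | add R₁ R₂ h₁ h₂ =>
    obtain ⟨Q₁, r₁, hQ₁, H₁⟩ := h₁
    obtain ⟨Q₂, r₂, hQ₂, H₂⟩ := h₂
    refine ⟨Q₁ * Q₂, r₁ * Q₂ + r₂ * Q₁, by simp [hQ₁, hQ₂], fun C _ _ z y h => ?_⟩
    simp only [map_add, map_mul]
    rw [← H₁ C z y h, ← H₂ C z y h]
    ring
  | mul_X R i h =>
    obtain ⟨Q, r, hQ, H⟩ := h
    refine ⟨Q * q i, r * p i, by simp [hQ, hq], fun C _ _ z y h => ?_⟩
    simp only [map_mul, MvPolynomial.aeval_X]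
    rw [← H C z y h, ← h i]
    ring

/-- The ring of those elements of `B` that are fractions of polynomials in `x` over `A`. -/
def fracSubalgebra (A : Type v) {B : Type v} [CommRing A] [CommRing B] [Algebra A B] [IsDomain B]
    (x : B) : Subalgebra A B where
  carrier := {w | ∃ p q : A[X], aeval x q ≠ 0 ∧ aeval x q * w = aeval x p}
  mul_mem' := by
    rintro a b ⟨p, q, hq, h⟩ ⟨p', q', hq', h'⟩
    refine ⟨p * p', q * q', by simp [hq, hq'], ?_⟩
    simp only [map_mul]
    rw [← h, ← h']; ring
  add_mem' := by
    rintro a b ⟨p, q, hq, h⟩ ⟨p', q', hq', h'⟩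
    refine ⟨p * q' + p' * q, q * q', by simp [hq, hq'], ?_⟩
    simp only [map_mul, map_add]
    rw [← h, ← h']; ring
  algebraMap_mem' a := ⟨C a, 1, by simp, by simp⟩

variable [IsDomain B]

theorem self_mem_fracSubalgebra (x : B) : x ∈ fracSubalgebra A x :=
  ⟨X, 1, by simp, by simp⟩

theorem IsImmediateExt.over_fracSubalgebra (hAB : IsImmediateExt A B) (x : B) :
    IsImmediateExt (fracSubalgebra A x) B where
  injective := Subtype.val_injective
  dvd_of_dvd := by
    rintro ⟨a, p, q, hq, h⟩ ⟨b, p', q', hq', h'⟩ ⟨t, ht⟩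
    change b = a * t at ht
    by_cases ha : a = 0
    · subst ha
      rw [zero_mul] at ht
      subst ht
      exact ⟨1, (mul_one _).symm⟩
    · refine ⟨⟨t, p' * q, q' * p, ?_, ?_⟩, Subtype.ext ht⟩
      · rw [map_mul, ← h]
        exact mul_ne_zero hq' (mul_ne_zero hq ha)
      · simp only [map_mul]
        rw [← h, ← h', ht]; ring
  exists_associated b := by
    obtain ⟨a, ha⟩ := hAB.exists_associated b
    exact ⟨algebraMap A _ a, ha⟩

theorem exists_smooth_of_mem_fracSubalgebra [ValuationRing B] [Algebra ℚ B]
    (hAB : IsImmediateExt A B) (x : B) {ι : Type*} [Finite ι] (w : ι → B)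
    (hw : ∀ i, w i ∈ fracSubalgebra A x) (l : Set (MvPolynomial ι A)) (hl : l.Finite)
    (hwl : ∀ R ∈ l, MvPolynomial.aeval w R = 0) :
    ∃ (S : Type v) (_ : CommRing S) (_ : Algebra A S) (_ : Algebra.Smooth A S) (φ : S →ₐ[A] B)
      (y : ι → S), (∀ i, φ (y i) = w i) ∧ ∀ R ∈ l, MvPolynomial.aeval y R = 0 := by
  classical
  have hdom : IsDomain A := hAB.injective.isDomain _
  have hne : ∀ a : A, a ≠ 0 → algebraMap A B a ≠ 0 := fun a ha => by
    rwa [Ne, map_eq_zero_iff _ hAB.injective]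
  choose p q hq hpq using hw
  choose Q r hQ hr using exists_common_denominator x p q hq
  choose c hc using fun h : A[X] => hAB.exists_associated (aeval x h)
  obtain ⟨S, i1, i2, i3, φ, X, hX, H⟩ := exists_smooth_aeval_eq_smul hAB x
    ((Set.finite_range p).toFinset ∪ (Set.finite_range q).toFinset ∪ (hl.image Q).toFinset ∪
      (hl.image r).toFinset) c (fun h _ => hc h)
  have hφ : ∀ h : A[X], φ (aeval X h) = aeval x h := fun h => by rw [← aeval_algHom_apply, hX]
  have hc0 : ∀ h : A[X], aeval x h ≠ 0 → c h ≠ 0 := by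
    intro h hh h0
    have := hc h
    rw [h0, map_zero, Associated.comm, associated_zero_iff_eq_zero] at this
    exact hh this
  have Hp : ∀ i, ∃ u : S, IsUnit u ∧ aeval X (p i) = c (p i) • u := fun i => H _ (by simp)
  have Hq : ∀ i, ∃ u : S, IsUnit u ∧ aeval X (q i) = c (q i) • u := fun i => H _ (by simp)
  choose u _ hu' using Hp
  choose v hv hv' using Hq
  choose v' hvv' using fun i => (hv i).exists_right_inv
  have hdvd : ∀ i, c (q i) ∣ c (p i) := fun i => by
    refine hAB.dvd_of_dvd _ _ ?_
    rw [(hc _).dvd_iff_dvd_left, (hc _).dvd_iff_dvd_right, ← hpq]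
    exact dvd_mul_right _ _
  choose k hk using hdvd
  have hy : ∀ i, aeval X (q i) * (k i • (u i * v' i)) = aeval X (p i) := by
    intro i
    rw [hv', hu', hk, smul_mul_smul_comm, mul_left_comm, hvv', mul_one]
  refine ⟨S, i1, i2, i3, φ, fun i => k i • (u i * v' i), fun i => ?_, fun R hR => ?_⟩
  · refine mul_left_cancel₀ (hq i) ?_
    rw [hpq, ← hφ, ← map_mul, hy, hφ]
  · have h1 := hr R S X _ hy
    obtain ⟨a, ha, ha'⟩ := H (Q R) (by
      simp only [Finset.mem_union, Set.Finite.mem_toFinset]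
      exact .inl (.inr ⟨R, hR, rfl⟩))
    obtain ⟨b, -, hb'⟩ := H (r R) (by
      simp only [Finset.mem_union, Set.Finite.mem_toFinset]
      exact .inr ⟨R, hR, rfl⟩)
    have hcr : c (r R) = 0 := by
      have h2 := hc (r R)
      rw [← hr R B x w hpq, hwl R hR, mul_zero, associated_zero_iff_eq_zero,
        map_eq_zero_iff _ hAB.injective] at h2
      exact h2
    rw [hb', hcr, zero_smul, ha', smul_mul_assoc, ← smul_zero (c (Q R))] at h1
    have h3 := smul_right_injective_of_flat (hc0 _ (hQ R)) h1
    exact (ha.mul_right_eq_zero).mp h3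

end Simple

section Descent
open TensorProduct

/-- A smooth algebra with finitely many elements comes from a finitely presented `ℤ`-subalgebra
containing any given finite set. -/
theorem Algebra.Smooth.exists_descent {W S : Type v} [CommRing W] [CommRing S] [Algebra W S]
    [Algebra.Smooth W S] (F : Set W) (hF : F.Finite) {ι : Type*} [Finite ι] (s : ι → S) :
    ∃ (V₀ : Type v) (_ : CommRing V₀) (_ : Algebra.FinitePresentation ℤ V₀) (i : V₀ →+* W)
      (S₀ : Type v) (_ : CommRing S₀) (_ : Algebra V₀ S₀) (_ : Algebra.Smooth V₀ S₀)
      (j : S₀ →+* S), Function.Injective i ∧ F ⊆ Set.range i ∧ Function.Injective j ∧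
      (∀ v, j (algebraMap V₀ S₀ v) = algebraMap W S (i v)) ∧ ∀ k, s k ∈ Set.range j := by
  obtain ⟨A₀, S₀, _, _, hfg, hsm, ⟨e⟩⟩ := Algebra.Smooth.exists_subalgebra_fg ℤ W S
  obtain ⟨J, ⟨G, hG⟩, hJ⟩ := Submodule.exists_fg_le_subset_range_rTensor_subtype (R := A₀)
    (Set.range fun k => e (s k)) (Set.finite_range _)
  let V₀ : Subalgebra A₀ W := Algebra.adjoin A₀ (F ∪ G)
  have hA₀ : Algebra.FiniteType ℤ A₀ := (Subalgebra.fg_iff_finiteType _).mp hfg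
  have hV₀ : Algebra.FiniteType A₀ V₀ :=
    (Subalgebra.fg_iff_finiteType _).mp
      (Subalgebra.fg_def.mpr ⟨F ∪ G, hF.union G.finite_toSet, rfl⟩)
  have hV₀' : Algebra.FiniteType ℤ V₀ := Algebra.FiniteType.trans hA₀ hV₀
  let j : V₀ ⊗[A₀] S₀ →ₐ[A₀] W ⊗[A₀] S₀ := Algebra.TensorProduct.map V₀.val (AlgHom.id A₀ S₀)
  have hj : Function.Injective j :=
    Module.Flat.rTensor_preserves_injective_linearMap (M := S₀) V₀.val.toLinearMap
      Subtype.val_injective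
  refine ⟨V₀, inferInstance, Algebra.FinitePresentation.of_finiteType.mp hV₀', V₀.val.toRingHom,
    V₀ ⊗[A₀] S₀, inferInstance, inferInstance, inferInstance,
    (e.symm : W ⊗[A₀] S₀ →+* S).comp j.toRingHom, Subtype.val_injective, ?_, ?_, ?_, ?_⟩
  · intro f hf
    exact ⟨⟨f, Algebra.subset_adjoin (.inl hf)⟩, rfl⟩
  · exact e.symm.injective.comp hj
  · intro v
    have : j (algebraMap V₀ (V₀ ⊗[A₀] S₀) v) = algebraMap W _ (v : W) := by
      rw [Algebra.TensorProduct.algebraMap_apply, Algebra.TensorProduct.algebraMap_apply]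
      exact Algebra.TensorProduct.map_tmul _ _ _ _
    change e.symm (j _) = _
    rw [this]
    exact e.symm.commutes _
  · intro k
    have hJV : J ≤ Subalgebra.toSubmodule V₀ := by
      rw [← hG, Submodule.span_le]
      exact fun g hg => Algebra.subset_adjoin (.inr hg)
    obtain ⟨y, hy⟩ := hJ ⟨k, rfl⟩
    refine ⟨(Submodule.inclusion hJV).rTensor S₀ y, ?_⟩
    have hjy : ∀ z, j ((Submodule.inclusion hJV).rTensor S₀ z) = J.subtype.rTensor S₀ z := by
      intro z
      induction z with
      | zero => simp
      | tmul a b => exact Algebra.TensorProduct.map_tmul _ _ _ _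
      | add a b ha hb => rw [map_add, map_add, map_add, ha, hb]
    have : j ((Submodule.inclusion hJV).rTensor S₀ y) = e (s k) := (hjy y).trans hy
    change e.symm (j _) = _
    rw [this]
    exact e.symm_apply_apply _

theorem Algebra.Smooth.exists_pushout {V S₁ S₀ B : Type v} [CommRing V] [CommRing S₁] [CommRing S₀]
    [CommRing B] [Algebra V S₀] [Algebra.Smooth V S₀] (θ : V →+* S₁) (φ₁ : S₁ →+* B)
    (φ₀ : S₀ →+* B) (h : ∀ v, φ₀ (algebraMap V S₀ v) = φ₁ (θ v)) :
    ∃ (S : Type v) (_ : CommRing S) (_ : Algebra S₁ S) (_ : Algebra.Smooth S₁ S) (i : S₀ →+* S)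
      (φ : S →+* B), (∀ s, φ (algebraMap S₁ S s) = φ₁ s) ∧ (∀ s, φ (i s) = φ₀ s) ∧
      ∀ v, i (algebraMap V S₀ v) = algebraMap S₁ S (θ v) := by
  let := θ.toAlgebra
  let := (φ₁.comp θ).toAlgebra
  let f₁ : S₁ →ₐ[V] B := { φ₁ with commutes' := fun v => rfl }
  let f₀ : S₀ →ₐ[V] B := { φ₀ with commutes' := h }
  refine ⟨S₁ ⊗[V] S₀, inferInstance, inferInstance, inferInstance,
    (Algebra.TensorProduct.includeRight : S₀ →ₐ[V] S₁ ⊗[V] S₀).toRingHom,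
    (Algebra.TensorProduct.productMap f₁ f₀).toRingHom, ?_, ?_, ?_⟩
  · intro s
    have := Algebra.TensorProduct.productMap_left_apply f₁ f₀ s
    exact this
  · intro s
    have := Algebra.TensorProduct.productMap_right_apply f₁ f₀ s
    exact this
  · intro v
    exact (Algebra.TensorProduct.includeRight : S₀ →ₐ[V] S₁ ⊗[V] S₀).commutes v

end Descent

section Lift
open MvPolynomial

variable {A B : Type v} [CommRing A] [CommRing B] [Algebra A B] [IsDomain B] [ValuationRing B]
  [Algebra ℚ B]

/-- A finitely presented ring with values in fractions of polynomials in `x` over `A` maps to `B`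
through a smooth `A`-algebra. -/
theorem exists_smooth_lift (hAB : IsImmediateExt A B) (x : B) {V₀ : Type v} [CommRing V₀]
    [Algebra.FinitePresentation ℤ V₀] (j : V₀ →+* B) (hj : ∀ v, j v ∈ fracSubalgebra A x)
    (P : Set (V₀ × A)) (hP : P.Finite) (hjP : ∀ p ∈ P, j p.1 = algebraMap A B p.2) :
    ∃ (S : Type v) (_ : CommRing S) (_ : Algebra A S) (_ : Algebra.Smooth A S) (φ : S →ₐ[A] B)
      (θ : V₀ →+* S), (∀ v, φ (θ v) = j v) ∧ ∀ p ∈ P, θ p.1 = algebraMap A S p.2 := by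
  obtain ⟨n, f, hf, G, hG⟩ := Algebra.FinitePresentation.out (R := ℤ) (A := V₀)
  choose g hg using hf
  have key : ∀ R : MvPolynomial (Fin n) ℤ, aeval (fun i => j (f (X i))) R = j (f R) := by
    intro R
    have : (aeval fun i => j (f (X i)) : MvPolynomial (Fin n) ℤ →ₐ[ℤ] B) =
        j.toIntAlgHom.comp f := by
      ext i
      simp
    exact DFunLike.congr_fun this R
  obtain ⟨S, i1, i2, i3, φ, y, hy, H⟩ := exists_smooth_of_mem_fracSubalgebra hAB x
    (fun i => j (f (X i))) (fun i => hj _)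
    (map (algebraMap ℤ A) '' G ∪ (fun p : V₀ × A => map (algebraMap ℤ A) (g p.1) - C p.2) '' P)
    ((G.finite_toSet.image _).union (hP.image _)) (by
      rintro _ (⟨R, hR, rfl⟩ | ⟨p, hp, rfl⟩)
      · have : f R = 0 := by
          have : R ∈ RingHom.ker f.toRingHom := hG ▸ Ideal.subset_span hR
          exact this
        rw [aeval_map_algebraMap, key, this, map_zero]
      · rw [map_sub, aeval_map_algebraMap, key, hg, hjP p hp, aeval_C, sub_self])
  have hker : RingHom.ker f.toRingHom ≤ RingHom.ker (aeval y : _ →ₐ[ℤ] S).toRingHom := by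
    rw [← hG, Ideal.span_le]
    intro R hR
    have := H _ (.inl ⟨R, hR, rfl⟩)
    rwa [aeval_map_algebraMap] at this
  let θ : V₀ →+* S := f.toRingHom.liftOfSurjective (fun v => ⟨g v, hg v⟩)
    ⟨(aeval y : _ →ₐ[ℤ] S).toRingHom, hker⟩
  have hθ : ∀ R, θ (f R) = aeval y R := fun R =>
    f.toRingHom.liftOfRightInverse_comp_apply _ _ ⟨(aeval y : _ →ₐ[ℤ] S).toRingHom, hker⟩ R
  refine ⟨S, i1, i2, i3, φ, θ, fun v => ?_, fun p hp => ?_⟩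
  · obtain ⟨R, rfl⟩ : ∃ R, f R = v := ⟨g v, hg v⟩
    rw [hθ, ← key]
    have : ((φ.restrictScalars ℤ).comp (aeval y) : MvPolynomial (Fin n) ℤ →ₐ[ℤ] B) =
        aeval fun i => j (f (X i)) := by
      ext i
      simp [hy]
    exact DFunLike.congr_fun this R
  · have := H _ (.inr ⟨p, hp, rfl⟩)
    rw [map_sub, aeval_map_algebraMap, aeval_C, sub_eq_zero, ← hθ, hg] at this
    exact this

/-- Elements of a smooth algebra over `fracSubalgebra A x` satisfying finitely many relations over
`A` can be lifted to a smooth algebra over `A`. -/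
theorem exists_smooth_of_smooth_fracSubalgebra (hAB : IsImmediateExt A B) (x : B) {S₂ : Type v}
    [CommRing S₂] [Algebra (fracSubalgebra A x) S₂] [Algebra.Smooth (fracSubalgebra A x) S₂]
    (φ₂ : S₂ →ₐ[fracSubalgebra A x] B) {ι : Type*} [Finite ι] (s : ι → S₂)
    (l : Set (MvPolynomial ι A)) (hl : l.Finite)
    (hls : ∀ R ∈ l, eval₂ ((algebraMap (fracSubalgebra A x) S₂).comp
      (algebraMap A (fracSubalgebra A x))) s R = 0) :
    ∃ (S : Type v) (_ : CommRing S) (_ : Algebra A S) (_ : Algebra.Smooth A S) (φ : S →ₐ[A] B)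
      (y : ι → S), (∀ i, φ (y i) = φ₂ (s i)) ∧ ∀ R ∈ l, aeval y R = 0 := by
  let T : Set A := ⋃ R ∈ l, (fun m => coeff m R) '' R.support
  have hT : T.Finite := hl.biUnion fun R _ => R.support.finite_toSet.image _
  obtain ⟨V₀, _, _, i, S₀, _, _, _, j, hi, hFi, hj, hij, hs⟩ :=
    Algebra.Smooth.exists_descent (W := fracSubalgebra A x) (S := S₂)
      (algebraMap A (fracSubalgebra A x) '' T) (hT.image _) s
  choose s₀ hs₀ using hs
  have hv : ∀ a : A, ∃ v : V₀, a ∈ T → i v = algebraMap A (fracSubalgebra A x) a := by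
    intro a
    by_cases ha : a ∈ T
    · obtain ⟨v, hv⟩ := hFi ⟨a, ha, rfl⟩
      exact ⟨v, fun _ => hv⟩
    · exact ⟨0, fun h => absurd h ha⟩
  choose v hv using hv
  obtain ⟨S₁, _, _, _, φ₁, θ, hφ₁, hθ⟩ := exists_smooth_lift hAB x
    ((fracSubalgebra A x).val.toRingHom.comp i) (fun v => (i v).2) ((fun a => (v a, a)) '' T)
    (hT.image _) (by
      rintro _ ⟨a, ha, rfl⟩
      exact congrArg Subtype.val (hv a ha))
  obtain ⟨S, _, _, _, k, φ, hφ, hφk, hk⟩ := Algebra.Smooth.exists_pushout θ φ₁.toRingHom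
    (φ₂.toRingHom.comp j) (fun v => by
      change φ₂ (j _) = φ₁ (θ v)
      rw [hij, hφ₁, φ₂.commutes]
      rfl)
  let : Algebra A S := ((algebraMap S₁ S).comp (algebraMap A S₁)).toAlgebra
  have : IsScalarTower A S₁ S := .of_algebraMap_eq fun _ => rfl
  refine ⟨S, inferInstance, inferInstance, Algebra.Smooth.comp A S₁ S,
    { φ with commutes' := fun a => (hφ _).trans (φ₁.commutes a) }, fun t => k (s₀ t),
    fun t => ?_, fun R hR => ?_⟩
  · exact (hφk _).trans (congrArg φ₂ (hs₀ t))
  · have hmem : ∀ m ∈ R.support, coeff m R ∈ T := fun m hm =>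
      Set.mem_biUnion hR ⟨m, hm, rfl⟩
    have h0 : ∑ d ∈ R.support, algebraMap V₀ S₀ (v (coeff d R)) * ∏ t ∈ d.support, s₀ t ^ d t
        = 0 := by
      refine hj ?_
      rw [map_zero, ← hls R hR, eval₂_eq, map_sum]
      refine Finset.sum_congr rfl fun d hd => ?_
      simp only [map_mul, map_prod, map_pow, hs₀, hij, hv _ (hmem d hd), RingHom.comp_apply]
    rw [aeval_def, eval₂_eq, ← map_zero k, ← h0, map_sum]
    refine Finset.sum_congr rfl fun d hd => ?_
    simp only [map_mul, map_prod, map_pow, hk, hθ _ ⟨_, hmem d hd, rfl⟩]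
    rfl

end Lift

section Systems
open MvPolynomial

/-- A finite system of polynomial equations over `A` that has a solution in an immediate extension
of `A` has a lift of this solution in a smooth `A`-algebra. -/
theorem IsImmediateExt.exists_smooth {B : Type v} [CommRing B] [IsDomain B] [ValuationRing B]
    [Algebra ℚ B] (n : ℕ) {A : Type v} [CommRing A] [Algebra A B] (hAB : IsImmediateExt A B)
    (w : Fin n → B) (l : Set (MvPolynomial (Fin n) A)) (hl : l.Finite)
    (hw : ∀ R ∈ l, aeval w R = 0) :
    ∃ (S : Type v) (_ : CommRing S) (_ : Algebra A S) (_ : Algebra.Smooth A S) (φ : S →ₐ[A] B)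
      (y : Fin n → S), (∀ i, φ (y i) = w i) ∧ ∀ R ∈ l, aeval y R = 0 := by
  induction n generalizing A with
  | zero =>
    refine ⟨A, inferInstance, inferInstance, inferInstance, Algebra.ofId A B, finZeroElim,
      finZeroElim, fun R hR => hAB.injective ?_⟩
    rw [map_zero, ← hw R hR, ← aeval_algebraMap_apply]
    congr 2
    exact Subsingleton.elim _ _
  | succ n ih =>
    let t : fracSubalgebra A (w 0) := ⟨w 0, self_mem_fracSubalgebra _⟩
    let r : MvPolynomial (Fin (n + 1)) A →+* MvPolynomial (Fin n) (fracSubalgebra A (w 0)) :=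
      eval₂Hom (C.comp (algebraMap A (fracSubalgebra A (w 0)))) (Fin.cons (C t) X)
    have hr : ∀ (S : Type v) [CommRing S] [Algebra (fracSubalgebra A (w 0)) S] (y : Fin n → S)
        (R : MvPolynomial (Fin (n + 1)) A), aeval y (r R) =
          eval₂ ((algebraMap (fracSubalgebra A (w 0)) S).comp
            (algebraMap A (fracSubalgebra A (w 0))))
            (Fin.cons (algebraMap _ S t) y) R := by
      intro S _ _ y R
      have : (aeval y).toRingHom.comp r =
          eval₂Hom ((algebraMap (fracSubalgebra A (w 0)) S).comp (algebraMap A _))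
            (Fin.cons (algebraMap _ S t) y) := by
        ext i
        · simp [r]
        · cases i using Fin.cases <;> simp [r]
      exact DFunLike.congr_fun this R
    obtain ⟨S₂, _, _, _, φ₂, y, hy, H⟩ := ih (hAB.over_fracSubalgebra (w 0))
      (fun i => w i.succ) (r '' l) (hl.image _) (by
        rintro _ ⟨R, hR, rfl⟩
        rw [hr, ← hw R hR, aeval_def]
        congr 1
        ext i
        cases i using Fin.cases <;> rfl)
    obtain ⟨S, i1, i2, i3, φ, z, hz, Hz⟩ := exists_smooth_of_smooth_fracSubalgebra hAB (w 0) φ₂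
      (Fin.cons (algebraMap _ S₂ t) y) l hl (fun R hR => by
        rw [← hr]
        exact H _ ⟨R, hR, rfl⟩)
    refine ⟨S, i1, i2, i3, φ, z, fun i => ?_, Hz⟩
    rw [hz]
    cases i using Fin.cases with
    | zero => exact φ₂.commutes t
    | succ i => exact hy i

theorem IsImmediateExt.of_hasTrivialValueGroupExt {V V' : Type*} [CommRing V] [IsDomain V]
    [ValuationRing V] [CommRing V'] [IsDomain V'] [Algebra V V']
    (hinj : Function.Injective (algebraMap V V')) [IsLocalHom (algebraMap V V')]
    (hvalue : (algebraMap V V').HasTrivialValueGroupExt) : IsImmediateExt V V' := by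
  have hdvd : ∀ a b : V, algebraMap V V' a ∣ algebraMap V V' b → a ∣ b := by
    rintro a b ⟨t, ht⟩
    rcases ValuationRing.dvd_total a b with h | ⟨c, rfl⟩
    · exact h
    · by_cases hb : b = 0
      · simp [hb]
      · have hc : algebraMap V V' c * t = 1 := by
          refine mul_left_cancel₀ ((map_ne_zero_iff _ hinj).mpr hb) ?_
          rw [mul_one, ← mul_assoc, ← map_mul, ← ht]
        have : IsUnit c := isUnit_of_map_unit (algebraMap V V') c (.of_mul_eq_one _ hc)
        exact this.mul_right_dvd.mpr dvd_rfl
  refine ⟨hinj, hdvd, fun b => ?_⟩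
  by_cases hb : b = 0
  · exact ⟨0, by rw [hb, map_zero]⟩
  · obtain ⟨a, d, -, hd, h⟩ := hvalue b 1 hb one_ne_zero
    rw [one_mul] at h
    obtain ⟨c, rfl⟩ := hdvd d a ((dvd_mul_left _ _).trans h.dvd)
    rw [map_mul, mul_comm (algebraMap V V' d)] at h
    exact ⟨c, (h.of_mul_right .rfl ((map_ne_zero_iff _ hinj).mpr hd)).symm⟩

theorem IsImmediateExt.range {V V' : Type*} [CommRing V] [CommRing V'] [Algebra V V']
    (h : IsImmediateExt V V') : IsImmediateExt (Algebra.ofId V V').range V' where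
  injective := Subtype.val_injective
  dvd_of_dvd := by
    rintro ⟨_, a, rfl⟩ ⟨_, b, rfl⟩ hab
    exact map_dvd (Algebra.ofId V V').rangeRestrict (h.dvd_of_dvd a b hab)
  exists_associated b := by
    obtain ⟨a, ha⟩ := h.exists_associated b
    exact ⟨(Algebra.ofId V V').rangeRestrict a, ha⟩

/-- A smooth algebra in any universe is isomorphic to one in the universe of the base ring. -/
theorem Algebra.Smooth.exists_algEquiv (V : Type u) (S : Type v) [CommRing V] [CommRing S]
    [Algebra V S] [Algebra.Smooth V S] :
    ∃ (S' : Type u) (_ : CommRing S') (_ : Algebra V S'),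
      Algebra.Smooth V S' ∧ Nonempty (S' ≃ₐ[V] S) := by
  obtain ⟨n, f, hf, -⟩ := Algebra.FinitePresentation.out (R := V) (A := S)
  let e := Ideal.quotientKerAlgEquivOfSurjective hf
  exact ⟨_, inferInstance, inferInstance, Algebra.Smooth.of_equiv e.symm, ⟨e⟩⟩

end Systems

/-- An extension `V ⊆ V'` of valuation rings containing `ℚ` whose value group
extension is trivial is ind-smooth (no finiteness assumption on the fraction field extension). -/
theorem trivial_value_group_extension_isIndSmooth
    (V : Type u) (V' : Type v) [CommRing V] [IsDomain V] [ValuationRing V]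
    [CommRing V'] [IsDomain V'] [ValuationRing V']
    [Algebra ℚ V] [Algebra ℚ V'] [Algebra V V']
    (hinj : Function.Injective (algebraMap V V'))
    [IsLocalHom (algebraMap V V')]
    (hvalue : (algebraMap V V').HasTrivialValueGroupExt) :
    (algebraMap V V').IsIndSmooth := by
  intro E _ _ _ ω hω
  have him := IsImmediateExt.of_hasTrivialValueGroupExt hinj hvalue
  let A : Subalgebra V V' := (Algebra.ofId V V').range
  obtain ⟨n, f, hf, G, hG⟩ := Algebra.FinitePresentation.out (R := V) (A := E)
  let ω' : E →ₐ[V] V' := { ω with commutes' := fun a => DFunLike.congr_fun hω a }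
  have key : ∀ R : MvPolynomial (Fin n) V,
      MvPolynomial.aeval (fun i => ω (f (MvPolynomial.X i))) R = ω (f R) := by
    intro R
    have : (MvPolynomial.aeval fun i => ω (f (MvPolynomial.X i)) :
        MvPolynomial (Fin n) V →ₐ[V] V') = ω'.comp f := by
      ext i
      simp [ω']
    exact DFunLike.congr_fun this R
  obtain ⟨S, _, _, _, φ, y, hy, H⟩ := him.range.exists_smooth n (fun i => ω (f (MvPolynomial.X i)))
    (MvPolynomial.map (algebraMap V A) '' G) (G.finite_toSet.image _) (by
      rintro _ ⟨R, hR, rfl⟩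
      have : f R = 0 := by
        have : R ∈ RingHom.ker f.toRingHom := hG ▸ Ideal.subset_span hR
        exact this
      rw [MvPolynomial.aeval_map_algebraMap, key, this, map_zero])
  let : Algebra V S := ((algebraMap A S).comp (algebraMap V A)).toAlgebra
  have : IsScalarTower V A S := .of_algebraMap_eq fun _ => rfl
  have : Algebra.Smooth V A := .of_equiv (AlgEquiv.ofInjective (Algebra.ofId V V') hinj)
  have : Algebra.Smooth V S := .comp V A S
  obtain ⟨S', _, _, hS', ⟨e⟩⟩ := Algebra.Smooth.exists_algEquiv V S
  have hker : RingHom.ker f ≤ RingHom.ker (MvPolynomial.aeval y : _ →ₐ[V] S) := by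
    change RingHom.ker f.toRingHom ≤ _
    rw [← hG, Ideal.span_le]
    intro R hR
    have := H _ ⟨R, hR, rfl⟩
    rwa [MvPolynomial.aeval_map_algebraMap] at this
  let g : E →ₐ[V] S := (Ideal.Quotient.liftₐ _ (MvPolynomial.aeval y) hker).comp
    (Ideal.quotientKerAlgEquivOfSurjective hf).symm.toAlgHom
  have hg : ∀ R, g (f R) = MvPolynomial.aeval y R := by
    intro R
    have : (Ideal.quotientKerAlgEquivOfSurjective hf).symm (f R) = Ideal.Quotient.mk _ R := by
      rw [AlgEquiv.symm_apply_eq]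
      rfl
    change Ideal.Quotient.liftₐ _ (MvPolynomial.aeval y) hker
      ((Ideal.quotientKerAlgEquivOfSurjective hf).symm (f R)) = _
    rw [this]
    rfl
  refine ⟨S', inferInstance, inferInstance, hS', e.symm.toAlgHom.comp g,
    φ.toRingHom.comp (e : S' →+* S), ?_, ?_⟩
  · ext a
    obtain ⟨R, rfl⟩ := hf a
    change φ (e (e.symm (g (f R)))) = ω (f R)
    rw [e.apply_symm_apply, hg, ← key]
    have : ((φ.restrictScalars V).comp (MvPolynomial.aeval y) : MvPolynomial (Fin n) V →ₐ[V] V') =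
        MvPolynomial.aeval fun i => ω (f (MvPolynomial.X i)) := by
      ext i
      simp [hy]
    exact DFunLike.congr_fun this R
  · ext a
    change φ (e (algebraMap V S' a)) = _
    rw [e.commutes]
    exact φ.commutes _
end
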